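/- Let E_i = (K_1^{(i)},…,K_{t_i}^{(i)}), 1 ≤ i ≤ p, be p tuples of convex bodies in ℝ^n, and let λ^1,…,λ^p be partitions with λ^i_1 ≤ t_i and Σ_{i=1}^p |λ^i| = n−2. Define Θ : (pairs of convex bodies in ℝ^n) → ℝ by Θ(M,N) = V(s_{λ^1}(E_1),…,s_{λ^p}(E_p), M, N), interpreted by multilinear expansion of the Schur polynomials into mixed volumes. Then for all convex bodies M, N in ℝ^n: Θ(M,N)² ≥ Θ(M,M)·Θ(N,N). -/

import Mathlib

set_option linter.unusedSectionVars false
set_option linter.unusedVariables false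

open MeasureTheory
open scoped Pointwise

namespace ConvexPaper

abbrev En (n : ℕ) := EuclideanSpace ℝ (Fin n)

noncomputable def mixedVol (n : ℕ) (L : List (Set (En n))) : ℝ :=
  ((n.factorial : ℝ))⁻¹ *
    ∑ S ∈ (Finset.range n).powerset.filter (fun S => S.Nonempty),
      (-1 : ℝ) ^ (n - S.card) * (volume (∑ i ∈ S, L.getD i 0)).toReal

/-- Elementary symmetric polynomial with integer index (`σ_k = 0` for `k < 0`). -/
noncomputable def esymmZ (e : ℕ) (k : ℤ) : MvPolynomial (Fin e) ℝ :=
  if 0 ≤ k then MvPolynomial.esymm (Fin e) ℝ k.toNat else 0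

/-- The Schur polynomial `s_λ = det[σ_{λ_i − i + j}]_{i,j=1}^N` in `e` variables,
for `λ : Fin N → ℕ`. -/
noncomputable def schur (e N : ℕ) (lam : Fin N → ℕ) : MvPolynomial (Fin e) ℝ :=
  (Matrix.of fun i j : Fin N =>
    esymmZ e ((lam i : ℤ) - ((i : ℕ) : ℤ) + ((j : ℕ) : ℤ))).det

/-- The product `∏_i s_{λ^i}(E_i)` of Schur polynomials, each in its own block of
variables, as a polynomial in the variables `(i : Fin p) × Fin (t i)`. -/
noncomputable def schurProd (p : ℕ) (t : Fin p → ℕ) (N : Fin p → ℕ)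
    (lam : ∀ i, Fin (N i) → ℕ) :
    MvPolynomial ((i : Fin p) × Fin (t i)) ℝ :=
  ∏ i : Fin p, MvPolynomial.rename (fun j => ⟨i, j⟩) (schur (t i) (N i) (lam i))

/-- Multilinear expansion of a polynomial into mixed volumes: each monomial
`c_μ·x^μ` of `P` contributes `c_μ` times the mixed volume of the bodies `K i`
with multiplicities `μ i`, together with the list `rest` of remaining arguments. -/
noncomputable def polyMixedVol (n : ℕ) {ι : Type} [Fintype ι]
    (P : MvPolynomial ι ℝ) (K : ι → Set (En n)) (rest : List (Set (En n))) : ℝ :=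
  ∑ μ ∈ P.support, P.coeff μ *
    mixedVol n
      (((Finset.univ : Finset ι).toList.map fun i => List.replicate (μ i) (K i)).flatten
        ++ rest)

end ConvexPaper

section PartA
namespace AFS

/-- A symmetric bilinear form with at most one positive direction. -/
def Lor {V : Type*} [AddCommGroup V] [Module ℝ V] (q : V →ₗ[ℝ] V →ₗ[ℝ] ℝ) : Prop :=
  (∀ x y, q x y = q y x) ∧ ∀ x y, 0 < q x x → q x x * q y y ≤ q x y ^ 2

section Lor
variable {V : Type*} [AddCommGroup V] [Module ℝ V] {V' : Type*} [AddCommGroup V'] [Module ℝ V']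

theorem quad_expand (q : V →ₗ[ℝ] V →ₗ[ℝ] ℝ) (hs : ∀ x y, q x y = q y x) (a b : ℝ) (x y : V) :
    q (a • x + b • y) (a • x + b • y) = a ^ 2 * q x x + 2 * a * b * q x y + b ^ 2 * q y y := by
  simp only [map_add, map_smul, LinearMap.add_apply, LinearMap.smul_apply, smul_eq_mul]
  rw [hs y x]; ring

theorem Lor.of_hyper (q : V →ₗ[ℝ] V →ₗ[ℝ] ℝ) (hs : ∀ x y, q x y = q y x) (θ : V →ₗ[ℝ] ℝ)
    (h : ∀ x, θ x = 0 → q x x ≤ 0) : Lor q := by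
  refine ⟨hs, fun x y hx => ?_⟩
  have hu := h (θ y • x + (-θ x) • y) (by simp; ring)
  rw [quad_expand q hs] at hu
  have hθ : θ x ≠ 0 := fun h0 => absurd (h x h0) (not_le.mpr hx)
  have h2 : 0 < θ x ^ 2 := by positivity
  by_contra hc
  push Not at hc
  have h3 : 0 < θ x ^ 2 * (q x x * q y y - q x y ^ 2) := mul_pos h2 (by linarith)
  nlinarith [sq_nonneg (θ y * q x x - θ x * q x y), mul_nonneg hx.le (neg_nonneg.mpr hu)]

theorem Lor.of_orth (q : V →ₗ[ℝ] V →ₗ[ℝ] ℝ) (hs : ∀ x y, q x y = q y x) (v : V)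
    (h : ∀ x, q v x = 0 → q x x ≤ 0) : Lor q :=
  Lor.of_hyper q hs (q v) h

theorem Lor.orth {q : V →ₗ[ℝ] V →ₗ[ℝ] ℝ} (hq : Lor q) {v : V} (hv : 0 < q v v) {x : V}
    (hx : q v x = 0) : q x x ≤ 0 := by
  have := hq.2 v x hv
  rw [hx] at this
  by_contra hc
  push Not at hc
  nlinarith [mul_pos hv hc]

theorem Lor.of_le {q : V →ₗ[ℝ] V →ₗ[ℝ] ℝ} (hs : ∀ x y, q x y = q y x)
    {q' : V' →ₗ[ℝ] V' →ₗ[ℝ] ℝ} (hq' : Lor q') (f : V →ₗ[ℝ] V')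
    (h : ∀ x, q x x ≤ q' (f x) (f x)) : Lor q := by
  refine ⟨hs, fun x y hx => ?_⟩
  by_contra hc
  push Not at hc
  have hX' : 0 < q' (f x) (f x) := lt_of_lt_of_le hx (h x)
  set X' := q' (f x) (f x)
  set s := q' (f x) (f y) / X' with hsdef
  have h1 := h ((-s) • x + (1:ℝ) • y)
  rw [quad_expand q hs, map_add, map_smul, map_smul, quad_expand q' hq'.1] at h1
  have h2 : q' (f x) (f y) = s * X' := by rw [hsdef]; field_simp
  have h3 := hq'.2 (f x) (f y) hX'
  rw [h2] at h1 h3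
  have h4 : q' (f y) (f y) ≤ s ^ 2 * X' := by
    have : X' * q' (f y) (f y) ≤ X' * (s ^ 2 * X') := by
      calc _ ≤ _ := h3
        _ = _ := by ring
    exact le_of_mul_le_mul_left this hX'
  have h5 : s ^ 2 * q x x - 2 * s * q x y + q y y ≤ 0 := by
    have : (-s) ^ 2 * X' + 2 * (-s) * 1 * (s * X') + 1 ^ 2 * q' (f y) (f y) ≤ 0 := by
      nlinarith
    nlinarith
  nlinarith [sq_nonneg (s * q x x - q x y), mul_nonneg hx.le (neg_nonneg.mpr h5)]

theorem Lor.comp {q' : V' →ₗ[ℝ] V' →ₗ[ℝ] ℝ} (hq' : Lor q') {q : V →ₗ[ℝ] V →ₗ[ℝ] ℝ}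
    (f : V →ₗ[ℝ] V') (h : ∀ x y, q x y = q' (f x) (f y)) : Lor q :=
  Lor.of_le (fun x y => by rw [h, h, hq'.1]) hq' f (fun x => (h x x).le)

theorem Lor.zero {q : V →ₗ[ℝ] V →ₗ[ℝ] ℝ} (h : ∀ x y, q x y = 0) : Lor q :=
  ⟨fun x y => by rw [h, h], fun x y hx => by rw [h] at hx; exact absurd hx (lt_irrefl _)⟩

/-- Lorentzian forms: a Bochner-type bound for one form. -/
theorem Lor.bochner {q : V →ₗ[ℝ] V →ₗ[ℝ] ℝ} (hq : Lor q) {v : V} (hv : 0 < q v v) (x : V) :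
    q x x ≤ q v x ^ 2 / q v v := by
  rw [le_div_iff₀ hv]
  have := hq.2 v x hv
  linarith

/-- Two-divisor trickle down. -/
theorem Lor.two (q qE qM : V →ₗ[ℝ] V →ₗ[ℝ] ℝ) (E M : V)
    (hs : ∀ x y, q x y = q y x) (hE : Lor qE) (hM : Lor qM)
    (hsum : ∀ x, q x x = qE x x + qM x x)
    (h1 : ∀ x, qE (E + M) x = q E x) (h2 : ∀ x, qM (E + M) x = q M x)
    (hpE : 0 < qE (E + M) (E + M)) (hpM : 0 < qM (E + M) (E + M)) (hc : 0 < q E M) : Lor q := by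
  refine Lor.of_orth q hs (E + M) fun x hx => ?_
  have hB : ∀ x, q x x ≤ q E x ^ 2 / qE (E + M) (E + M) + q M x ^ 2 / qM (E + M) (E + M) := by
    intro x
    rw [hsum, ← h1, ← h2]
    exact add_le_add (hE.bochner hpE x) (hM.bochner hpM x)
  set A := q E E
  set B := q M M
  set c := q E M
  have hpE' : qE (E + M) (E + M) = A + c := by rw [h1, map_add]
  have hpM' : qM (E + M) (E + M) = B + c := by rw [h2, map_add, hs M E, add_comm]
  rw [hpE', hpM'] at hB
  rw [hpE'] at hpE
  rw [hpM'] at hpM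
  set β := q E x with hβ
  have hMx : q M x = -β := by
    rw [map_add, LinearMap.add_apply] at hx; linarith
  set κ := c ^ 2 - A * B with hκ
  set u : V := (B + c) • E + (-(A + c)) • M with hu
  have hgen : ∀ y, q u y = (B + c) * q E y - (A + c) * q M y := by
    intro y
    rw [hu, map_add, LinearMap.add_apply, map_smul, map_smul, LinearMap.smul_apply,
      LinearMap.smul_apply, smul_eq_mul, smul_eq_mul]
    ring
  have huE : q E u = -κ := by
    rw [hs, hgen, hs M E]; change (B + c) * A - (A + c) * c = _; rw [hκ]; ring
  have huM : q M u = κ := by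
    rw [hs, hgen]; change (B + c) * c - (A + c) * B = _; rw [hκ]; ring
  have huu : q u u = -κ * (A + B + 2 * c) := by
    rw [hgen, huE, huM]; ring
  have hux : q u x = β * (A + B + 2 * c) := by
    rw [hgen, hMx, ← hβ]; ring
  set p := A + B + 2 * c with hp
  have hpp : 0 < p := by rw [hp]; linarith
  have hinv : 1 / (A + c) + 1 / (B + c) = p / ((A + c) * (B + c)) := by
    field_simp; rw [hp]; ring
  have hP : 0 < (A + c) * (B + c) := mul_pos hpE hpM
  -- key: κ ≥ 0
  have hκ0 : 0 ≤ κ := by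
    have := hB u
    rw [huu, huE, huM] at this
    have h3 : (-κ) ^ 2 / (A + c) + κ ^ 2 / (B + c) = κ ^ 2 * (p / ((A + c) * (B + c))) := by
      rw [← hinv]; ring
    rw [h3] at this
    by_contra hneg
    push Not at hneg
    have h4 : -κ * p * ((A + c) * (B + c)) ≤ κ ^ 2 * p := by
      have := mul_le_mul_of_nonneg_right this hP.le
      calc _ ≤ _ := this
        _ = _ := by field_simp
    have h5 : (A + c) * (B + c) ≤ -κ := by
      have : (-κ * p) * ((A + c) * (B + c)) ≤ (-κ * p) * (-κ) := by nlinarith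
      exact le_of_mul_le_mul_left this (mul_pos (by linarith) hpp)
    have : c * p ≤ 0 := by rw [hp]; nlinarith
    exact absurd (mul_pos hc hpp) (not_lt.mpr this)
  have key : ∀ s : ℝ, q x x + 2 * s * (β * p) + s ^ 2 * (-κ * p) ≤
      (β - s * κ) ^ 2 * (p / ((A + c) * (B + c))) := by
    intro s
    have h6 := hB ((1:ℝ) • x + s • u)
    rw [quad_expand q hs, hs x u, hux, huu] at h6
    simp only [map_add, map_smul, huE, huM, hMx, ← hβ, smul_eq_mul] at h6
    rw [← hinv]
    calc _ = _ := by ring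
      _ ≤ _ := h6
      _ = _ := by ring
  rcases hκ0.eq_or_lt with h0 | hpos
  · by_cases hb : β = 0
    · have := key 0
      simp [hb] at this
      exact this
    · exfalso
      set C := p / ((A + c) * (B + c))
      have := key ((β ^ 2 * C - q x x + 1) / (2 * (β * p)))
      rw [← h0] at this
      have h7 : 2 * ((β ^ 2 * C - q x x + 1) / (2 * (β * p))) * (β * p) = β ^ 2 * C - q x x + 1 := by
        field_simp
      rw [h7] at this
      simp at this
      linarith
  · have := key (β / κ)
    have h8 : β - β / κ * κ = 0 := by field_simp; ring
    rw [h8] at this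
    have h9 : 2 * (β / κ) * (β * p) + (β / κ) ^ 2 * (-κ * p) = β ^ 2 * p / κ := by field_simp; ring
    have h10 : 0 ≤ β ^ 2 * p / κ := by positivity
    have h11 : (0:ℝ) ^ 2 * (p / ((A + c) * (B + c))) = 0 := by simp
    rw [h11] at this
    linarith

end Lor

end AFS
end PartA

section PartB
namespace AFS

section Sch
variable {A : Type*} [CommRing A]

/-- lower the `b`-th entry. -/
def sh (ν : ℕ → ℤ) (b : ℕ) : ℕ → ℤ := Function.update ν b (ν b - 1)

/-- delete the `b`-th entry and lower all the others. -/
def del (ν : ℕ → ℤ) (b : ℕ) : ℕ → ℤ := fun k => (if k < b then ν k else ν (k + 1)) - 1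

/-- swap adjacent entries. -/
def sw (ν : ℕ → ℤ) (b : ℕ) : ℕ → ℤ := fun k => ν (Equiv.swap b (b + 1) k)

def KK (x : A) (Q : (ℕ → ℤ) → A) : ℕ → ℕ → (ℕ → ℤ) → A
  | _, 0, _ => 0
  | 0, d + 1, ν => x ^ d * Q ν
  | a + 1, d + 1, ν => KK x Q a (d + 1) ν + KK x Q (a + 1) d (sh ν a)

def QQ (P : (ℕ → ℤ) → A) (r : ℕ) (ν : ℕ → ℤ) : A :=
  ∑ b ∈ Finset.range (r + 1), if ν b = 1 then (-1) ^ b * P (del ν b) else 0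

def PP (N : ℕ) (x : ℕ → A) : ℕ → (ℕ → ℤ) → A
  | 0, _ => 1
  | r + 1, ν => KK (x r) (QQ (PP N x r) r) (r + 1) (N + 1) ν

theorem KK_zero (x : A) (Q) (a ν) : KK x Q a 0 ν = 0 := by cases a <;> rw [KK]
theorem KK_zero_succ (x : A) (Q) (d ν) : KK x Q 0 (d + 1) ν = x ^ d * Q ν := by rw [KK]
theorem KK_succ (x : A) (Q) (a d ν) :
    KK x Q (a + 1) (d + 1) ν = KK x Q a (d + 1) ν + KK x Q (a + 1) d (sh ν a) := by rw [KK]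

theorem sh_same (ν : ℕ → ℤ) (b : ℕ) : sh ν b b = ν b - 1 := by simp [sh]
theorem sh_ne (ν : ℕ → ℤ) {b c : ℕ} (h : c ≠ b) : sh ν b c = ν c := by simp [sh, h]
theorem sh_apply (ν : ℕ → ℤ) (b c : ℕ) : sh ν b c = if c = b then ν c - 1 else ν c := by
  simp only [sh, Function.update_apply]; split_ifs with h
  · rw [h]
  · rfl
theorem sh_comm (ν : ℕ → ℤ) (b c : ℕ) : sh (sh ν b) c = sh (sh ν c) b := by
  funext k; simp only [sh_apply]; split_ifs <;> rfl

theorem sw_sh (ν : ℕ → ℤ) (b c : ℕ) : sh (sw ν b) c = sw (sh ν (Equiv.swap b (b + 1) c)) b := by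
  funext k
  simp only [sh_apply, sw]
  by_cases h : k = c
  · simp [h]
  · rw [if_neg h, if_neg (fun h' => h ((Equiv.swap b (b + 1)).injective h'))]

theorem sw_sh_left (ν : ℕ → ℤ) (b : ℕ) : sh (sw ν b) b = sw (sh ν (b + 1)) b := by
  rw [sw_sh, Equiv.swap_apply_left]
theorem sw_sh_right (ν : ℕ → ℤ) (b : ℕ) : sh (sw ν b) (b + 1) = sw (sh ν b) b := by
  rw [sw_sh, Equiv.swap_apply_right]
theorem sw_sh_ne (ν : ℕ → ℤ) (b c : ℕ) (h1 : c ≠ b) (h2 : c ≠ b + 1) :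
    sh (sw ν b) c = sw (sh ν c) b := by
  rw [sw_sh, Equiv.swap_apply_of_ne_of_ne h1 h2]

/-- antisymmetry at adjacent pair `b`, `b+1`. -/
def Anti (F : (ℕ → ℤ) → A) (b : ℕ) : Prop := ∀ ν, F (sw ν b) = - F ν
/-- vanishing at nonpositive entry. -/
def Van (F : (ℕ → ℤ) → A) (b : ℕ) : Prop := ∀ ν, ν b ≤ 0 → F ν = 0

theorem KK_van (x : A) (Q : (ℕ → ℤ) → A) (b : ℕ) (h : Van Q b) (a d : ℕ) :
    Van (KK x Q a d) b := by
  induction d generalizing a with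
  | zero => intro ν _; exact KK_zero _ _ _ _
  | succ d ihd =>
    induction a with
    | zero => intro ν hν; rw [KK_zero_succ, h ν hν, mul_zero]
    | succ a iha =>
      intro ν hν
      rw [KK_succ, iha ν hν, ihd, add_zero]
      rw [sh_apply]; split_ifs <;> linarith

theorem KK_anti_ge (x : A) (Q : (ℕ → ℤ) → A) (b : ℕ) (h : Anti Q b) (a d : ℕ) (hab : a ≤ b) :
    Anti (KK x Q a d) b := by
  induction d generalizing a with
  | zero => intro ν; simp [KK_zero]
  | succ d ihd =>
    induction a with
    | zero => intro ν; rw [KK_zero_succ, KK_zero_succ, h ν, mul_neg]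
    | succ a iha =>
      intro ν
      rw [KK_succ, KK_succ, iha (by omega) ν, sw_sh_ne _ _ _ (by omega) (by omega),
        ihd (a + 1) hab]
      ring

theorem KK_two (x : A) (Q : (ℕ → ℤ) → A) (a d : ℕ) (ν : ℕ → ℤ) :
    KK x Q (a + 2) (d + 2) ν = KK x Q a (d + 2) ν + KK x Q (a + 2) (d + 1) (sh ν a)
      + KK x Q (a + 2) (d + 1) (sh ν (a + 1)) - KK x Q (a + 2) d (sh (sh ν a) (a + 1)) := by
  have h1 : KK x Q (a + 2) (d + 2) ν = KK x Q (a + 1) (d + 2) ν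
    + KK x Q (a + 2) (d + 1) (sh ν (a + 1)) := KK_succ _ _ _ _ _
  have h2 : KK x Q (a + 1) (d + 2) ν = KK x Q a (d + 2) ν
    + KK x Q (a + 1) (d + 1) (sh ν a) := KK_succ _ _ _ _ _
  have h3 : KK x Q (a + 2) (d + 1) (sh ν a) = KK x Q (a + 1) (d + 1) (sh ν a)
    + KK x Q (a + 2) d (sh (sh ν a) (a + 1)) := KK_succ _ _ _ _ _
  rw [h1, h2, h3]; ring

theorem KK_one (x : A) (Q : (ℕ → ℤ) → A) (a : ℕ) (ν : ℕ → ℤ) : KK x Q a 1 ν = Q ν := by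
  induction a with
  | zero => simp [KK_zero_succ]
  | succ a ih => rw [KK_succ, ih, KK_zero, add_zero]

theorem KK_anti_lt (x : A) (Q : (ℕ → ℤ) → A) (b : ℕ) (h : Anti Q b) (a d : ℕ) (hab : b + 2 ≤ a) :
    Anti (KK x Q a d) b := by
  induction a, hab using Nat.le_induction generalizing d with
  | base =>
    induction d using Nat.strong_induction_on with
    | _ d ih =>
      match d with
      | 0 => intro ν; simp [KK_zero]
      | 1 => intro ν; rw [KK_one, KK_one, h]
      | d + 2 =>
        intro ν
        rw [KK_two, KK_two, sw_sh_left, sw_sh_right, sw_sh_right, KK_anti_ge x Q b h b _ le_rfl,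
          ih (d + 1) (by omega), ih (d + 1) (by omega), ih d (by omega), sh_comm ν b (b + 1)]
        ring
  | succ a hab iha =>
    induction d with
    | zero => intro ν; simp [KK_zero]
    | succ d ihd =>
      intro ν
      rw [KK_succ, KK_succ, iha (d + 1) ν, sw_sh_ne _ _ _ (by omega) (by omega), ihd]
      ring

theorem del_sw_left (ν : ℕ → ℤ) (b : ℕ) : del (sw ν b) b = del ν (b + 1) := by
  funext k
  simp only [del, sw, Equiv.swap_apply_def]
  split_ifs <;> first | rfl | omega | (congr 2; omega)

theorem del_sw_right (ν : ℕ → ℤ) (b : ℕ) : del (sw ν b) (b + 1) = del ν b := by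
  funext k
  simp only [del, sw, Equiv.swap_apply_def]
  split_ifs <;> first | rfl | omega | (congr 2; omega)

theorem del_sw_lt (ν : ℕ → ℤ) (b c : ℕ) (h : c < b) : del (sw ν b) c = sw (del ν c) (b - 1) := by
  funext k
  simp only [del, sw, Equiv.swap_apply_def]
  split_ifs <;> first | rfl | omega | (congr 2; omega)

theorem del_sw_gt (ν : ℕ → ℤ) (b c : ℕ) (h : b + 1 < c) : del (sw ν b) c = sw (del ν c) b := by
  funext k
  simp only [del, sw, Equiv.swap_apply_def]
  split_ifs <;> first | rfl | omega | (congr 2; omega)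

theorem QQ_anti (P : (ℕ → ℤ) → A) (r : ℕ) (hP : ∀ b, b + 1 < r → Anti P b) (b : ℕ)
    (hb : b + 1 < r + 1) : Anti (QQ P r) b := by
  intro ν
  rw [QQ, QQ, ← Finset.sum_neg_distrib]
  refine Finset.sum_equiv (Equiv.swap b (b + 1)) ?_ ?_
  · intro c
    simp only [Finset.mem_range, Equiv.swap_apply_def]
    split_ifs <;> omega
  · intro c hc
    rw [Finset.mem_range] at hc
    have hsw : sw ν b c = ν (Equiv.swap b (b + 1) c) := rfl
    rw [hsw]
    split_ifs with h1
    · rcases lt_trichotomy c b with h | h | h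
      · rw [Equiv.swap_apply_of_ne_of_ne (by omega) (by omega), del_sw_lt _ _ _ h,
          hP _ (by omega)]; ring
      · subst h; rw [Equiv.swap_apply_left, del_sw_left]; ring
      · rcases (Nat.succ_le_of_lt h).eq_or_lt with h' | h'
        · have : c = b + 1 := h'.symm
          subst this; rw [Equiv.swap_apply_right, del_sw_right]; ring
        · rw [Equiv.swap_apply_of_ne_of_ne (by omega) (by omega), del_sw_gt _ _ _ h',
            hP _ (by omega)]; ring
    · simp

theorem QQ_van (P : (ℕ → ℤ) → A) (r : ℕ) (hP : ∀ b, b < r → Van P b) (b : ℕ)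
    (hb : b < r + 1) : Van (QQ P r) b := by
  intro ν hν
  refine Finset.sum_eq_zero fun c hc => ?_
  rw [Finset.mem_range] at hc
  split_ifs with h1
  · have hbc : b ≠ c := by rintro rfl; omega
    rcases lt_or_gt_of_ne hbc with h | h
    · rw [hP b (by omega), mul_zero]; simp [del, h]; omega
    · rw [hP (b - 1) (by omega), mul_zero]
      simp only [del]; rw [if_neg (by omega), Nat.sub_add_cancel (by omega)]; omega
  · rfl

theorem QQ_big (P : (ℕ → ℤ) → A) (r : ℕ) (ν : ℕ → ℤ) (h : ∀ b, b < r + 1 → ν b ≠ 1) :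
    QQ P r ν = 0 := by
  refine Finset.sum_eq_zero fun c hc => ?_
  rw [Finset.mem_range] at hc
  rw [if_neg (h c hc)]

theorem QQ_one (P : (ℕ → ℤ) → A) (r : ℕ) (hP : ∀ b, b < r → Van P b) (ν : ℕ → ℤ) (h : ν 0 = 1) :
    QQ P r ν = P (del ν 0) := by
  rw [QQ, Finset.sum_eq_single 0]
  · simp [h]
  · intro c hc hc0
    rw [Finset.mem_range] at hc
    split_ifs with h1
    · rw [hP 0 (by omega), mul_zero]; simp [del, Nat.pos_of_ne_zero hc0, h]
    · rfl
  · simp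

theorem PP_prop (N : ℕ) (x : ℕ → A) (r : ℕ) :
    (∀ b, b < r → Van (PP N x r) b) ∧ (∀ b, b + 1 < r → Anti (PP N x r) b) := by
  induction r with
  | zero => exact ⟨fun b hb => absurd hb (by omega), fun b hb => absurd hb (by omega)⟩
  | succ r ih =>
    refine ⟨fun b hb => ?_, fun b hb => ?_⟩
    · exact KK_van _ _ _ (QQ_van _ _ ih.1 b hb) _ _
    · exact KK_anti_lt _ _ _ (QQ_anti _ _ ih.2 b hb) _ _ (by omega)

theorem Anti.eq_zero [NoZeroDivisors A] [CharZero A] {F : (ℕ → ℤ) → A} {b : ℕ} (h : Anti F b)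
    {ν : ℕ → ℤ} (hν : ν b = ν (b + 1)) : F ν = 0 := by
  have h1 := h ν
  have : sw ν b = ν := by
    funext k; simp only [sw, Equiv.swap_apply_def]; split_ifs with h1 h2
    · rw [h1, hν]
    · rw [h2, hν]
    · rfl
  rw [this] at h1
  exact self_eq_neg.mp h1

end Sch
end AFS
end PartB

section PartC
namespace AFS

open MvPolynomial

section Forms
variable {σ : Type} [Fintype σ]

abbrev Fn (σ : Type) := ℕ → (ℕ → ℤ) → MvPolynomial σ ℝ

noncomputable def ell : (σ → ℝ) →ₗ[ℝ] MvPolynomial σ ℝ :=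
  Fintype.linearCombination ℝ (fun s => (X s : MvPolynomial σ ℝ))

theorem ell_single [DecidableEq σ] (s : σ) (c : ℝ) : ell (Pi.single s c) = c • (X s : MvPolynomial σ ℝ) := by
  rw [ell, Fintype.linearCombination_apply_single]

noncomputable def opT (b : ℕ) : Module.End ℝ (Fn σ) where
  toFun F := fun d ν => F d (sh ν b)
  map_add' _ _ := rfl
  map_smul' _ _ := rfl

noncomputable def opO : Module.End ℝ (Fn σ) where
  toFun F := fun d ν => F (d + 1) ν
  map_add' _ _ := rfl
  map_smul' _ _ := rfl

noncomputable def opM : MvPolynomial σ ℝ →ₗ[ℝ] Module.End ℝ (Fn σ) where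
  toFun p :=
    { toFun := fun F d ν => p * F d ν
      map_add' := fun F G => by funext d ν; simp [mul_add]
      map_smul' := fun c F => by funext d ν; simp }
  map_add' p q := by ext1 F; funext d ν; simp [add_mul]
  map_smul' c p := by ext1 F; funext d ν; simp

abbrev Wt (σ : Type) := (σ → ℝ) × (ℕ → ℝ) × ℝ

noncomputable def LL (r : ℕ) : Wt σ →ₗ[ℝ] Module.End ℝ (Fn σ) where
  toFun w := opM (ell w.1) + ∑ b ∈ Finset.range r, w.2.1 b • opT b + w.2.2 • opO
  map_add' w w' := by
    simp only [Prod.fst_add, Prod.snd_add, map_add, Pi.add_apply, add_smul, Finset.sum_add_distrib]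
    abel
  map_smul' c w := by
    simp only [Prod.smul_fst, Prod.smul_snd, map_smul, Pi.smul_apply, smul_assoc, Finset.smul_sum,
      RingHom.id_apply, smul_add]

theorem LL_apply (r : ℕ) (w : Wt σ) (F : Fn σ) (d : ℕ) (ν : ℕ → ℤ) :
    LL r w F d ν = ell w.1 * F d ν + ∑ b ∈ Finset.range r, w.2.1 b • F d (sh ν b)
      + w.2.2 • F (d + 1) ν := by
  simp [LL, opM, opT, opO, LinearMap.add_apply, LinearMap.sum_apply, LinearMap.smul_apply]

theorem opT_comm (b c : ℕ) : Commute (opT b : Module.End ℝ (Fn σ)) (opT c) := by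
  ext1 F; funext d ν
  simp only [Module.End.mul_apply, opT, LinearMap.coe_mk, AddHom.coe_mk]
  rw [sh_comm]

theorem opTO_comm (b : ℕ) : Commute (opT b : Module.End ℝ (Fn σ)) opO := rfl
theorem opTM_comm (b : ℕ) (p : MvPolynomial σ ℝ) : Commute (opT b : Module.End ℝ (Fn σ)) (opM p) := rfl
theorem opOM_comm (p : MvPolynomial σ ℝ) : Commute (opO : Module.End ℝ (Fn σ)) (opM p) := rfl
theorem opM_comm (p p' : MvPolynomial σ ℝ) : Commute (opM p : Module.End ℝ (Fn σ)) (opM p') := by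
  ext1 F; funext d ν
  simp only [Module.End.mul_apply, opM, LinearMap.coe_mk, AddHom.coe_mk]
  ring

theorem LL_comm_of (r : ℕ) (w : Wt σ) (S : Module.End ℝ (Fn σ)) (h1 : ∀ p, Commute S (opM p))
    (h2 : ∀ b, Commute S (opT b)) (h3 : Commute S opO) : Commute S (LL r w) := by
  refine Commute.add_right (Commute.add_right (h1 _) ?_) (h3.smul_right _)
  exact Commute.sum_right _ _ _ fun b _ => (h2 b).smul_right _

theorem LL_comm (r : ℕ) (w w' : Wt σ) : Commute (LL r w) (LL r w') := by
  refine LL_comm_of r w' _ (fun p => ?_) (fun b => ?_) ?_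
  · exact (LL_comm_of r w _ (fun q => opM_comm _ _) (fun b => (opTM_comm _ _).symm)
      (opOM_comm _).symm).symm
  · exact (LL_comm_of r w _ (fun q => opTM_comm _ _) (fun b => opT_comm _ _) (opTO_comm _)).symm
  · exact (LL_comm_of r w _ (fun q => opOM_comm _) (fun b => (opTO_comm _).symm)
      (Commute.refl _)).symm

theorem LL_opT (r : ℕ) (w : Wt σ) (b : ℕ) (F : Fn σ) : LL r w (opT b F) = opT b (LL r w F) := by
  have := (LL_comm_of r w (opT b) (fun q => opTM_comm _ _) (fun b => opT_comm _ _) (opTO_comm _)).symm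
  exact LinearMap.congr_fun this F

theorem LL_opO (r : ℕ) (w : Wt σ) (F : Fn σ) : LL r w (opO F) = opO (LL r w F) := by
  have := (LL_comm_of r w opO (fun q => opOM_comm _) (fun b => (opTO_comm _).symm)
      (Commute.refl _)).symm
  exact LinearMap.congr_fun this F

noncomputable def qf (r : ℕ) (φ : MvPolynomial σ ℝ →ₗ[ℝ] ℝ) (F : Fn σ) (d : ℕ) (ν : ℕ → ℤ) :
    Wt σ →ₗ[ℝ] Wt σ →ₗ[ℝ] ℝ :=
  LinearMap.mk₂ ℝ (fun w w' => φ (LL r w (LL r w' F) d ν))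
    (fun w w' w'' => by simp) (fun c w w' => by simp)
    (fun w w' w'' => by simp) (fun c w w' => by simp)

theorem qf_apply (r : ℕ) (φ : MvPolynomial σ ℝ →ₗ[ℝ] ℝ) (F : Fn σ) (d : ℕ) (ν : ℕ → ℤ) (w w' : Wt σ) :
    qf r φ F d ν w w' = φ (LL r w (LL r w' F) d ν) := rfl

theorem qf_symm (r : ℕ) (φ : MvPolynomial σ ℝ →ₗ[ℝ] ℝ) (F : Fn σ) (d : ℕ) (ν : ℕ → ℤ) (w w' : Wt σ) :
    qf r φ F d ν w w' = qf r φ F d ν w' w := by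
  rw [qf_apply, qf_apply]
  have := LinearMap.congr_fun (LL_comm r w w').eq F
  rw [Module.End.mul_apply, Module.End.mul_apply] at this
  rw [this]

noncomputable def mon (s : Multiset σ) : MvPolynomial σ ℝ := (s.map X).prod

theorem mon_cons (a : σ) (s : Multiset σ) : mon (a ::ₘ s) = X a * mon s := by simp [mon]
theorem mon_add (s t : Multiset σ) : mon (s + t) = mon s * mon t := by simp [mon]
theorem mon_rep (d : ℕ) (a : σ) : mon (Multiset.replicate d a) = X a ^ d := by simp [mon]

/-- the quadratic form `z ↦ Φ(p ℓ_z ℓ_z')`. -/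
noncomputable def bf (Φ : MvPolynomial σ ℝ →ₗ[ℝ] ℝ) (p : MvPolynomial σ ℝ) :
    (σ → ℝ) →ₗ[ℝ] (σ → ℝ) →ₗ[ℝ] ℝ :=
  LinearMap.mk₂ ℝ (fun z z' => Φ (p * (ell z * ell z')))
    (fun w w' w'' => by simp [add_mul, mul_add]) (fun c w w' => by simp)
    (fun w w' w'' => by simp [mul_add]) (fun c w w' => by simp)

theorem bf_apply (Φ : MvPolynomial σ ℝ →ₗ[ℝ] ℝ) (p : MvPolynomial σ ℝ) (z z' : σ → ℝ) :
    bf Φ p z z' = Φ (p * (ell z * ell z')) := rfl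

/-- Alexandrov-Fenchel functionals of degree `n`. -/
def AFpos (Φ : MvPolynomial σ ℝ →ₗ[ℝ] ℝ) (n : ℕ) : Prop :=
  (∀ s : Multiset σ, s.card = n → 0 < Φ (mon s)) ∧
  ∀ s : Multiset σ, s.card + 2 = n → Lor (bf Φ (mon s))

noncomputable def mulF (Φ : MvPolynomial σ ℝ →ₗ[ℝ] ℝ) (p : MvPolynomial σ ℝ) :
    MvPolynomial σ ℝ →ₗ[ℝ] ℝ := Φ.comp (LinearMap.mulLeft ℝ p)

theorem mulF_apply (Φ : MvPolynomial σ ℝ →ₗ[ℝ] ℝ) (p q : MvPolynomial σ ℝ) :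
    mulF Φ p q = Φ (p * q) := rfl

/-- partitions, as strictly increasing sequences. -/
def Par (N r : ℕ) (ν : ℕ → ℤ) : Prop :=
  (0 < r → 1 ≤ ν 0) ∧ (∀ b, b + 1 < r → ν b < ν (b + 1)) ∧ ∀ b, b < r → ν b ≤ N + b + 1

theorem Par.sh {N r : ℕ} {ν : ℕ → ℤ} (h : Par N r ν) (b : ℕ) (h0 : b = 0 → 2 ≤ ν 0)
    (h1 : ∀ c, c + 1 = b → ν c + 1 < ν b) : Par N r (sh ν b) := by
  refine ⟨fun hr => ?_, fun c hc => ?_, fun c hc => ?_⟩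
  · rw [sh_apply]; split_ifs with h'
    · have := h0 h'.symm; omega
    · exact h.1 hr
  · have h2 := h.2.1 c hc
    rw [sh_apply, sh_apply]
    split_ifs with h3 h4 h4
    · omega
    · omega
    · have := h1 c h4; rw [← h4] at this; omega
    · exact h2
  · have := h.2.2 c hc
    rw [sh_apply]; split_ifs <;> omega

theorem Par.del {N r : ℕ} {ν : ℕ → ℤ} (h : Par N (r + 1) ν) (h0 : ν 0 = 1) : Par N r (del ν 0) := by
  refine ⟨fun hr => ?_, fun c hc => ?_, fun c hc => ?_⟩
  · have := h.2.1 0 (by omega); simp only [AFS.del]; simp at this ⊢; omega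
  · have := h.2.1 (c + 1) (by omega); simp only [AFS.del]; simp at this ⊢; omega
  · have := h.2.2 (c + 1) (by omega); simp only [AFS.del]; simp at this ⊢; omega

theorem Par.ge {N r : ℕ} {ν : ℕ → ℤ} (h : Par N r ν) (b : ℕ) (hb : b < r) : ν 0 + b ≤ ν b := by
  induction b with
  | zero => simp
  | succ b ih => have := h.2.1 b hb; have := ih (by omega); push_cast; omega

def wt (r : ℕ) (ν : ℕ → ℤ) : ℤ := ∑ b ∈ Finset.range r, (ν b - b - 1)

theorem wt_sh {r : ℕ} (ν : ℕ → ℤ) (b : ℕ) (hb : b < r) : wt r (sh ν b) = wt r ν - 1 := by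
  have : wt r (sh ν b) = wt r ν + ∑ c ∈ Finset.range r, (if c = b then -1 else 0) := by
    rw [wt, wt, ← Finset.sum_add_distrib]
    refine Finset.sum_congr rfl fun c _ => ?_
    rw [sh_apply]; split_ifs <;> ring
  rw [this, Finset.sum_ite_eq', if_pos (Finset.mem_range.mpr hb)]; ring

theorem wt_del {r : ℕ} (ν : ℕ → ℤ) (h : ν 0 = 1) : wt (r + 1) ν = wt r (del ν 0) := by
  rw [wt, wt, Finset.sum_range_succ', h]
  simp only [del]
  push_cast
  simp only [Nat.not_lt_zero, if_false]
  have : ∀ b : ℕ, ν (b + 1) - ((b:ℤ) + 1) - 1 = ν (b + 1) - 1 - b - 1 := fun b => by ring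
  simp [this]

end Forms
end AFS
end PartC

section PartD
namespace AFS

open MvPolynomial

section Pos
variable {σ : Type} [Fintype σ]

noncomputable def Ps (N : ℕ) (xv : ℕ → σ) (r : ℕ) : (ℕ → ℤ) → MvPolynomial σ ℝ :=
  PP N (fun i => (X (xv i) : MvPolynomial σ ℝ)) r
noncomputable def Qs (N : ℕ) (xv : ℕ → σ) (r : ℕ) : (ℕ → ℤ) → MvPolynomial σ ℝ :=
  QQ (Ps N xv r) r
noncomputable def Ks (N : ℕ) (xv : ℕ → σ) (r a : ℕ) : Fn σ :=
  fun d ν => KK (X (xv r)) (Qs N xv r) a d ν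

theorem Ks_zero (N : ℕ) (xv : ℕ → σ) (r a) (ν) : Ks N xv r a 0 ν = 0 := KK_zero _ _ _ _
theorem Ks_zero_succ (N : ℕ) (xv : ℕ → σ) (r d) (ν) :
    Ks N xv r 0 (d + 1) ν = X (xv r) ^ d * Qs N xv r ν := KK_zero_succ _ _ _ _
theorem Ks_succ (N : ℕ) (xv : ℕ → σ) (r a d) (ν) :
    Ks N xv r (a + 1) (d + 1) ν = Ks N xv r a (d + 1) ν + Ks N xv r (a + 1) d (sh ν a) :=
  KK_succ _ _ _ _ _
theorem Ps_succ (N : ℕ) (xv : ℕ → σ) (r) (ν) :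
    Ps N xv (r + 1) ν = Ks N xv r (r + 1) (N + 1) ν := by
  rw [Ps, PP]; rfl

theorem Qs_big (N : ℕ) (xv : ℕ → σ) (r) (ν) (hν : Par N (r + 1) ν) (h : 2 ≤ ν 0) :
    Qs N xv r ν = 0 := by
  refine QQ_big _ _ _ fun b hb => ?_
  have := hν.ge b hb
  omega

theorem Qs_one (N : ℕ) (xv : ℕ → σ) (r) (ν) (h : ν 0 = 1) :
    Qs N xv r ν = Ps N xv r (del ν 0) := QQ_one _ _ (PP_prop _ _ _).1 _ h

theorem Ks_van (N : ℕ) (xv : ℕ → σ) (r a d b) (hb : b < r + 1) : Van (Ks N xv r a d) b :=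
  KK_van _ _ _ (QQ_van _ _ (PP_prop _ _ _).1 _ hb) _ _

theorem Qs_anti (N : ℕ) (xv : ℕ → σ) (r b) (hb : b + 1 < r + 1) : Anti (Qs N xv r) b :=
  QQ_anti _ _ (PP_prop _ _ _).2 _ hb

theorem Ks_anti (N : ℕ) (xv : ℕ → σ) (r a d b) (hb : b + 1 < r + 1) (h : b + 2 ≤ a) :
    Anti (Ks N xv r a d) b :=
  KK_anti_lt _ _ _ (Qs_anti _ _ _ _ hb) _ _ h

theorem Ks_blocked (N : ℕ) (xv : ℕ → σ) (r b d) (ν) (hb : b + 1 < r + 1) (h : ν (b + 1) = ν b + 1) :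
    Ks N xv r (b + 2) d (sh ν (b + 1)) = 0 := by
  refine (Ks_anti N xv r (b + 2) d b hb le_rfl).eq_zero ?_
  rw [sh_same, sh_ne _ (by omega)]; omega

def PosP (Φ : MvPolynomial σ ℝ →ₗ[ℝ] ℝ) (n N : ℕ) (xv : ℕ → σ) (r : ℕ) : Prop :=
  ∀ (s : Multiset σ) ν, Par N r ν → (s.card : ℤ) + r * N - wt r ν = n → 0 < mulF Φ (mon s) (Ps N xv r ν)

theorem mulF_rep (Φ : MvPolynomial σ ℝ →ₗ[ℝ] ℝ) (s : Multiset σ) (d : ℕ) (a : σ) (p : MvPolynomial σ ℝ) :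
    mulF Φ (mon s) (X a ^ d * p) = mulF Φ (mon (s + Multiset.replicate d a)) p := by
  rw [mulF_apply, mulF_apply, mon_add, mon_rep, mul_assoc]

theorem K_pos {Φ : MvPolynomial σ ℝ →ₗ[ℝ] ℝ} {n N : ℕ} {xv : ℕ → σ} {r : ℕ}
    (h : PosP Φ n N xv r) (d : ℕ) : ∀ (a : ℕ) (s : Multiset σ) (ν : ℕ → ℤ), Par N (r + 1) ν → a ≤ r + 1 →
      (s.card : ℤ) + r * N + d - 1 - wt (r + 1) ν = n →
      0 ≤ mulF Φ (mon s) (Ks N xv r a d ν) ∧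
        (1 ≤ a → ν 0 ≤ d → 0 < mulF Φ (mon s) (Ks N xv r a d ν)) := by
  induction d with
  | zero =>
    intro a s ν hν ha hd
    rw [Ks_zero, map_zero]
    refine ⟨le_rfl, fun _ h0 => ?_⟩
    have := hν.1 (by omega)
    push_cast at h0; omega
  | succ d ihd =>
    intro a
    induction a with
    | zero =>
      intro s ν hν ha hd
      refine ⟨?_, fun h => absurd h (by omega)⟩
      rw [Ks_zero_succ]
      rcases (hν.1 (by omega)).eq_or_lt with h0 | h0
      · rw [Qs_one _ _ _ _ h0.symm, mulF_rep]
        refine (h _ _ (hν.del h0.symm) ?_).le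
        rw [← wt_del _ h0.symm]
        simp only [Multiset.card_add, Multiset.card_replicate]
        push_cast at hd ⊢; linarith
      · rw [Qs_big _ _ _ _ hν (by omega), mul_zero, map_zero]
    | succ a iha =>
      intro s ν hν ha hd
      have hd2 : (s.card : ℤ) + r * N + d - 1 - wt (r + 1) (sh ν a) = n := by
        rw [wt_sh _ _ (by omega)]; push_cast at hd; linarith
      rw [Ks_succ, map_add]
      rcases a with _ | b
      · rcases (hν.1 (by omega)).eq_or_lt with h0 | h0
        · have hz : Ks N xv r (0 + 1) d (sh ν 0) = 0 :=
            Ks_van N xv r _ d 0 (by omega) _ (by rw [sh_same]; omega)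
          rw [hz, map_zero, add_zero, Ks_zero_succ, Qs_one _ _ _ _ h0.symm, mulF_rep]
          have := (h (s + Multiset.replicate d (xv r)) _ (hν.del h0.symm) (by
            rw [← wt_del _ h0.symm]
            simp only [Multiset.card_add, Multiset.card_replicate]
            push_cast at hd ⊢; linarith))
          exact ⟨this.le, fun _ _ => this⟩
        · rw [Ks_zero_succ, Qs_big _ _ _ _ hν (by omega), mul_zero, map_zero, zero_add]
          have h3 := ihd (0 + 1) s (sh ν 0) (hν.sh 0 (fun _ => by omega) (fun c hc => absurd hc (by omega))) ha hd2
          refine ⟨h3.1, fun _ h5 => h3.2 (by omega) ?_⟩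
          rw [sh_same]; push_cast at h5; omega
      · have hA := iha s ν hν (by omega) hd
        have hB : 0 ≤ mulF Φ (mon s) (Ks N xv r (b + 1 + 1) d (sh ν (b + 1))) := by
          have h1 := hν.2.1 b (by omega)
          by_cases hbl : ν (b + 1) = ν b + 1
          · rw [Ks_blocked _ _ _ _ _ _ (by omega) hbl, map_zero]
          · refine (ihd _ s _ (hν.sh _ (fun h => absurd h (by omega)) (fun c hc => ?_)) ha hd2).1
            have : c = b := by omega
            subst this; omega
        exact ⟨by linarith [hA.1], fun _ h5 => by linarith [hA.2 (by omega) h5]⟩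

end Pos
end AFS
end PartD

section PartE
namespace AFS

open MvPolynomial

section Row
variable {σ : Type} [Fintype σ]

def tv (b : ℕ) : Wt σ := (0, Pi.single b 1, 0)
def ov : Wt σ := (0, 0, 1)

theorem LL_tv (r b : ℕ) (hb : b < r) : (LL r (tv b) : Module.End ℝ (Fn σ)) = opT b := by
  ext1 F; funext d ν
  rw [LL_apply]
  simp only [tv, map_zero, zero_mul, zero_add, zero_smul, add_zero]
  rw [Finset.sum_eq_single b]
  · simp [opT]
  · intro c _ hc; simp [Pi.single_eq_of_ne hc]
  · intro h; exact absurd (Finset.mem_range.mpr hb) h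

theorem LL_ov (r : ℕ) : (LL r ov : Module.End ℝ (Fn σ)) = opO := by
  ext1 F; funext d ν
  rw [LL_apply]
  simp [ov, opO]

theorem opT_apply (b : ℕ) (F : Fn σ) (d ν) : opT b F d ν = F d (sh ν b) := rfl
theorem opO_apply (F : Fn σ) (d ν) : opO F d ν = F (d + 1) ν := rfl

theorem opO_Ks (N : ℕ) (xv : ℕ → σ) (r a : ℕ) :
    opO (Ks N xv r (a + 1)) = opO (Ks N xv r a) + opT a (Ks N xv r (a + 1)) := by
  funext d ν
  exact Ks_succ N xv r a d ν

/-- (L3) -/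
theorem L3 (φ : MvPolynomial σ ℝ →ₗ[ℝ] ℝ) (N : ℕ) (xv : ℕ → σ) (r a d : ℕ) (ν : ℕ → ℤ) (w w' : Wt σ) :
    qf (r + 1) φ (Ks N xv r (a + 1)) (d + 1) ν w w' =
      qf (r + 1) φ (Ks N xv r a) (d + 1) ν w w' +
      qf (r + 1) φ (Ks N xv r (a + 1)) d (sh ν a) w w' := by
  simp only [qf_apply]
  rw [← map_add]; congr 1
  have e := congrFun (congrFun (congrArg (fun F => LL (r + 1) w (LL (r + 1) w' F)) (opO_Ks N xv r a)) d) ν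
  simp only [map_add, LL_opO, LL_opT] at e
  exact e

theorem LL_anti (R b : ℕ) (w : Wt σ) (F : Fn σ) (hF : ∀ d, Anti (F d) b) (hb : b + 1 < R)
    (hw : w.2.1 b = w.2.1 (b + 1)) (d : ℕ) : Anti (LL R w F d) b := by
  intro ν
  rw [LL_apply, LL_apply, hF, hF]
  have : ∑ c ∈ Finset.range R, w.2.1 c • F d (sh (sw ν b) c) =
      - ∑ c ∈ Finset.range R, w.2.1 c • F d (sh ν c) := by
    rw [← Finset.sum_neg_distrib]
    refine Finset.sum_equiv (Equiv.swap b (b + 1)) ?_ ?_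
    · intro c
      simp only [Finset.mem_range, Equiv.swap_apply_def]
      split_ifs <;> omega
    · intro c _
      rw [sw_sh, hF, smul_neg]
      congr 2
      rw [Equiv.swap_apply_def]; split_ifs with h1 h2
      · rw [h1, hw]
      · rw [h2, hw]
      · rfl
  rw [this, smul_neg]; ring

theorem sw_sh2 (ν : ℕ → ℤ) (b : ℕ) (h : ν (b + 1) = ν b + 1) :
    sw (sh (sh ν b) (b + 1)) b = sh (sh ν (b + 1)) (b + 1) := by
  funext k
  simp only [sw, sh_apply, Equiv.swap_apply_def]
  split_ifs <;> first | omega | (subst_vars; omega)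

theorem qf_add_smul (r : ℕ) (φ : MvPolynomial σ ℝ →ₗ[ℝ] ℝ) (F : Fn σ) (d : ℕ) (ν : ℕ → ℤ) (x y : Wt σ) (c : ℝ) :
    qf r φ F d ν (x + c • y) (x + c • y) = qf r φ F d ν x x + 2 * c * qf r φ F d ν y x
      + c ^ 2 * qf r φ F d ν y y := by
  have := quad_expand (qf r φ F d ν) (qf_symm r φ F d ν) 1 c x y
  rw [one_smul] at this
  rw [this, qf_symm r φ F d ν x y]; ring

/-- the linear map of (L2) -/
noncomputable def f2 (b : ℕ) : Wt σ →ₗ[ℝ] Wt σ where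
  toFun w := w - (w.2.1 (b + 1) - w.2.1 b) • tv (b + 1)
  map_add' w w' := by
    simp only [Prod.snd_add, Prod.fst_add, Pi.add_apply, sub_smul, add_smul]; abel
  map_smul' c w := by
    simp only [Prod.smul_snd, Prod.smul_fst, Pi.smul_apply, smul_eq_mul, RingHom.id_apply, smul_sub, sub_smul, mul_smul]

/-- (L2) -/
theorem L2 {Φ : MvPolynomial σ ℝ →ₗ[ℝ] ℝ} {n N : ℕ} {xv : ℕ → σ} {r : ℕ}
    (h : PosP Φ n N xv r) (b d : ℕ) (s : Multiset σ) (ν : ℕ → ℤ) (hν : Par N (r + 1) ν)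
    (hb : b + 1 < r + 1) (hbl : ν (b + 1) = ν b + 1)
    (hd : (s.card : ℤ) + 2 + r * N + (d + 1 : ℕ) - 1 - wt (r + 1) ν = n) (x : Wt σ) :
    qf (r + 1) (mulF Φ (mon s)) (Ks N xv r (b + 2)) (d + 1) ν x x ≤
    qf (r + 1) (mulF Φ (mon s)) (Ks N xv r (b + 1)) (d + 1) ν (f2 b x) (f2 b x) := by
  set φ := mulF Φ (mon s)
  have hx : x = f2 b x + (x.2.1 (b + 1) - x.2.1 b) • tv (b + 1) := by simp [f2]
  set ξ := x.2.1 (b + 1) - x.2.1 b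
  set x' := f2 b x with hx'
  have hτ : x'.2.1 b = x'.2.1 (b + 1) := by
    rw [hx']; simp [f2, tv]
  have hA : ∀ d, Anti (Ks N xv r (b + 2) d) b := fun d => Ks_anti N xv r (b + 2) d b hb le_rfl
  have hA1 := fun d => LL_anti (r + 1) b x' _ hA hb hτ d
  have hA2 := fun d => LL_anti (r + 1) b x' _ hA1 hb hτ d
  have hsw : sh ν (b + 1) b = sh ν (b + 1) (b + 1) := by
    rw [sh_same, sh_ne _ (by omega)]; omega
  have e1 : qf (r + 1) φ (Ks N xv r (b + 2)) (d + 1) ν (tv (b + 1)) x' = 0 := by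
    rw [qf_apply, LL_tv _ _ hb, opT_apply, (hA1 (d + 1)).eq_zero hsw, map_zero]
  have e2 : qf (r + 1) φ (Ks N xv r (b + 2)) d (sh ν (b + 1)) x' x' = 0 := by
    rw [qf_apply, (hA2 d).eq_zero hsw, map_zero]
  have e3 : qf (r + 1) φ (Ks N xv r (b + 2)) (d + 1) ν (tv (b + 1)) (tv (b + 1)) ≤ 0 := by
    rw [qf_apply, LL_tv _ _ hb, opT_apply, opT_apply, ← sw_sh2 ν b hbl, hA (d + 1), map_neg,
      neg_nonpos]
    have hpar : (Par N (r + 1) (sh ν b)) ∨ Ks N xv r (b + 2) (d + 1) (sh (sh ν b) (b + 1)) = 0 := by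
      rcases b with _ | c
      · rcases (hν.1 (by omega)).eq_or_lt with h0 | h0
        · right
          refine Ks_van N xv r _ _ 0 (by omega) _ ?_
          rw [sh_ne _ (by omega), sh_same]; omega
        · left; exact hν.sh 0 (fun _ => by omega) (fun c hc => absurd hc (by omega))
      · have h1 := hν.2.1 c (by omega)
        by_cases h2 : ν (c + 1) = ν c + 1
        · right
          refine (Ks_anti N xv r _ _ c (by omega) (by omega)).eq_zero ?_
          rw [sh_ne _ (by omega), sh_ne _ (by omega), sh_ne _ (by omega), sh_same]; omega
        · left
          refine hν.sh _ (fun h => absurd h (by omega)) (fun c' hc => ?_)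
          have : c' = c := by omega
          subst this; omega
    rcases hpar with hpar | hz
    · refine (K_pos h (d + 1) (b + 2) s _ (hpar.sh (b + 1) (fun h => absurd h (by omega)) ?_) (by omega) ?_).1
      · intro c hc
        have : c = b := by omega
        subst this
        rw [sh_same, sh_ne _ (by omega)]; omega
      · rw [wt_sh _ _ (by omega), wt_sh _ _ (by omega)]; linarith
    · rw [hz, map_zero]
  have e4 := L3 φ N xv r (b + 1) d ν x' x'
  rw [hx, qf_add_smul, e1, e4, e2]
  have := mul_nonneg (sq_nonneg ξ) (neg_nonneg.mpr e3)
  linarith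

/-- the linear map of (L1) -/
noncomputable def f1 : Wt σ →ₗ[ℝ] Wt σ where
  toFun w := w - (w.2.1 0) • tv 0
  map_add' w w' := by
    simp only [Prod.snd_add, Prod.fst_add, Pi.add_apply, add_smul]; abel
  map_smul' c w := by
    simp only [Prod.smul_snd, Prod.smul_fst, Pi.smul_apply, smul_eq_mul, RingHom.id_apply, smul_sub, mul_smul]

noncomputable def f0 : Wt σ →ₗ[ℝ] Wt σ where
  toFun w := f1 w + (w.2.1 0) • ov
  map_add' w w' := by
    simp only [map_add, Prod.snd_add, Prod.fst_add, Pi.add_apply, add_smul]; abel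
  map_smul' c w := by
    simp only [map_smul, Prod.smul_snd, Prod.smul_fst, Pi.smul_apply, smul_eq_mul, RingHom.id_apply, smul_add, mul_smul]

theorem op_ident {V : Type*} [AddCommGroup V] [Module ℝ V] (A T O : Module.End ℝ V)
    (hAT : Commute A T) (hAO : Commute A O) (hTO : Commute T O) (F B : V) (hF : O F = B + T F) (τ : ℝ) :
    O ((A + τ • T) ((A + τ • T) F)) = T ((A + τ • O) ((A + τ • O) F)) + A (A B) - τ ^ 2 • T (O B) := by
  have hB : B = O F - T F := by rw [hF]; abel
  have c1 : ∀ v, A (T v) = T (A v) := fun v => LinearMap.congr_fun hAT v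
  have c2 : ∀ v, A (O v) = O (A v) := fun v => LinearMap.congr_fun hAO v
  have c3 : ∀ v, T (O v) = O (T v) := fun v => LinearMap.congr_fun hTO v
  rw [hB]
  simp only [LinearMap.add_apply, LinearMap.smul_apply, map_add, map_sub, map_smul, c1, c2, c3]
  module

theorem Qs_ne_one (N : ℕ) (xv : ℕ → σ) (r) (ν) (h : ∀ b, b < r + 1 → ν b ≠ 1) : Qs N xv r ν = 0 :=
  QQ_big _ _ _ h

theorem rem1 {Φ : MvPolynomial σ ℝ →ₗ[ℝ] ℝ} {n N : ℕ} {xv : ℕ → σ} {r : ℕ}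
    (h : PosP Φ n N xv r) (d : ℕ) (s : Multiset σ) (ν : ℕ → ℤ) (hν : Par N (r + 1) ν)
    (h0 : 2 ≤ ν 0)
    (hd : (s.card : ℤ) + 2 + r * N + (d + 1 : ℕ) - 1 - wt (r + 1) ν = n) (x : Wt σ) (hx : x.2.1 0 = 0) :
    mulF Φ (mon s) (LL (r + 1) x (LL (r + 1) x (opO (Ks N xv r 0))) d ν) ≤ 0 := by
  set B : Fn σ := opO (Ks N xv r 0) with hB
  have hBv : ∀ d ν, B d ν = X (xv r) ^ d * Qs N xv r ν := fun d ν => Ks_zero_succ _ _ _ _ _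
  have hge := fun b hb => hν.ge b hb
  have hz : ∀ d, B d ν = 0 := fun d => by
    rw [hBv, Qs_ne_one, mul_zero]; intro b hb; have := hge b hb; omega
  have hz1 : ∀ d b, 1 ≤ b → B d (sh ν b) = 0 := fun d b h1 => by
    rw [hBv, Qs_ne_one, mul_zero]; intro c hc; have := hge c hc; rw [sh_apply]; split_ifs <;> omega
  have hz2 : ∀ d b c, 1 ≤ b → 1 ≤ c → ¬ (b = 1 ∧ c = 1) → B d (sh (sh ν b) c) = 0 := fun d b c h1 h2 h3 => by
    rw [hBv, Qs_ne_one, mul_zero]; intro k hk; have := hge k hk; simp only [sh_apply]; split_ifs <;> omega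
  have g1 : ∀ d, LL (r + 1) x B d ν = 0 := fun d => by
    rw [LL_apply, hz, hz, Finset.sum_eq_zero]
    · simp
    · intro b _
      rcases b.eq_zero_or_pos with hb | hb
      · rw [hb, hx, zero_smul]
      · rw [hz1 _ _ hb, smul_zero]
  have g2 : ∀ b, 1 ≤ b → LL (r + 1) x B d (sh ν b) = if b = 1 ∧ 1 < r + 1 then x.2.1 1 • B d (sh (sh ν 1) 1) else 0 := by
    intro b hb
    rw [LL_apply, hz1 _ _ hb, hz1 _ _ hb]
    simp only [mul_zero, smul_zero, zero_add, add_zero]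
    split_ifs with h1
    · rw [Finset.sum_eq_single 1, h1.1]
      · intro c _ hc
        rcases c.eq_zero_or_pos with hc0 | hc0
        · rw [hc0, hx, zero_smul]
        · rw [hz2 _ _ _ hb hc0 (by omega), smul_zero]
      · intro h; exact absurd (Finset.mem_range.mpr h1.2) h
    · refine Finset.sum_eq_zero fun c hc => ?_
      rw [Finset.mem_range] at hc
      rcases c.eq_zero_or_pos with hc0 | hc0
      · rw [hc0, hx, zero_smul]
      · rw [hz2 _ _ _ hb hc0 (by omega), smul_zero]
  rw [LL_apply, g1, g1, mul_zero, smul_zero, zero_add, add_zero]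
  by_cases hr : 1 < r + 1
  · rw [Finset.sum_eq_single 1]
    · rw [g2 1 le_rfl, if_pos ⟨rfl, hr⟩, map_smul, map_smul, smul_eq_mul, smul_eq_mul, ← mul_assoc]
      refine mul_nonpos_of_nonneg_of_nonpos (mul_self_nonneg _) ?_
      have h1 := hge 1 hr
      by_cases hbl : ν 0 = 2 ∧ ν 1 = 3
      · have hbl' : ν (0 + 1) = ν 0 + 1 := by rw [zero_add]; omega
        have := sw_sh2 ν 0 hbl'
        rw [zero_add] at this
        rw [← this, hBv, Qs_anti N xv r 0 hr, mul_neg, map_neg, neg_nonpos]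
        have hp := hν.sh 0 (fun _ => by omega) (fun c hc => absurd hc (by omega))
        have := (K_pos h (d + 1) 0 s _ (hp.sh 1 (fun h => absurd h (by omega)) (fun c hc => by
          have : c = 0 := by omega
          subst this; rw [sh_same, sh_ne _ (by omega)]; omega)) (by omega) (by
          rw [wt_sh _ _ (by omega), wt_sh _ _ (by omega)]; linarith)).1
        rwa [Ks_zero_succ] at this
      · rw [hBv, Qs_ne_one, mul_zero, map_zero]
        intro c hc; have := hge c hc
        by_cases hc1 : c = 1
        · subst hc1; rw [sh_same, sh_same]; push_cast at this; omega
        · rw [sh_ne _ hc1, sh_ne _ hc1]; omega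
    · intro b _ hb
      rcases b.eq_zero_or_pos with hc0 | hc0
      · rw [hc0, hx, zero_smul]
      · rw [g2 b hc0, if_neg (by omega), smul_zero]
    · intro h; exact absurd (Finset.mem_range.mpr hr) h
  · rw [Finset.sum_eq_zero, map_zero]
    intro b hb
    rw [Finset.mem_range] at hb
    have : b = 0 := by omega
    rw [this, hx, zero_smul]

/-- (L1) -/
theorem L1 {Φ : MvPolynomial σ ℝ →ₗ[ℝ] ℝ} {n N : ℕ} {xv : ℕ → σ} {r : ℕ}
    (h : PosP Φ n N xv r) (d : ℕ) (s : Multiset σ) (ν : ℕ → ℤ) (hν : Par N (r + 1) ν)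
    (h0 : 2 ≤ ν 0)
    (hd : (s.card : ℤ) + 2 + r * N + (d + 1 : ℕ) - 1 - wt (r + 1) ν = n) (x : Wt σ) :
    qf (r + 1) (mulF Φ (mon s)) (Ks N xv r 1) (d + 1) ν x x ≤
    qf (r + 1) (mulF Φ (mon s)) (Ks N xv r 1) d (sh ν 0) (f0 x) (f0 x) := by
  have hx : x = f1 x + (x.2.1 0) • tv 0 := by simp [f1]
  have hf0 : f0 x = f1 x + (x.2.1 0) • ov := rfl
  have hτ : (f1 x).2.1 0 = 0 := by simp [f1, tv]
  have h1 : LL (r + 1) x = LL (r + 1) (f1 x) + x.2.1 0 • opT 0 := by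
    conv_lhs => rw [hx]
    rw [map_add, map_smul, LL_tv _ _ (by omega)]
  have h2 : LL (r + 1) (f0 x) = LL (r + 1) (f1 x) + x.2.1 0 • opO := by
    rw [hf0, map_add, map_smul, LL_ov]
  have key := op_ident (LL (r + 1) (f1 x)) (opT 0) opO
    (LL_comm_of (r + 1) (f1 x) (opT 0) (fun q => opTM_comm _ _) (fun b => opT_comm _ _) (opTO_comm _)).symm
    (LL_comm_of (r + 1) (f1 x) opO (fun q => opOM_comm _) (fun b => (opTO_comm _).symm) (Commute.refl _)).symm
    (opTO_comm 0) (Ks N xv r 1) (opO (Ks N xv r 0)) (opO_Ks N xv r 0) (x.2.1 0)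
  rw [← h1, ← h2] at key
  have key2 := congrFun (congrFun key d) ν
  rw [opO_apply] at key2
  rw [qf_apply, qf_apply, key2]
  have e1 := rem1 h d s ν hν h0 hd (f1 x) hτ
  have e2 := (K_pos h (d + 2) 0 s (sh ν 0) (hν.sh 0 (fun _ => by omega) (fun c hc => absurd hc (by omega)))
    (by omega) (by rw [wt_sh _ _ (by omega)]; push_cast at hd ⊢; linarith)).1
  have e3 : ∀ (F G H : Fn σ) (c : ℝ), mulF Φ (mon s) ((F + G - c • H) d ν) =
    mulF Φ (mon s) (F d ν) + mulF Φ (mon s) (G d ν) - c * mulF Φ (mon s) (H d ν) := by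
    intro F G H c
    simp
  rw [e3]
  have e4 : opT 0 (opO (opO (Ks N xv r 0))) d ν = Ks N xv r 0 (d + 2) (sh ν 0) := rfl
  rw [e4, opT_apply]
  have := mul_nonneg (sq_nonneg (x.2.1 0)) e2
  linarith

end Row
end AFS
end PartE

section PartF
namespace AFS

open MvPolynomial

section Row2
variable {σ : Type} [Fintype σ]

theorem Ks_one (N : ℕ) (xv : ℕ → σ) (r a) (ν) : Ks N xv r a 1 ν = Qs N xv r ν := KK_one _ _ _ _

theorem qf_zero (N : ℕ) (xv : ℕ → σ) (r a) (ν) (φ : MvPolynomial σ ℝ →ₗ[ℝ] ℝ) (x : Wt σ) (hx : x.2.2 = 0) :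
    qf (r + 1) φ (Ks N xv r a) 0 ν x x = 0 := by
  have h1 : ∀ ν, LL (r + 1) x (Ks N xv r a) 0 ν = 0 := fun ν => by
    rw [LL_apply, hx]; simp [Ks_zero]
  rw [qf_apply, LL_apply, hx]
  simp [h1]

theorem Ks_two (N : ℕ) (xv : ℕ → σ) (r a) (ν) (ha : a ≤ r) (hν : Par N (r + 1) ν) (h0 : 2 ≤ ν 0) :
    Ks N xv r (a + 1) 2 ν = Qs N xv r (sh ν 0) := by
  induction a with
  | zero =>
    have := Ks_succ N xv r 0 1 ν
    rw [this, Ks_zero_succ, Qs_big _ _ _ _ hν h0, mul_zero, zero_add, Ks_one]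
  | succ a ih =>
    have := Ks_succ N xv r (a + 1) 1 ν
    rw [this, ih (by omega), Ks_one, Qs_ne_one _ _ _ (sh ν (a + 1)), add_zero]
    intro b hb; have := hν.ge b hb; rw [sh_apply]; split_ifs <;> omega

/-- Claim K at `d = 0`. -/
theorem claimK0 {Φ : MvPolynomial σ ℝ →ₗ[ℝ] ℝ} {n N : ℕ} {xv : ℕ → σ} {r : ℕ}
    (h : PosP Φ n N xv r) (a : ℕ) (s : Multiset σ) (ν : ℕ → ℤ) (hν : Par N (r + 1) ν)
    (ha : a ≤ r) (h0 : 2 ≤ ν 0)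
    (hd : (s.card : ℤ) + 2 + r * N + (0 : ℕ) - 1 - wt (r + 1) ν = n) (x : Wt σ)
    (hx : x.2.2 + x.2.1 0 = 0) :
    qf (r + 1) (mulF Φ (mon s)) (Ks N xv r (a + 1)) 0 ν x x ≤ 0 := by
  have hge := fun b hb => hν.ge b hb
  have hQ : ∀ b, b ≠ 0 → Qs N xv r (sh ν b) = 0 := fun b hb0 => by
    rw [Qs_ne_one]
    intro b hb; have := hν.ge b hb; rw [sh_apply]; split_ifs <;> omega
  have hsum : ∀ c : ℝ, ∑ b ∈ Finset.range (r + 1), x.2.1 b • (c • Qs N xv r (sh ν b)) = (x.2.1 0 * c) • Qs N xv r (sh ν 0) := by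
    intro c
    rw [Finset.sum_eq_single 0, smul_smul]
    · intro b _ hb; rw [hQ b hb, smul_zero, smul_zero]
    · intro h; exact absurd (Finset.mem_range.mpr (Nat.succ_pos r)) h
  have h1 : ∀ ν, LL (r + 1) x (Ks N xv r (a + 1)) 0 ν = x.2.2 • Qs N xv r ν := fun ν => by
    rw [LL_apply]; simp [Ks_zero, Ks_one]
  have h2 : LL (r + 1) x (Ks N xv r (a + 1)) 1 ν = (x.2.1 0 + x.2.2) • Qs N xv r (sh ν 0) := by
    rw [LL_apply]
    simp only [Ks_one]
    have := hsum 1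
    simp only [one_smul] at this
    rw [this, Ks_two _ _ _ _ _ ha hν h0, Qs_big _ _ _ _ hν h0, mul_zero, zero_add, mul_one, add_smul]
  rw [qf_apply, LL_apply]
  simp only [h1]
  rw [zero_add, h2, hsum, Qs_big _ _ _ _ hν h0, smul_zero, mul_zero, zero_add, map_add, map_smul, map_smul, map_smul]
  have e2 := (K_pos h 1 0 s (sh ν 0) (hν.sh 0 (fun _ => by omega) (fun c hc => absurd hc (by omega)))
    (by omega) (by rw [wt_sh _ _ (by omega)]; push_cast at hd ⊢; linarith)).1
  rw [Ks_one] at e2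
  have hx' : x.2.1 0 = - x.2.2 := by linarith
  rw [hx']
  simp only [smul_eq_mul]
  have := mul_nonneg (mul_self_nonneg x.2.2) e2
  nlinarith

theorem claimK {Φ : MvPolynomial σ ℝ →ₗ[ℝ] ℝ} {n N : ℕ} {xv : ℕ → σ} {r : ℕ}
    (h : PosP Φ n N xv r) (d : ℕ) : ∀ (a : ℕ) (s : Multiset σ) (ν : ℕ → ℤ) (_ : Par N (r + 1) ν)
    (_ : a ≤ r) (_ : 2 ≤ ν 0) (_ : d + 1 ≤ ν 0)
    (_ : (s.card : ℤ) + 2 + r * N + d - 1 - wt (r + 1) ν = n) (x : Wt σ)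
    (_ : x.2.2 + x.2.1 0 = 0),
    qf (r + 1) (mulF Φ (mon s)) (Ks N xv r (a + 1)) d ν x x ≤ 0 := by
  induction d with
  | zero => intro a s ν hν ha h0 _ hd x hx; exact claimK0 h a s ν hν ha h0 hd x hx
  | succ d ihd =>
    intro a
    induction a with
    | zero =>
      intro s ν hν ha h0 h1 hd x hx
      refine (L1 h d s ν hν h0 hd x).trans ?_
      have hy : (f0 x).2.2 = 0 := by simp [f0, f1, tv, ov]; linarith
      have ht : (f0 x).2.1 0 = 0 := by simp [f0, f1, tv, ov]
      rcases d.eq_zero_or_pos with hd0 | hd0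
      · subst hd0; exact (qf_zero _ _ _ _ _ _ _ hy).le
      · refine ihd 0 s _ (hν.sh 0 (fun _ => by omega) (fun c hc => absurd hc (by omega))) ha ?_ ?_ ?_ _ (by rw [hy, ht, add_zero])
        · rw [sh_same]; push_cast at h1; omega
        · rw [sh_same]; push_cast at h1; omega
        · rw [wt_sh _ _ (by omega)]; push_cast at hd; linarith
    | succ b ihb =>
      intro s ν hν ha h0 h1 hd x hx
      by_cases hbl : ν (b + 1) = ν b + 1
      · refine (L2 h b d s ν hν (by omega) hbl hd x).trans ?_
        refine ihb s ν hν (by omega) h0 h1 hd _ ?_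
        rw [← hx]; simp [f2, tv]
      · have hlt := hν.2.1 b (by omega)
        rw [L3]
        have e1 := ihb s ν hν (by omega) h0 h1 hd x hx
        have hp : Par N (r + 1) (sh ν (b + 1)) := hν.sh _ (fun h => absurd h (by omega)) (fun c' hc => by
          have : c' = b := by omega
          subst this; omega)
        have e2 := ihd (b + 1) s _ hp ha (by rw [sh_ne _ (by omega)]; exact h0)
          (by rw [sh_ne _ (by omega)]; push_cast at h1; omega)
          (by rw [wt_sh _ _ (by omega)]; push_cast at hd; linarith) x hx
        linarith

noncomputable def injW : ((σ → ℝ) × (ℕ → ℝ)) →ₗ[ℝ] Wt σ where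
  toFun w := (w.1, w.2, 0)
  map_add' w w' := by simp
  map_smul' c w := by simp

noncomputable def st (r : ℕ) (φ : MvPolynomial σ ℝ →ₗ[ℝ] ℝ) (P : (ℕ → ℤ) → MvPolynomial σ ℝ) (ν : ℕ → ℤ) :
    ((σ → ℝ) × (ℕ → ℝ)) →ₗ[ℝ] ((σ → ℝ) × (ℕ → ℝ)) →ₗ[ℝ] ℝ :=
  (qf r φ (fun _ => P) 0 ν).compl₁₂ injW injW

noncomputable def pjW [DecidableEq σ] (a : σ) : Wt σ →ₗ[ℝ] ((σ → ℝ) × (ℕ → ℝ)) where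
  toFun w := (w.1 + w.2.2 • Pi.single a 1, fun b => w.2.1 (b + 1))
  map_add' w w' := by
    ext : 1
    · simp only [Prod.fst_add, Prod.snd_add, add_smul]; abel
    · rfl
  map_smul' c w := by
    ext : 1
    · simp [mul_smul]
    · rfl

theorem del_sh (ν : ℕ → ℤ) (b : ℕ) : del (sh ν (b + 1)) 0 = sh (del ν 0) b := by
  funext k
  simp only [del, sh_apply]
  split_ifs <;> omega

theorem LL_inj_const (r : ℕ) (w : (σ → ℝ) × (ℕ → ℝ)) (P : (ℕ → ℤ) → MvPolynomial σ ℝ) :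
    LL r (injW w) (fun _ => P) = fun _ => LL r (injW w) (fun _ => P) 0 := by
  funext d ν
  rw [LL_apply, LL_apply]

theorem LL_del [DecidableEq σ] (r : ℕ) (w : Wt σ) (a : σ) (F : Fn σ) (P : (ℕ → ℤ) → MvPolynomial σ ℝ)
    (h1 : ∀ d, Van (F d) 0) (h2 : ∀ d ν, ν 0 = 1 → F d ν = X a ^ d * P (del ν 0)) :
    (∀ d, Van (LL (r + 1) w F d) 0) ∧
    (∀ d ν, ν 0 = 1 → LL (r + 1) w F d ν = X a ^ d * LL r (injW (pjW a w)) (fun _ => P) 0 (del ν 0)) := by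
  constructor
  · intro d ν hν
    rw [LL_apply, h1 d ν hν, h1 _ ν hν, Finset.sum_eq_zero]
    · simp
    · intro b _
      rw [h1 d _ (by rw [sh_apply]; split_ifs <;> omega), smul_zero]
  · intro d ν hν
    rw [LL_apply, LL_apply, Finset.sum_range_succ', h1 d (sh ν 0) (by rw [sh_same]; omega), h2 _ _ hν, h2 _ _ hν]
    have : ∀ b ∈ Finset.range r, w.2.1 (b + 1) • F d (sh ν (b + 1)) =
        X a ^ d * (w.2.1 (b + 1) • P (sh (del ν 0) b)) := by
      intro b _
      rw [h2 _ _ (by rw [sh_ne _ (by omega), hν]), del_sh, mul_smul_comm]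
    rw [Finset.sum_congr rfl this, ← Finset.mul_sum]
    simp only [injW, pjW, LinearMap.coe_mk, AddHom.coe_mk, map_add, map_smul, ell_single, one_smul,
      zero_smul, add_zero, smul_zero]
    simp only [Algebra.smul_def]
    ring

def RowP (Φ : MvPolynomial σ ℝ →ₗ[ℝ] ℝ) (n N : ℕ) (xv : ℕ → σ) (r : ℕ) : Prop :=
  ∀ (s : Multiset σ) ν, Par N r ν → (s.card : ℤ) + 2 + r * N - wt r ν = n →
    Lor (st r (mulF Φ (mon s)) (Ps N xv r) ν)

theorem row_base [DecidableEq σ] {Φ : MvPolynomial σ ℝ →ₗ[ℝ] ℝ} {n N : ℕ} {xv : ℕ → σ} {r : ℕ}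
    (hR : RowP Φ n N xv r) (d : ℕ) (s : Multiset σ) (ν : ℕ → ℤ) (hν : Par N (r + 1) ν)
    (h0 : ν 0 = 1)
    (hd : (s.card : ℤ) + 2 + r * N + (d + 1 : ℕ) - 1 - wt (r + 1) ν = n) :
    Lor (qf (r + 1) (mulF Φ (mon s)) (Ks N xv r 1) (d + 1) ν) := by
  have hB := hR (s + Multiset.replicate d (xv r)) (del ν 0) (hν.del h0) (by
    rw [← wt_del _ h0]; simp only [Multiset.card_add, Multiset.card_replicate]; push_cast at hd ⊢; linarith)
  refine hB.comp (pjW (xv r)) fun x y => ?_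
  rw [show (1 : ℕ) = 0 + 1 from rfl, L3]
  have hV : ∀ d, Van (Ks N xv r (0 + 1) d) 0 := fun d => Ks_van _ _ _ _ _ _ (by omega)
  have hVL : ∀ (w : Wt σ) (F : Fn σ), (∀ d, Van (F d) 0) → ∀ d, Van (LL (r + 1) w F d) 0 := by
    intro w F h1 d ν hν
    rw [LL_apply, h1 d ν hν, h1 _ ν hν, Finset.sum_eq_zero]
    · simp
    · intro b _
      rw [h1 d _ (by rw [sh_apply]; split_ifs <;> omega), smul_zero]
  have e1 : qf (r + 1) (mulF Φ (mon s)) (Ks N xv r (0 + 1)) d (sh ν 0) x y = 0 := by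
    rw [qf_apply, hVL x _ (hVL y _ hV) d _ (by rw [sh_same]; omega), map_zero]
  rw [e1, add_zero, qf_apply]
  have e2 : LL (r + 1) x (LL (r + 1) y (Ks N xv r 0)) (d + 1) ν
      = LL (r + 1) x (LL (r + 1) y (opO (Ks N xv r 0))) d ν := by
    rw [LL_opO, LL_opO]; rfl
  have hb1 : ∀ d, Van (opO (Ks N xv r 0) d) 0 := fun d => Ks_van _ _ _ _ _ _ (by omega)
  have hb2 : ∀ d ν, ν 0 = 1 → opO (Ks N xv r 0) d ν = X (xv r) ^ d * Ps N xv r (del ν 0) := by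
    intro d ν h; rw [opO_apply, Ks_zero_succ, Qs_one _ _ _ _ h]
  have k1 := LL_del r y (xv r) _ _ hb1 hb2
  have k2 := LL_del r x (xv r) _ _ k1.1 k1.2
  rw [e2, k2.2 d ν h0, mulF_rep, ← LL_inj_const]
  rfl

theorem row [DecidableEq σ] {Φ : MvPolynomial σ ℝ →ₗ[ℝ] ℝ} {n N : ℕ} {xv : ℕ → σ} {r : ℕ}
    (h : PosP Φ n N xv r) (hR : RowP Φ n N xv r) (d : ℕ) : ∀ (a : ℕ) (s : Multiset σ) (ν : ℕ → ℤ)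
    (_ : Par N (r + 1) ν) (_ : a ≤ r) (_ : (s.card : ℤ) + 2 + r * N + d - 1 - wt (r + 1) ν = n),
    Lor (qf (r + 1) (mulF Φ (mon s)) (Ks N xv r (a + 1)) d ν) := by
  induction d with
  | zero =>
    intro a s ν hν ha hd
    refine Lor.of_hyper _ (qf_symm _ _ _ _ _)
      ((LinearMap.snd ℝ (ℕ → ℝ) ℝ).comp (LinearMap.snd ℝ (σ → ℝ) ((ℕ → ℝ) × ℝ))) fun x hx => ?_
    exact (qf_zero _ _ _ _ _ _ _ hx).le
  | succ d ihd =>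
    intro a
    induction a with
    | zero =>
      intro s ν hν ha hd
      rcases (hν.1 (by omega)).eq_or_lt with h0 | h0
      · exact row_base hR d s ν hν h0.symm hd
      · refine Lor.of_le (qf_symm _ _ _ _ _) (ihd 0 s (sh ν 0) (hν.sh 0 (fun _ => by omega) (fun c hc => absurd hc (by omega))) ha ?_) f0 (L1 h d s ν hν (by omega) hd)
        rw [wt_sh _ _ (by omega)]; push_cast at hd; linarith
    | succ b ihb =>
      intro s ν hν ha hd
      have hE := ihb s ν hν (by omega) hd
      by_cases hbl : ν (b + 1) = ν b + 1
      · exact Lor.of_le (qf_symm _ _ _ _ _) hE (f2 b) (L2 h b d s ν hν (by omega) hbl hd)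
      · have hlt := hν.2.1 b (by omega)
        have hp : Par N (r + 1) (sh ν (b + 1)) := hν.sh _ (fun h => absurd h (by omega)) (fun c' hc => by
          have : c' = b := by omega
          subst this; omega)
        have hM := ihd (b + 1) s _ hp ha (by rw [wt_sh _ _ (by omega)]; push_cast at hd; linarith)
        by_cases hc : ν 0 ≤ d + 1
        · have hsum : (ov - tv (b + 1) : Wt σ) + tv (b + 1) = ov := by abel
          have hOT : LL (r + 1) (ov - tv (b + 1) : Wt σ) (Ks N xv r (b + 2)) = opO (Ks N xv r (b + 1)) := by
            rw [map_sub, LL_ov, LL_tv _ _ (by omega), LinearMap.sub_apply, opO_Ks, add_sub_cancel_right]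
          refine Lor.two _ _ _ (ov - tv (b + 1)) (tv (b + 1)) (qf_symm _ _ _ _ _) hE hM
            (fun x => L3 _ _ _ _ _ _ _ _ _) (fun x => ?_) (fun x => ?_) ?_ ?_ ?_
          · rw [hsum, qf_symm, qf_apply, qf_symm, qf_apply, hOT, LL_ov]
          · rw [hsum, qf_apply, qf_apply, LL_ov, LL_tv _ _ (by omega)]; rfl
          · rw [hsum, qf_apply, LL_ov]
            refine (K_pos h (d + 3) (b + 1) s ν hν (by omega) ?_).2 (by omega) ?_
            · push_cast at hd ⊢; linarith
            · push_cast; omega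
          · rw [hsum, qf_apply, LL_ov]
            refine (K_pos h (d + 2) (b + 1 + 1) s _ hp (by omega) ?_).2 (by omega) ?_
            · rw [wt_sh _ _ (by omega)]; push_cast at hd ⊢; linarith
            · rw [sh_ne _ (by omega)]; push_cast; omega
          · rw [qf_symm, qf_apply, hOT, LL_tv _ _ (by omega)]
            refine (K_pos h (d + 2) (b + 1) s _ hp (by omega) ?_).2 (by omega) ?_
            · rw [wt_sh _ _ (by omega)]; push_cast at hd ⊢; linarith
            · rw [sh_ne _ (by omega)]; push_cast; omega
        · refine Lor.of_hyper _ (qf_symm _ _ _ _ _)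
            ((LinearMap.snd ℝ (ℕ → ℝ) ℝ).comp (LinearMap.snd ℝ (σ → ℝ) ((ℕ → ℝ) × ℝ)) +
             (LinearMap.proj 0).comp ((LinearMap.fst ℝ (ℕ → ℝ) ℝ).comp (LinearMap.snd ℝ (σ → ℝ) ((ℕ → ℝ) × ℝ)))) fun x hx => ?_
          exact claimK h (d + 1) (b + 1) s ν hν ha (by omega) (by push_cast; omega) hd x hx

theorem stage {Φ : MvPolynomial σ ℝ →ₗ[ℝ] ℝ} {n : ℕ} (hΦ : AFpos Φ n) (N : ℕ) (xv : ℕ → σ) (r : ℕ) :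
    PosP Φ n N xv r ∧ RowP Φ n N xv r := by
  classical
  induction r with
  | zero =>
    refine ⟨fun s ν _ hd => ?_, fun s ν _ hd => ?_⟩
    · have : mulF Φ (mon s) (Ps N xv 0 ν) = Φ (mon s) := by
        rw [mulF_apply, Ps, PP, mul_one]
      rw [this]
      refine hΦ.1 s ?_
      simp [wt] at hd; exact_mod_cast hd
    · refine (hΦ.2 s (by simp [wt] at hd; exact_mod_cast hd)).comp (LinearMap.fst ℝ _ _) fun x y => ?_
      have : ∀ ν, Ps N xv 0 ν = 1 := fun ν => by
        rw [Ps, PP]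
      simp only [st, LinearMap.compl₁₂_apply, qf_apply, LL_apply, this]
      simp [injW, bf_apply, mulF_apply]
  | succ r ih =>
    refine ⟨fun s ν hν hd => ?_, fun s ν hν hd => ?_⟩
    · rw [Ps_succ]
      refine (K_pos ih.1 (N + 1) (r + 1) s ν hν le_rfl ?_).2 (by omega) ?_
      · push_cast at hd ⊢; linarith
      · have := hν.2.2 0 (by omega); push_cast at this ⊢; omega
    · refine (row ih.1 ih.2 (N + 1) r s ν hν le_rfl ?_).comp injW fun x y => ?_
      · push_cast at hd ⊢; linarith
      · simp only [st, LinearMap.compl₁₂_apply, qf_apply, LL_apply, Ps_succ]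
        simp [injW]

theorem AFpos.mul_Ps {Φ : MvPolynomial σ ℝ →ₗ[ℝ] ℝ} {n : ℕ} (hΦ : AFpos Φ n) (N : ℕ) (xv : ℕ → σ) (r : ℕ)
    (ν : ℕ → ℤ) (hν : Par N r ν) (m : ℕ) (hm : (m : ℤ) + r * N - wt r ν = n) :
    AFpos (mulF Φ (Ps N xv r ν)) m := by
  have h := stage hΦ N xv r
  refine ⟨fun s hs => ?_, fun s hs => ?_⟩
  · have := h.1 s ν hν (by rw [hs]; exact hm)
    rwa [mulF_apply, mul_comm] at this
  · have := h.2 s ν hν (by rw [← hm, ← hs]; push_cast; ring)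
    refine this.comp (LinearMap.inl ℝ _ _) fun x y => ?_
    simp only [st, LinearMap.compl₁₂_apply, qf_apply, LL_apply]
    simp only [bf_apply, mulF_apply, injW]
    simp
    congr 1
    ring

end Row2
end AFS
end PartF

section PartG
namespace AFS

section Ident
variable {A : Type*} [CommRing A]

def EE (x : ℕ → A) : ℕ → ℤ → A
  | 0, k => if k = 0 then 1 else 0
  | r + 1, k => EE x r k + x r * EE x r (k - 1)

theorem EE_succ (x : ℕ → A) (r k) : EE x (r + 1) k = EE x r k + x r * EE x r (k - 1) := by rw [EE]

theorem EE_neg (x : ℕ → A) (r : ℕ) (k : ℤ) (h : k < 0) : EE x r k = 0 := by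
  induction r generalizing k with
  | zero => rw [EE, if_neg (by omega)]
  | succ r ih => rw [EE_succ, ih k h, ih (k - 1) (by omega)]; ring

theorem EE_gt (x : ℕ → A) (r : ℕ) (k : ℤ) (h : r < k) : EE x r k = 0 := by
  induction r generalizing k with
  | zero => rw [EE, if_neg (by push_cast at h; omega)]
  | succ r ih => rw [EE_succ, ih k (by push_cast at h; omega), ih (k - 1) (by push_cast at h; omega)]; ring

/-- matrix with rows `≥ t` processed -/
def GM (x : ℕ → A) (N r t : ℕ) (c : ℕ → ℤ) : Matrix (Fin N) (Fin N) A :=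
  Matrix.of fun m k => if t ≤ (m : ℕ) then EE x r (c m - 1 + (m : ℕ) - (k : ℕ)) else
    EE x (r + 1) (c m + (m : ℕ) - (k : ℕ))

theorem GM_split (x : ℕ → A) (N r t : ℕ) (c : ℕ → ℤ) (ht : t < N) :
    (GM x N r (t + 1) c).det = x r * (GM x N r t c).det +
      (GM x N r t (Function.update c t (c t + 1))).det := by
  set u : Fin N → A := fun k => EE x r (c t - 1 + t - (k : ℕ))
  set v : Fin N → A := fun k => EE x r (c t + t - (k : ℕ))
  set i : Fin N := ⟨t, ht⟩
  have h1 : GM x N r (t + 1) c = (GM x N r t c).updateRow i (x r • u + v) := by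
    ext m k
    by_cases hm : m = i
    · subst hm
      rw [Matrix.updateRow_self]
      simp only [GM, Matrix.of_apply, i, u, v, Pi.add_apply, Pi.smul_apply, smul_eq_mul]
      rw [if_neg (by omega), EE_succ, show c t - 1 + (t : ℤ) - (k : ℕ) = c t + t - (k : ℕ) - 1 by ring]
      ring
    · rw [Matrix.updateRow_ne hm]
      have : (m : ℕ) ≠ t := fun h => hm (Fin.ext h)
      simp only [GM, Matrix.of_apply]
      split_ifs <;> first | rfl | omega
  have h2 : GM x N r t c = (GM x N r t c).updateRow i u := by
    ext m k
    by_cases hm : m = i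
    · subst hm
      rw [Matrix.updateRow_self]
      simp [GM, Matrix.of_apply, i, u]
    · rw [Matrix.updateRow_ne hm]
  have h3 : GM x N r t (Function.update c t (c t + 1)) = (GM x N r t c).updateRow i v := by
    ext m k
    by_cases hm : m = i
    · subst hm
      rw [Matrix.updateRow_self]
      simp [GM, Matrix.of_apply, i, v]
    · rw [Matrix.updateRow_ne hm]
      have : (m : ℕ) ≠ t := fun h => hm (Fin.ext h)
      simp only [GM, Matrix.of_apply, Function.update_of_ne this]
  rw [h1, Matrix.det_updateRow_add, Matrix.det_updateRow_smul, ← h2, ← h3]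

theorem GM_down (x : ℕ → A) (N r t : ℕ) (c : ℕ → ℤ) (ht : t < N)
    (h : (t + 1 < N ∧ c (t + 1) = c t) ∨ (t + 1 = N ∧ c t = r + 1)) :
    (GM x N r (t + 1) c).det = x r * (GM x N r t c).det := by
  rw [GM_split _ _ _ _ _ ht, add_eq_left]
  rcases h with ⟨h1, h2⟩ | ⟨h1, h2⟩
  · refine Matrix.det_zero_of_row_eq (i := ⟨t, ht⟩) (j := ⟨t + 1, h1⟩) (by simp) ?_
    funext k
    simp [GM, h2]
  · refine Matrix.det_eq_zero_of_row_eq_zero ⟨t, ht⟩ fun k => ?_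
    simp [GM, h2]
    refine EE_gt _ _ _ ?_
    have := k.2
    omega

theorem GM_downs (x : ℕ → A) (N r t j : ℕ) (c : ℕ → ℤ) (hj : t + j < N)
    (h : ∀ m, t ≤ m → m < t + j → c (m + 1) = c m) :
    (GM x N r (t + j) c).det = x r ^ j * (GM x N r t c).det := by
  induction j with
  | zero => simp
  | succ j ih =>
    rw [← add_assoc, GM_down _ _ _ _ _ (by omega) (Or.inl ⟨by omega, h _ (by omega) (by omega)⟩),
      ih (by omega) (fun m h1 h2 => h m h1 (by omega))]
    ring

theorem GM_zero (x : ℕ → A) (N r : ℕ) (c : ℕ → ℤ) (hN : 0 < N) (h : c 0 = 0) :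
    (GM x N r 0 c).det = 0 := by
  refine Matrix.det_eq_zero_of_row_eq_zero ⟨0, hN⟩ fun k => ?_
  simp [GM, h]
  refine EE_neg _ _ _ ?_
  omega

theorem GM_congr (x : ℕ → A) (N r t : ℕ) (c c' : ℕ → ℤ) (h : ∀ m, m < N → c m = c' m) :
    GM x N r t c = GM x N r t c' := by
  ext m k
  simp only [GM, Matrix.of_apply, h m m.2]

def cnt (R : ℕ) (ν : ℕ → ℤ) (m : ℕ) : ℤ := ∑ b ∈ Finset.range R, if ν b - b - 1 ≤ m then 1 else 0

theorem Par.mono {N r : ℕ} {ν : ℕ → ℤ} (h : Par N r ν) (b c : ℕ) (hbc : b ≤ c) (hc : c < r) :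
    ν b + c ≤ ν c + b := by
  induction c, hbc using Nat.le_induction with
  | base => exact le_rfl
  | succ c hbc ih =>
    have := h.2.1 c hc; have := ih (by omega); push_cast; omega

theorem cnt_eq (R : ℕ) (ν : ℕ → ℤ) (m a : ℕ) (ha : a ≤ R) (h1 : ∀ b, b < a → ν b - b - 1 ≤ m)
    (h2 : ∀ b, a ≤ b → b < R → m < ν b - b - 1) : cnt R ν m = a := by
  rw [cnt]
  have : ∀ b ∈ Finset.range R, (if ν b - b - 1 ≤ m then (1:ℤ) else 0) = if b ∈ Finset.range a then 1 else 0 := by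
    intro b hb
    rw [Finset.mem_range] at hb
    by_cases hba : b < a
    · rw [if_pos (h1 b hba), if_pos (Finset.mem_range.mpr hba)]
    · rw [if_neg (not_le.mpr (h2 b (by omega) hb)), if_neg (by simpa using hba)]
  rw [Finset.sum_congr rfl this, Finset.sum_ite_mem,
    Finset.inter_eq_right.mpr (Finset.range_mono ha)]
  simp

theorem cnt_sh (R : ℕ) (ν : ℕ → ℤ) (p a : ℕ) (ha : a < R) (h : ν a = p + 1 + a + 1) :
    cnt R (sh ν a) = Function.update (cnt R ν) p (cnt R ν p + 1) := by
  funext m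
  have : ∀ b, (if sh ν a b - b - 1 ≤ m then (1:ℤ) else 0) =
      (if ν b - b - 1 ≤ m then (1:ℤ) else 0) + if b = a then (if m = p then 1 else 0) else 0 := by
    intro b
    rw [sh_apply]
    split_ifs <;> first | rfl | omega | (subst_vars; omega)
  have h2 : cnt R (sh ν a) m = cnt R ν m + if m = p then 1 else 0 := by
    rw [cnt, Finset.sum_congr rfl (fun b _ => this b), Finset.sum_add_distrib, Finset.sum_ite_eq',
      if_pos (Finset.mem_range.mpr ha)]; rfl
  rw [h2, Function.update_apply]
  split_ifs with h3
  · rw [h3]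
  · rw [add_zero]

theorem cnt_del (r : ℕ) (ν : ℕ → ℤ) (m : ℕ) (h : ν 0 = 1) : cnt (r + 1) ν m - 1 = cnt r (del ν 0) m := by
  rw [cnt, cnt, Finset.sum_range_succ', h]
  simp only [del, Nat.not_lt_zero, if_false]
  have : ∀ b : ℕ, ν (b + 1) - ((b + 1 : ℕ) : ℤ) - 1 = ν (b + 1) - 1 - b - 1 := fun b => by push_cast; ring
  simp only [this]
  simp

def DD (x : ℕ → A) (N r : ℕ) (c : ℕ → ℤ) : A :=
  (Matrix.of fun m k : Fin N => EE x r (c m + (m : ℕ) - (k : ℕ))).det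

theorem KK_ident [NoZeroDivisors A] [CharZero A] (x : ℕ → A) (N r : ℕ) (P : (ℕ → ℤ) → A)
    (hP1 : ∀ b, b < r → Van P b) (hP2 : ∀ b, b + 1 < r → Anti P b)
    (hP : ∀ ν, Par N r ν → P ν = DD x N r (cnt r ν)) (d : ℕ) :
    ∀ (a p : ℕ) (ν : ℕ → ℤ), a < r + 1 → Par N (r + 1) ν → ν a = p + a + 1 → p + 1 ≤ d →
      KK (x r) (QQ P r) (a + 1) d ν = x r ^ (d - 1 - p) * (GM x N r p (cnt (r + 1) ν)).det := by
  induction d with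
  | zero => intro a p ν _ _ _ h; omega
  | succ d ihd =>
    intro a
    induction a with
    | zero =>
      intro p ν ha hν hp hd
      rw [KK_succ, KK_zero_succ]
      have hpN : p ≤ N := by have := hν.2.2 0 (by omega); push_cast at *; omega
      rcases p with _ | p
      · have h0 : ν 0 = 1 := by rw [hp]; simp
        rw [KK_van _ _ 0 (QQ_van _ _ hP1 0 (by omega)) _ _ _ (by rw [sh_same]; omega), add_zero,
          QQ_one _ _ hP1 _ h0, hP _ (hν.del h0)]
        simp only [Nat.sub_zero, Nat.add_sub_cancel]
        rw [DD]
        congr 2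
        ext m k
        simp only [GM, Matrix.of_apply, Nat.zero_le, if_true]
        rw [cnt_del _ _ _ h0]
      · rw [QQ_big _ _ _ (fun b hb => by have := hν.ge b hb; push_cast at hp; omega), mul_zero, zero_add,
          ihd 0 p _ ha (hν.sh 0 (fun _ => by push_cast at hp; omega) (fun c hc => absurd hc (by omega)))
            (by rw [sh_same, hp]; push_cast; ring) (by omega),
          cnt_sh _ _ p 0 ha (by rw [hp]; push_cast; ring), GM_split _ _ _ _ _ (by omega)]
        have hc : ∀ m, m ≤ p → cnt (r + 1) ν m = 0 := by
          intro m hm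
          refine cnt_eq (r + 1) ν m 0 (by omega) (fun b hb => absurd hb (by omega)) (fun b _ hb => ?_)
          have := hν.ge b hb; push_cast at hp; omega
        have hz := GM_downs x N r 0 p (cnt (r + 1) ν) (by omega)
          (fun m _ h2 => by rw [hc m (by omega), hc (m + 1) (by omega)])
        rw [zero_add, GM_zero x N r _ (by omega) (hc 0 (by omega)), mul_zero] at hz
        rw [hz, mul_zero, zero_add]
        congr 2; omega
    | succ b ihb =>
      intro p ν ha hν hp hd
      obtain ⟨p', hp'⟩ : ∃ p' : ℕ, ν b = p' + b + 1 := by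
        have h1 := hν.ge b (by omega); have h2 := hν.1 (by omega)
        exact ⟨(ν b - b - 1).toNat, by omega⟩
      have hlt := hν.2.1 b (by omega)
      have hpN : p ≤ N := by have := hν.2.2 (b + 1) (by omega); push_cast at *; omega
      have hpp : p' ≤ p := by push_cast at hp; omega
      rw [KK_succ, ihb p' ν (by omega) hν hp' (by omega)]
      rcases hpp.eq_or_lt with h | h
      · subst h
        have hz : KK (x r) (QQ P r) (b + 1 + 1) d (sh ν (b + 1)) = 0 := by
          refine (KK_anti_lt _ _ b (QQ_anti _ _ hP2 _ (by omega)) _ _ (by omega)).eq_zero ?_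
          rw [sh_same, sh_ne _ (by omega)]; push_cast at hp; omega
        rw [hz, add_zero]
      · obtain ⟨q, rfl⟩ : ∃ q, p = q + 1 := ⟨p - 1, by omega⟩
        rw [ihd (b + 1) q _ ha (hν.sh _ (fun h => absurd h (by omega)) (fun c hc => by
          have : c = b := by omega
          subst this; push_cast at hp; omega)) (by rw [sh_same, hp]; push_cast; ring) (by omega),
          cnt_sh _ _ q (b + 1) ha (by rw [hp]; push_cast; ring), GM_split _ _ _ _ _ (by omega)]
        have hc : ∀ m, p' ≤ m → m ≤ q → cnt (r + 1) ν m = (b + 1 : ℕ) := by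
          intro m hm1 hm2
          refine cnt_eq (r + 1) ν m (b + 1) (by omega) (fun b' hb => ?_) (fun b' hb1 hb => ?_)
          · have := hν.mono b' b (by omega) (by omega); omega
          · have := hν.mono (b + 1) b' (by omega) (by omega); push_cast at *; omega
        obtain ⟨j, rfl⟩ : ∃ j, q = p' + j := ⟨q - p', by omega⟩
        rw [GM_downs x N r p' j (cnt (r + 1) ν) (by omega) (fun m h1 h2 => by rw [hc m h1 (by omega), hc (m + 1) (by omega) (by omega)])]
        have e1 : d + 1 - 1 - p' = (d + 1 - 1 - (p' + j + 1)) + j + 1 := by omega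
        have e2 : d - 1 - (p' + j) = d + 1 - 1 - (p' + j + 1) := by omega
        rw [e1, e2, pow_succ, pow_add]
        ring

theorem PP_ident [NoZeroDivisors A] [CharZero A] (x : ℕ → A) (N r : ℕ) (ν : ℕ → ℤ) (hν : Par N r ν) :
    PP N x r ν = DD x N r (cnt r ν) := by
  induction r generalizing ν with
  | zero =>
    rw [PP, DD]
    have : (Matrix.of fun m k : Fin N => EE x 0 (cnt 0 ν m + (m : ℕ) - (k : ℕ))) = 1 := by
      ext m k
      simp only [Matrix.of_apply, EE, cnt, Finset.range_zero, Finset.sum_empty, zero_add, Matrix.one_apply]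
      congr 1
      rw [eq_iff_iff, sub_eq_zero, Fin.ext_iff]; exact Nat.cast_inj
    rw [this, Matrix.det_one]
  | succ r ih =>
    obtain ⟨p, hp⟩ : ∃ p : ℕ, ν r = p + r + 1 := by
      have h1 := hν.ge r (by omega); have h2 := hν.1 (by omega)
      exact ⟨(ν r - r - 1).toNat, by omega⟩
    have hpN : p ≤ N := by have := hν.2.2 r (by omega); push_cast at *; omega
    rw [PP, KK_ident x N r _ (PP_prop _ _ _).1 (PP_prop _ _ _).2 ih (N + 1) r p ν (by omega) hν hp (by omega)]
    have hD : DD x N (r + 1) (cnt (r + 1) ν) = (GM x N r N (cnt (r + 1) ν)).det := by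
      rw [DD]; congr 1
      ext m k
      simp only [GM, Matrix.of_apply]
      rw [if_neg (by have := m.2; omega)]
    rw [hD]
    have hc : ∀ m, p ≤ m → cnt (r + 1) ν m = (r + 1 : ℕ) := by
      intro m hm
      refine cnt_eq (r + 1) ν m (r + 1) le_rfl (fun b' hb => ?_) (fun b' hb1 hb => by omega)
      have := hν.mono b' r (by omega) (by omega); omega
    obtain ⟨j, rfl⟩ : ∃ j, N = p + j := ⟨N - p, by omega⟩
    rcases j with _ | j
    · simp
    · rw [← add_assoc, GM_down x _ r (p + j) _ (by omega) (Or.inr ⟨rfl, by rw [hc _ (by omega)]; push_cast; rfl⟩),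
        GM_downs x _ r p j _ (by omega) (fun m h1 h2 => by rw [hc m h1, hc (m + 1) (by omega)])]
      rw [show p + j + 1 + 1 - 1 - p = j + 1 by omega]
      ring

end Ident
end AFS
end PartG

section PartH
open MeasureTheory
open scoped Pointwise

namespace AFS

open MvPolynomial

theorem mesymm_succ {A : Type*} [CommSemiring A] (a : A) (s : Multiset A) (k : ℕ) :
    (a ::ₘ s).esymm (k + 1) = s.esymm (k + 1) + a * s.esymm k := by
  simp only [Multiset.esymm, Multiset.powersetCard_cons, Multiset.map_add, Multiset.sum_add,
    Multiset.map_map, Function.comp_def, Multiset.prod_cons, Multiset.sum_map_mul_left]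

theorem EE_esymm {A : Type*} [CommRing A] (x : ℕ → A) (r : ℕ) (k : ℤ) :
    EE x r k = if 0 ≤ k then ((Multiset.range r).map x).esymm k.toNat else 0 := by
  induction r generalizing k with
  | zero =>
    rw [EE]
    split_ifs with h1 h2 h2
    · subst h1; simp [Multiset.esymm]
    · omega
    · obtain ⟨j, hj⟩ : ∃ j, k.toNat = j + 1 := ⟨k.toNat - 1, by omega⟩
      rw [hj]; simp [Multiset.esymm, Multiset.powersetCard_zero_right]
    · rfl
  | succ r ih =>
    rw [EE_succ, ih, ih, Multiset.range_succ, Multiset.map_cons]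
    rcases lt_trichotomy k 0 with h | h | h
    · rw [if_neg (by omega), if_neg (by omega), if_neg (by omega)]; ring
    · subst h; simp [Multiset.esymm]
    · obtain ⟨j, rfl⟩ : ∃ j : ℕ, k = j + 1 := ⟨(k - 1).toNat, by omega⟩
      rw [if_pos (by omega), if_pos (by omega), if_pos (by omega)]
      have : ((j : ℤ) + 1).toNat = j + 1 := by omega
      rw [this, mesymm_succ]; simp

theorem EE_esymmZ {A : Type*} [CommRing A] [Algebra ℝ A] (x : ℕ → A) (e : ℕ) (k : ℤ) :
    aeval (fun j : Fin e => x j) (ConvexPaper.esymmZ e k) = EE x e k := by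
  rw [EE_esymm, ConvexPaper.esymmZ]
  split_ifs
  · rw [MvPolynomial.aeval_esymm_eq_multiset_esymm]
    congr 1
    rw [show (fun j : Fin e => x j) = x ∘ (fun j : Fin e => (j : ℕ)) from rfl, ← Multiset.map_map]
    congr 1
    have := Fin.univ_val_map (n := e) (fun j => (j : ℕ))
    rw [this, ← Multiset.coe_range]; congr 1
    exact List.ext_getElem (by simp) (by simp)
  · simp

theorem DD_schur {A : Type*} [CommRing A] [Algebra ℝ A] (x : ℕ → A) (e N : ℕ) (lam : Fin N → ℕ)
    (c : ℕ → ℤ) (hc : ∀ m : Fin N, c m = lam m.rev) :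
    aeval (fun j : Fin e => x j) (ConvexPaper.schur e N lam) = DD x N e c := by
  rw [ConvexPaper.schur, AlgHom.map_det, DD, ← Matrix.det_submatrix_equiv_self Fin.revPerm]
  congr 1
  ext m k
  simp only [AlgHom.mapMatrix_apply, Matrix.map_apply, Matrix.submatrix_apply, Matrix.of_apply]
  rw [EE_esymmZ, hc]
  congr 1
  simp only [Fin.revPerm_apply, Fin.val_rev]
  have := m.2
  have := k.2
  omega

theorem exists_nu (e N : ℕ) (lam : Fin N → ℕ) (hanti : Antitone lam) (hle : ∀ j, lam j ≤ e) :
    ∃ ν : ℕ → ℤ, Par N e ν ∧ (e : ℤ) * N - wt e ν = (∑ j, lam j : ℕ) ∧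
      ∀ m : Fin N, cnt e ν m = lam m.rev := by
  classical
  set c : Fin N → ℕ := fun m => lam m.rev with hcdef
  have hc : Monotone c := fun a b h => hanti (Fin.rev_le_rev.mpr h)
  set μ : ℕ → ℕ := fun b => (Finset.univ.filter (fun m => c m ≤ b)).card with hμ
  have key : ∀ b (m : Fin N), μ b ≤ m ↔ b < c m := by
    intro b m
    constructor
    · intro h
      by_contra hcon
      push Not at hcon
      have : (Finset.Iic m) ⊆ Finset.univ.filter (fun m => c m ≤ b) := by
        intro m' hm'
        rw [Finset.mem_Iic] at hm'
        exact Finset.mem_filter.mpr ⟨Finset.mem_univ _, (hc hm').trans hcon⟩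
      have h2 := Finset.card_le_card this
      rw [Fin.card_Iic] at h2
      simp only [hμ] at h
      omega
    · intro h
      have : Finset.univ.filter (fun m => c m ≤ b) ⊆ Finset.Iio m := by
        intro m' hm'
        rw [Finset.mem_filter] at hm'
        rw [Finset.mem_Iio]
        by_contra hcon
        push Not at hcon
        have := hc hcon
        omega
      have h2 := Finset.card_le_card this
      rw [Fin.card_Iio] at h2
      exact h2
  have hmono : Monotone μ := by
    intro a b hab
    refine Finset.card_le_card fun m hm => ?_
    rw [Finset.mem_filter] at hm ⊢
    exact ⟨hm.1, hm.2.trans hab⟩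
  have hN : ∀ b, μ b ≤ N := fun b => by
    have := Finset.card_le_univ (Finset.univ.filter (fun m => c m ≤ b))
    simpa using this
  refine ⟨fun b => μ b + b + 1, ⟨fun _ => by push_cast; omega, fun b _ => ?_, fun b _ => ?_⟩, ?_, ?_⟩
  · have := hmono (Nat.le_succ b); push_cast; simp only [Nat.succ_eq_add_one] at this; omega
  · have := hN b; simp only; omega
  · have h1 : wt e (fun b => (μ b : ℤ) + b + 1) = ((∑ b ∈ Finset.range e, μ b : ℕ) : ℤ) := by
      rw [wt]; push_cast; refine Finset.sum_congr rfl fun b _ => by ring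
    have h2 : ∑ b ∈ Finset.range e, μ b = ∑ m : Fin N, (e - c m) := by
      simp only [hμ, Finset.card_filter]
      rw [Finset.sum_comm]
      refine Finset.sum_congr rfl fun m _ => ?_
      rw [← Finset.card_filter]
      have : Finset.filter (fun b => c m ≤ b) (Finset.range e) = Finset.Ico (c m) e := by
        ext b; simp [and_comm]
      rw [this, Nat.card_Ico]
    have h3 : ∑ m : Fin N, (e - c m) + ∑ m, c m = e * N := by
      rw [← Finset.sum_add_distrib]
      rw [Finset.sum_congr rfl (fun m _ => Nat.sub_add_cancel (hle m.rev))]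
      simp [mul_comm]
    have h4 : ∑ m, c m = ∑ j, lam j := Equiv.sum_comp Fin.revPerm lam
    rw [h1, h2, ← h4]
    have : ((∑ m : Fin N, (e - c m) + ∑ m, c m : ℕ) : ℤ) = (e * N : ℕ) := by rw [h3]
    push_cast at this ⊢
    linarith
  · intro m
    refine cnt_eq e _ m (c m) (hle _) (fun b hb => ?_) (fun b hb _ => ?_)
    · have := (key b m).mpr hb; omega
    · have : ¬ (μ b ≤ m) := fun h => by have := (key b m).mp h; omega
      omega

/-- multiplication by a Schur polynomial preserves Alexandrov-Fenchel functionals. -/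
theorem AFpos.mul_schur {σ : Type} [Fintype σ] {Φ : MvPolynomial σ ℝ →ₗ[ℝ] ℝ} (e N : ℕ) (lam : Fin N → ℕ)
    (hanti : Antitone lam) (hle : ∀ j, lam j ≤ e) (v : Fin e → σ) (m : ℕ)
    (hΦ : AFpos Φ (m + ∑ j, lam j)) (hσ : Nonempty σ) :
    AFpos (mulF Φ (rename v (ConvexPaper.schur e N lam))) m := by
  classical
  obtain ⟨ν, hν, hw, hc⟩ := exists_nu e N lam hanti hle
  obtain ⟨a⟩ := hσ
  set xv : ℕ → σ := fun i => if h : i < e then v ⟨i, h⟩ else a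
  have h1 : rename v (ConvexPaper.schur e N lam) = Ps N xv e ν := by
    rw [Ps, PP_ident _ _ _ _ hν, ← DD_schur _ e N lam _ hc]
    have : (rename v : MvPolynomial (Fin e) ℝ →ₐ[ℝ] MvPolynomial σ ℝ)
        = aeval (fun j : Fin e => X (xv j)) := by
      apply algHom_ext; intro j; simp [xv]
    rw [this]
  rw [h1]
  refine hΦ.mul_Ps N xv e ν hν m ?_
  push_cast at hw ⊢; linarith

theorem mulF_mulF {σ : Type} [Fintype σ] (Φ : MvPolynomial σ ℝ →ₗ[ℝ] ℝ) (p q : MvPolynomial σ ℝ) :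
    mulF (mulF Φ p) q = mulF Φ (p * q) := by
  refine LinearMap.ext fun x => ?_
  simp [mulF_apply, mul_assoc]

theorem AFpos.mul_schurProd {σ : Type} [Fintype σ] {Φ : MvPolynomial σ ℝ →ₗ[ℝ] ℝ} (hσ : Nonempty σ)
    (p : ℕ) (t : Fin p → ℕ) (N : Fin p → ℕ)
    (lam : ∀ i, Fin (N i) → ℕ) (hanti : ∀ i, Antitone (lam i)) (hle : ∀ i j, lam i j ≤ t i)
    (v : ((i : Fin p) × Fin (t i)) → σ) (m : ℕ)
    (hΦ : AFpos Φ (m + ∑ i, ∑ j, lam i j)) :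
    AFpos (mulF Φ (rename v (ConvexPaper.schurProd p t N lam))) m := by
  classical
  rw [ConvexPaper.schurProd, map_prod]
  simp only [rename_rename]
  have : ∀ (S : Finset (Fin p)) (m : ℕ) (Φ : MvPolynomial σ ℝ →ₗ[ℝ] ℝ), AFpos Φ (m + ∑ i ∈ S, ∑ j, lam i j) →
      AFpos (mulF Φ (∏ i ∈ S, rename (v ∘ fun j => ⟨i, j⟩) (ConvexPaper.schur (t i) (N i) (lam i)))) m := by
    intro S
    induction S using Finset.induction_on with
    | empty =>
      intro m Φ h
      have : mulF Φ 1 = Φ := LinearMap.ext fun x => by simp [mulF_apply]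
      simpa [this] using h
    | insert i S hi ih =>
      intro m Φ h
      rw [Finset.prod_insert hi, ← mulF_mulF]
      rw [Finset.sum_insert hi] at h
      refine ih m _ (AFpos.mul_schur (t i) (N i) (lam i) (hanti i) (hle i) _ _ ?_ hσ)
      convert h using 1; ring
  exact this _ m Φ hΦ

end AFS
end PartH

section PartI
namespace AFS

open MeasureTheory Set
open scoped ENNReal

theorem bm1_compact {A B C : Set ℝ} (hA : IsCompact A) (hB : IsCompact B) (nA : A.Nonempty)
    (nB : B.Nonempty) (h : ∀ x ∈ A, ∀ y ∈ B, (x + y) / 2 ∈ C) :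
    volume A + volume B ≤ 2 * volume C := by
  obtain ⟨a, ha, hamax⟩ := hA.exists_isGreatest nA
  obtain ⟨b, hb, hbmin⟩ := hB.exists_isLeast nB
  set A' : Set ℝ := (fun x => (1 / 2 : ℝ) * x + b / 2) '' A with hA'
  set B' : Set ℝ := (fun x => (1 / 2 : ℝ) * x + a / 2) '' B with hB'
  have vol : ∀ (D : Set ℝ) (c : ℝ), volume ((fun x => (1 / 2 : ℝ) * x + c) '' D) = ENNReal.ofReal (1 / 2) * volume D := by
    intro D c
    have : (fun x : ℝ => (1 / 2 : ℝ) * x + c) '' D = (fun x => x + c) '' ((fun x => (1 / 2 : ℝ) • x) '' D) := by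
      rw [image_image]; rfl
    rw [this]
    simp only [image_add_right, measure_preimage_add_right]
    have := Measure.addHaar_smul (volume : Measure ℝ) (1 / 2 : ℝ) D
    rw [image_smul, this]; simp [abs_of_pos]
  have hsub : A' ∪ B' ⊆ C := by
    rintro _ (⟨x, hx, rfl⟩ | ⟨x, hx, rfl⟩)
    · have := h x hx b hb
      convert this using 1; ring
    · have := h a ha x hx
      convert this using 1; ring
  have hd : AEDisjoint volume A' B' := by
    refine measure_mono_null (t := {(a + b) / 2}) ?_ (by simp)
    rintro _ ⟨⟨x, hx, rfl⟩, ⟨y, hy, hxy⟩⟩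
    have h1 := hamax hx
    have h2 := hbmin hy
    simp only [mem_singleton_iff] at hxy ⊢
    linarith
  have hmB : MeasurableSet B' := by
    refine (IsCompact.image hB (by fun_prop)).measurableSet
  have h3 : volume A' + volume B' ≤ volume C := by
    rw [← measure_union₀ hmB.nullMeasurableSet hd]
    exact measure_mono hsub
  rw [hA', hB', vol, vol] at h3
  calc volume A + volume B = 2 * (ENNReal.ofReal (1 / 2) * volume A + ENNReal.ofReal (1 / 2) * volume B) := by
        rw [← mul_add, ← mul_assoc]
        have : (2 : ℝ≥0∞) * ENNReal.ofReal (1 / 2) = 1 := by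
          rw [show (2 : ℝ≥0∞) = ENNReal.ofReal 2 by simp, ← ENNReal.ofReal_mul (by norm_num)]
          simp
        rw [this, one_mul]
    _ ≤ _ := by gcongr

theorem bm1 {A B C : Set ℝ} (hA : MeasurableSet A) (hB : MeasurableSet B) (nA : A.Nonempty)
    (nB : B.Nonempty) (h : ∀ x ∈ A, ∀ y ∈ B, (x + y) / 2 ∈ C) :
    volume A + volume B ≤ 2 * volume C := by
  obtain ⟨a, ha⟩ := nA
  obtain ⟨b, hb⟩ := nB
  have key : ∀ K L : Set ℝ, IsCompact K → IsCompact L → K ⊆ A → L ⊆ B → volume K + volume L ≤ 2 * volume C := by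
    intro K L hK hL h1 h2
    refine le_trans ?_ (bm1_compact (A := insert a K) (B := insert b L) (C := C) (hK.insert a) (hL.insert b)
      ⟨a, by simp⟩ ⟨b, by simp⟩ ?_)
    · gcongr <;> simp
    · intro x hx y hy
      exact h x (insert_subset ha h1 hx) y (insert_subset hb h2 hy)
  have key2 : ∀ L : Set ℝ, IsCompact L → L ⊆ B → volume A + volume L ≤ 2 * volume C := by
    intro L hL h2
    have h3 : volume A ≤ 2 * volume C - volume L := by
      rw [hA.measure_eq_iSup_isCompact]
      refine iSup₂_le fun K hK => iSup_le fun hK' => ?_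
      exact ENNReal.le_sub_of_add_le_right hL.measure_lt_top.ne (key K L hK' hL hK h2)
    have h4 : volume L ≤ 2 * volume C := le_trans (by simp) (key ∅ L isCompact_empty hL (by simp) h2)
    exact add_le_of_le_tsub_right_of_le h4 h3
  by_cases hi : volume A = ∞
  · have := key2 ∅ isCompact_empty (by simp)
    rw [hi] at this ⊢
    simp only [measure_empty, add_zero, top_le_iff] at this
    rw [this]; simp
  · have h3 : volume B ≤ 2 * volume C - volume A := by
      rw [hB.measure_eq_iSup_isCompact]
      refine iSup₂_le fun K hK => iSup_le fun hK' => ?_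
      exact ENNReal.le_sub_of_add_le_left hi (key2 K hK' hK)
    have h4 : volume A ≤ 2 * volume C := le_trans (by simp) (key2 ∅ isCompact_empty (by simp))
    exact add_le_of_le_tsub_left_of_le h4 h3

theorem ennreal_amgm {a b c : ℝ≥0∞} (h : a + b ≤ 2 * c) : a * b ≤ c ^ 2 := by
  by_cases hc : c = ∞
  · simp [hc]
  have h2 : a + b < ∞ := lt_of_le_of_lt h (ENNReal.mul_lt_top (by simp) (lt_top_iff_ne_top.mpr hc))
  have ha : a ≠ ∞ := (lt_of_le_of_lt le_self_add h2).ne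
  have hb : b ≠ ∞ := (lt_of_le_of_lt le_add_self h2).ne
  lift a to NNReal using ha
  lift b to NNReal using hb
  lift c to NNReal using hc
  norm_cast at h ⊢
  have h' : (a : ℝ) + b ≤ 2 * c := by exact_mod_cast h
  have : (a : ℝ) * b ≤ c ^ 2 := by nlinarith [sq_nonneg ((a : ℝ) - b), a.coe_nonneg, b.coe_nonneg]
  exact_mod_cast this

theorem pl1_norm {f g h : ℝ → ℝ} (hf : Measurable f) (hg : Measurable g) (hh : Measurable h)
    (f0 : ∀ x, 0 ≤ f x) (g0 : ∀ x, 0 ≤ g x) (h0 : ∀ x, 0 ≤ h x) (f1 : ∀ x, f x ≤ 1) (g1 : ∀ x, g x ≤ 1)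
    (fs : ∀ t < 1, ∃ x, t < f x) (gs : ∀ t < 1, ∃ x, t < g x)
    (H : ∀ x y, f x * g y ≤ h ((x + y) / 2) ^ 2) :
    (∫⁻ x, ENNReal.ofReal (f x)) * (∫⁻ x, ENNReal.ofReal (g x)) ≤ (∫⁻ x, ENNReal.ofReal (h x)) ^ 2 := by
  apply ennreal_amgm
  rw [lintegral_eq_lintegral_meas_lt volume (.of_forall f0) hf.aemeasurable,
    lintegral_eq_lintegral_meas_lt volume (.of_forall g0) hg.aemeasurable,
    lintegral_eq_lintegral_meas_lt volume (.of_forall h0) hh.aemeasurable]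
  have hm : ∀ k : ℝ → ℝ, Measurable (fun t : ℝ => volume {a | t < k a}) := by
    intro k
    exact Antitone.measurable (fun s t hst => measure_mono (fun a ha => lt_of_le_of_lt hst ha))
  rw [← lintegral_add_left (hm f), ← lintegral_const_mul _ (hm h)]
  refine setLIntegral_mono ((hm h).const_mul 2) fun t ht => ?_
  rcases lt_or_ge t 1 with h1 | h1
  · refine bm1 (measurableSet_lt measurable_const hf) (measurableSet_lt measurable_const hg) (fs t h1) (gs t h1) ?_
    intro x hx y hy
    simp only [mem_ofPred_eq, mem_Ioi] at *
    have h2 := H x y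
    have h3 : t ^ 2 < h ((x + y) / 2) ^ 2 := lt_of_lt_of_le (by nlinarith) h2
    exact lt_of_pow_lt_pow_left₀ 2 (h0 _) h3
  · have e1 : {a | t < f a} = ∅ := by ext x; simp; linarith [f1 x]
    have e2 : {a | t < g a} = ∅ := by ext x; simp; linarith [g1 x]
    simp [e1, e2]

theorem pl1_bdd {f g h : ℝ → ℝ≥0∞} (hf : Measurable f) (hg : Measurable g) (hh : Measurable h)
    (M : ℝ≥0∞) (hM : M ≠ ∞) (fM : ∀ x, f x ≤ M) (gM : ∀ x, g x ≤ M) (hM' : ∀ x, h x ≤ M)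
    (H : ∀ x y, f x * g y ≤ h ((x + y) / 2) ^ 2) :
    (∫⁻ x, f x) * (∫⁻ x, g x) ≤ (∫⁻ x, h x) ^ 2 := by
  have norm : ∀ k : ℝ → ℝ≥0∞, (∀ x, k x ≤ M) → (∫⁻ x, k x) ≠ 0 → ∃ a : ℝ, 0 < a ∧
      (∀ x, (k x).toReal ≤ a) ∧ ∀ t < a, ∃ x, t < (k x).toReal := by
    intro k kM kI
    have bd : BddAbove (range fun x => (k x).toReal) := ⟨M.toReal, by
      rintro _ ⟨x, rfl⟩; exact ENNReal.toReal_mono hM (kM x)⟩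
    refine ⟨⨆ x, (k x).toReal, ?_, fun x => le_ciSup bd x, fun t ht => exists_lt_of_lt_ciSup ht⟩
    by_contra hc
    push Not at hc
    apply kI
    have : ∀ x, k x = 0 := fun x => by
      have h1 : (k x).toReal ≤ 0 := le_trans (le_ciSup bd x) hc
      have h2 := le_antisymm h1 ENNReal.toReal_nonneg
      rcases (ENNReal.toReal_eq_zero_iff _).mp h2 with h | h
      · exact h
      · exact absurd (h ▸ kM x) (by simpa using hM)
    simp [this]
  by_cases hf0 : ∫⁻ x, f x = 0
  · simp [hf0]
  by_cases hg0 : ∫⁻ x, g x = 0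
  · simp [hg0]
  obtain ⟨a, a0, fa, fa'⟩ := norm f fM hf0
  obtain ⟨b, b0, gb, gb'⟩ := norm g gM hg0
  set c := √(a * b) with hc
  have c0 : 0 < c := Real.sqrt_pos.mpr (by positivity)
  have cc : c ^ 2 = a * b := Real.sq_sqrt (by positivity)
  have fin : ∀ k : ℝ → ℝ≥0∞, (∀ x, k x ≤ M) → ∀ x, k x ≠ ∞ := fun k hk x =>
    (lt_of_le_of_lt (hk x) (lt_top_iff_ne_top.mpr hM)).ne
  have := pl1_norm (f := fun x => (f x).toReal / a) (g := fun x => (g x).toReal / b)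
    (h := fun x => (h x).toReal / c) (hf.ennreal_toReal.div_const _) (hg.ennreal_toReal.div_const _)
    (hh.ennreal_toReal.div_const _) (fun x => by positivity) (fun x => by positivity) (fun x => by positivity)
    (fun x => (div_le_one a0).mpr (fa x)) (fun x => (div_le_one b0).mpr (gb x))
    (fun t ht => by
      obtain ⟨x, hx⟩ := fa' (t * a) (by nlinarith)
      exact ⟨x, (lt_div_iff₀ a0).mpr hx⟩)
    (fun t ht => by
      obtain ⟨x, hx⟩ := gb' (t * b) (by nlinarith)
      exact ⟨x, (lt_div_iff₀ b0).mpr hx⟩)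
    (fun x y => by
      have h1 := ENNReal.toReal_mono (by simp [fin h hM']) (H x y)
      rw [ENNReal.toReal_mul, ENNReal.toReal_pow] at h1
      rw [div_mul_div_comm, div_pow, cc]
      gcongr)
  have conv : ∀ (k : ℝ → ℝ≥0∞) (d : ℝ), 0 < d → Measurable k → (∀ x, k x ≤ M) →
      ∫⁻ x, ENNReal.ofReal ((k x).toReal / d) = (∫⁻ x, k x) * ENNReal.ofReal (1 / d) := by
    intro k d hd hk hkM
    rw [← lintegral_mul_const _ hk]
    congr 1; funext x
    rw [div_eq_mul_one_div, ENNReal.ofReal_mul ENNReal.toReal_nonneg, ENNReal.ofReal_toReal (fin k hkM x)]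
  rw [conv f a a0 hf fM, conv g b b0 hg gM, conv h c c0 hh hM', mul_pow, mul_mul_mul_comm,
    ← ENNReal.ofReal_mul (by positivity), ← ENNReal.ofReal_pow (by positivity)] at this
  have e : 1 / a * (1 / b) = (1 / c) ^ 2 := by rw [div_pow, cc]; field_simp
  rw [e] at this
  exact (ENNReal.mul_le_mul_iff_left (by simp; positivity) (by simp)).mp this

theorem pl1 {f g h : ℝ → ℝ≥0∞} (hf : Measurable f) (hg : Measurable g) (hh : Measurable h)
    (H : ∀ x y, f x * g y ≤ h ((x + y) / 2) ^ 2) :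
    (∫⁻ x, f x) * (∫⁻ x, g x) ≤ (∫⁻ x, h x) ^ 2 := by
  have tr : ∀ k : ℝ → ℝ≥0∞, Measurable k → ∫⁻ x, k x = ⨆ m : ℕ, ∫⁻ x, min (k x) m := by
    intro k hk
    rw [← lintegral_iSup (fun m => hk.min measurable_const)]
    · congr 1; funext x
      have : min (k x) (⨆ m : ℕ, (m : ℝ≥0∞)) = ⨆ m : ℕ, min (k x) m := inf_iSup_eq _ _
      rw [← this, ENNReal.iSup_natCast]; simp
    · intro m m' hm x
      dsimp only
      gcongr
  have mono : ∀ k : ℝ → ℝ≥0∞, Monotone fun m : ℕ => ∫⁻ x, min (k x) m := by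
    intro k m m' hm
    refine lintegral_mono fun x => ?_
    dsimp only
    gcongr
  have main : ∀ m : ℕ, (∫⁻ x, min (f x) m) * (∫⁻ x, min (g x) m) ≤ (∫⁻ x, h x) ^ 2 := by
    intro m
    refine le_trans (pl1_bdd (f := fun x => min (f x) m) (g := fun x => min (g x) m) (h := fun x => min (h x) m)
      (hf.min measurable_const) (hg.min measurable_const) (hh.min measurable_const) m (by simp)
      (fun x => min_le_right _ _) (fun x => min_le_right _ _) (fun x => min_le_right _ _) ?_) ?_
    · intro x y
      rcases le_total (h ((x + y) / 2)) m with h1 | h1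
      · rw [min_eq_left h1]
        exact le_trans (mul_le_mul' (min_le_left _ _) (min_le_left _ _)) (H x y)
      · rw [min_eq_right h1, sq]
        exact mul_le_mul' (min_le_right _ _) (min_le_right _ _)
    · exact pow_le_pow_left' (lintegral_mono fun x => min_le_left _ _) 2
  rw [tr f hf, tr g hg, ENNReal.iSup_mul]
  refine iSup_le fun i => ?_
  rw [ENNReal.mul_iSup]
  refine iSup_le fun j => ?_
  exact le_trans (mul_le_mul' (mono f (le_max_left i j)) (mono g (le_max_right i j))) (main (max i j))

theorem pl (n : ℕ) {f g h : (Fin n → ℝ) → ℝ≥0∞} (hf : Measurable f) (hg : Measurable g) (hh : Measurable h)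
    (H : ∀ x y, f x * g y ≤ h ((1 / 2 : ℝ) • (x + y)) ^ 2) :
    (∫⁻ x, f x) * (∫⁻ x, g x) ≤ (∫⁻ x, h x) ^ 2 := by
  induction n with
  | zero =>
    have : ∀ k : (Fin 0 → ℝ) → ℝ≥0∞, ∫⁻ x, k x = k 0 := by
      intro k
      rw [lintegral_unique]
      simp [volume_pi]
      rfl
    rw [this, this, this]
    simpa using H 0 0
  | succ n ih =>
    have mp := (volume_preserving_piFinSuccAbove (fun _ : Fin (n + 1) => ℝ) 0).symm
    have hcons : ∀ (t : ℝ) (x : Fin n → ℝ),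
        (MeasurableEquiv.piFinSuccAbove (fun _ : Fin (n + 1) => ℝ) 0).symm (t, x) = Fin.cons t x := by
      intro t x
      exact Fin.insertNth_zero' t x
    have key : ∀ k : (Fin (n + 1) → ℝ) → ℝ≥0∞, Measurable k →
        ∫⁻ x, k x = ∫⁻ t : ℝ, ∫⁻ x : Fin n → ℝ, k (Fin.cons t x) := by
      intro k hk
      rw [← mp.lintegral_comp hk, Measure.volume_eq_prod, lintegral_prod _ (by exact (hk.comp mp.measurable).aemeasurable)]
      simp only [hcons]
    have hms : ∀ k : (Fin (n + 1) → ℝ) → ℝ≥0∞, Measurable k →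
        Measurable fun p : ℝ × (Fin n → ℝ) => k (Fin.cons p.1 p.2) := by
      intro k hk
      have := hk.comp mp.measurable
      convert this using 1
      funext p
      exact congrArg k (hcons p.1 p.2).symm
    rw [key f hf, key g hg, key h hh]
    refine pl1 (hms f hf).lintegral_prod_right' (hms g hg).lintegral_prod_right' (hms h hh).lintegral_prod_right' ?_
    intro s t
    refine ih ((hms f hf).comp measurable_prodMk_left) ((hms g hg).comp measurable_prodMk_left)
      ((hms h hh).comp measurable_prodMk_left) ?_
    intro x y
    refine le_trans (H (Fin.cons s x) (Fin.cons t y)) (le_of_eq ?_)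
    congr 2
    funext i
    refine Fin.cases ?_ (fun j => ?_) i <;> simp <;> ring

/-- multiplicative Brunn-Minkowski. -/
theorem bm {n : ℕ} {A B C : Set (EuclideanSpace ℝ (Fin n))} (hA : MeasurableSet A) (hB : MeasurableSet B)
    (hC : MeasurableSet C) (h : ∀ x ∈ A, ∀ y ∈ B, (1 / 2 : ℝ) • (x + y) ∈ C) :
    volume A * volume B ≤ volume C ^ 2 := by
  have mp := (EuclideanSpace.volume_preserving_symm_measurableEquiv_toLp (Fin n)).symm
  have key : ∀ D : Set (EuclideanSpace ℝ (Fin n)), MeasurableSet D → volume D =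
      ∫⁻ x : Fin n → ℝ, D.indicator 1 (WithLp.toLp 2 x) := by
    intro D hD
    rw [← lintegral_indicator_one hD, ← mp.lintegral_comp (measurable_one.indicator hD)]
    rfl
  have hm : ∀ D : Set (EuclideanSpace ℝ (Fin n)), MeasurableSet D →
      Measurable fun x : Fin n → ℝ => (D.indicator 1 (WithLp.toLp 2 x) : ℝ≥0∞) := by
    intro D hD
    exact (measurable_one.indicator hD).comp mp.measurable
  rw [key A hA, key B hB, key C hC]
  refine pl n (hm A hA) (hm B hB) (hm C hC) fun x y => ?_
  by_cases hx : WithLp.toLp 2 x ∈ A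
  · by_cases hy : WithLp.toLp 2 y ∈ B
    · have := h _ hx _ hy
      rw [← WithLp.toLp_add, ← WithLp.toLp_smul] at this
      simp only [indicator, hx, hy, this, if_true, Pi.one_apply]
      simp
    · simp [indicator, hy]
  · simp [indicator, hx]

end AFS
end PartI

section PartJ
namespace AFS

open MeasureTheory Set
open scoped ENNReal Pointwise

section dif
variable {W : Type*} [AddCommGroup W]

/-- iterated finite differences. -/
def dif : List W → (W → ℝ) → W → ℝ
  | [], F => F
  | v :: L, F => dif L (fun h => F (h + v) - F h)

theorem dif_nil (F : W → ℝ) (h : W) : dif [] F h = F h := rfl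
theorem dif_cons (v : W) (L : List W) (F : W → ℝ) : dif (v :: L) F = dif L (fun h => F (h + v) - F h) := rfl

theorem dif_sub (L : List W) (F G : W → ℝ) (h : W) : dif L (fun x => F x - G x) h = dif L F h - dif L G h := by
  induction L generalizing F G with
  | nil => rfl
  | cons v L ih =>
    rw [dif_cons, dif_cons, dif_cons, ih, ih, ih, ih, ih]; ring

theorem dif_zero (L : List W) (h : W) : dif L (fun _ => 0) h = 0 := by
  induction L with
  | nil => rfl
  | cons v L ih => rw [dif_cons]; simpa using ih

theorem dif_add (L : List W) (F G : W → ℝ) (h : W) : dif L (fun x => F x + G x) h = dif L F h + dif L G h := by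
  induction L generalizing F G with
  | nil => rfl
  | cons v L ih =>
    rw [dif_cons, dif_cons, dif_cons, ← ih]; congr 1; funext x; ring

theorem dif_smul (L : List W) (c : ℝ) (F : W → ℝ) (h : W) : dif L (fun x => c * F x) h = c * dif L F h := by
  induction L generalizing F with
  | nil => rfl
  | cons v L ih =>
    rw [dif_cons, dif_cons, ← ih]; congr 1; funext x; ring

theorem dif_sum {α : Type*} (L : List W) (s : Finset α) (F : α → W → ℝ) (h : W) :
    dif L (fun x => ∑ a ∈ s, F a x) h = ∑ a ∈ s, dif L (F a) h := by
  classical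
  induction s using Finset.induction_on with
  | empty => simp [dif_zero]
  | insert a s ha ih => simp only [Finset.sum_insert ha]; rw [dif_add, ih]

theorem dif_shift (L : List W) (F : W → ℝ) (v h : W) : dif L (fun x => F (x + v)) h = dif L F (h + v) := by
  induction L generalizing F with
  | nil => rfl
  | cons w L ih =>
    rw [dif_cons, dif_cons, ← ih]; congr 1; funext x
    rw [add_right_comm]

theorem dif_cons' (v : W) (L : List W) (F : W → ℝ) (h : W) :
    dif (v :: L) F h = dif L F (h + v) - dif L F h := by
  rw [dif_cons, dif_sub, dif_shift]

theorem dif_perm {L L' : List W} (hp : L.Perm L') (F : W → ℝ) : dif L F = dif L' F := by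
  induction hp generalizing F with
  | nil => rfl
  | cons v _ ih => rw [dif_cons, dif_cons, ih]
  | swap v w L =>
    rw [dif_cons, dif_cons, dif_cons, dif_cons]; congr 1; funext h
    rw [add_right_comm]; ring
  | trans _ _ h1 h2 => rw [h1, h2]

theorem dif_congr (F G : W → ℝ) (L : List W) (D : Set W) (hFG : ∀ x ∈ D, F x = G x) (h : W)
    (hD : ∀ L' : List W, L'.Sublist L → h + L'.sum ∈ D) : dif L F h = dif L G h := by
  induction L generalizing h with
  | nil => exact hFG h (by simpa using hD [] (by simp))
  | cons v L ih =>
    rw [dif_cons', dif_cons', ih, ih]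
    · intro L' hL'; exact hD L' (hL'.trans (List.sublist_cons_self v L))
    · intro L' hL'
      have := hD (v :: L') (hL'.cons_cons v)
      rwa [List.sum_cons, ← add_assoc] at this

/-- the sign-sum formula. -/
theorem dif_range (n : ℕ) (v : ℕ → W) (F : W → ℝ) (h : W) :
    dif ((List.range n).map v) F h =
      ∑ S ∈ (Finset.range n).powerset, (-1 : ℝ) ^ (n - S.card) * F (h + ∑ i ∈ S, v i) := by
  induction n generalizing h with
  | zero => simp [dif_nil]
  | succ n ih =>
    have hp : ((List.range (n + 1)).map v).Perm (v n :: (List.range n).map v) := by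
      rw [List.range_succ, List.map_append]
      exact (List.perm_append_comm).trans (by simp)
    rw [dif_perm hp, dif_cons', ih, ih, Finset.range_add_one, Finset.sum_powerset_insert (by simp), sub_eq_neg_add,
      ← Finset.sum_neg_distrib]
    congr 1
    · refine Finset.sum_congr rfl fun S hS => ?_
      have : S.card ≤ n := by simpa using Finset.card_le_card (Finset.mem_powerset.mp hS)
      rw [show n + 1 - S.card = (n - S.card) + 1 by omega, pow_succ]; ring
    · refine Finset.sum_congr rfl fun S hS => ?_
      have h1 : n ∉ S := fun h => by simpa using Finset.mem_powerset.mp hS h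
      rw [Finset.card_insert_of_notMem h1, Finset.sum_insert h1, Nat.add_sub_add_right, add_assoc]

end dif

variable {ι : Type} [Fintype ι] [DecidableEq ι] {n : ℕ}

abbrev EE' (n : ℕ) := EuclideanSpace ℝ (Fin n)

/-- the polytope with given facet normals and support numbers. -/
def Pol (u : ι → EE' n) (h : ι → ℝ) : Set (EE' n) := {x | ∀ i, inner ℝ (u i) x ≤ h i}

noncomputable def gv (u : ι → EE' n) (h : ι → ℝ) : ℝ := volume.real (Pol u h)

noncomputable def Uz (u : ι → EE' n) (z : EE' n) : ι → ℝ := fun i => inner ℝ (u i) z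

structure Geo (u : ι → EE' n) (Γ : Set (ι → ℝ)) (Fc : Finset ι → Prop) : Prop where
  isOpen : IsOpen Γ
  nonempty : Γ.Nonempty
  add : ∀ h ∈ Γ, ∀ h' ∈ Γ, h + h' ∈ Γ
  smul : ∀ h ∈ Γ, ∀ c : ℝ, 0 < c → c • h ∈ Γ
  transl : ∀ h ∈ Γ, ∀ z, h + Uz u z ∈ Γ
  bdd : ∀ h, Bornology.IsBounded (Pol u h)
  nonface : ∀ J, ¬ Fc J → ∀ h ∈ Γ, ∀ x ∈ Pol u h, ∃ j ∈ J, inner ℝ (u j) x < h j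
  face : ∀ J, Fc J → ∀ h ∈ Γ, ∃ z, (∀ j ∈ J, inner ℝ (u j) z = h j) ∧ ∀ i ∉ J, inner ℝ (u i) z < h i
  indep : ∀ J, Fc J → ∀ c : ι → ℝ, ∃ z, ∀ j ∈ J, inner ℝ (u j) z = c j
  card : ∀ J, Fc J → J.card ≤ n

def Slab (u : ι → EE' n) (L : List ι) (s h : ι → ℝ) : Set (EE' n) :=
  {x | (∀ j ∈ L, h j < inner ℝ (u j) x) ∧ ∀ j, inner ℝ (u j) x ≤ if j ∈ L then h j + s j else h j}

theorem Slab_meas (u : ι → EE' n) (L : List ι) (s h : ι → ℝ) : MeasurableSet (Slab u L s h) := by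
  have : Slab u L s h = (⋂ j, {x | j ∈ L → h j < inner ℝ (u j) x}) ∩
      ⋂ j, {x | inner ℝ (u j) x ≤ if j ∈ L then h j + s j else h j} := by
    ext x; simp [Slab]
  rw [this]
  refine (MeasurableSet.iInter fun j => ?_).inter (MeasurableSet.iInter fun j => ?_)
  · by_cases hj : j ∈ L
    · simp only [hj, true_imp_iff]
      exact (isOpen_lt (by fun_prop) (by fun_prop)).measurableSet
    · simp [hj]
  · exact (isClosed_le (by fun_prop) (by fun_prop)).measurableSet

theorem Slab_sub (u : ι → EE' n) (L : List ι) (s h : ι → ℝ) :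
    Slab u L s h ⊆ Pol u (fun j => if j ∈ L then h j + s j else h j) := fun _ hx => hx.2

theorem slab_vol (u : ι → EE' n) (hb : ∀ h, Bornology.IsBounded (Pol u h)) (L : List ι) (hL : L.Nodup)
    (s : ι → ℝ) (hs : ∀ j, 0 ≤ s j) (h : ι → ℝ) :
    dif (L.map fun j => Pi.single j (s j)) (gv u) h = volume.real (Slab u L s h) := by
  induction L generalizing h with
  | nil => simp [dif_nil, gv, Slab, Pol]
  | cons i L ih =>
    rw [List.nodup_cons] at hL
    rw [List.map_cons, dif_cons', ih hL.2, ih hL.2]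
    have hne : ∀ j ∈ L, j ≠ i := fun j hj h => hL.1 (h ▸ hj)
    have e : Slab u (i :: L) s h = Slab u L s (h + Pi.single i (s i)) \ Slab u L s h := by
      ext x
      simp only [Slab, mem_sdiff, Set.mem_ofPred_eq, List.mem_cons]
      constructor
      · rintro ⟨h1, h2⟩
        refine ⟨⟨fun j hj => ?_, fun j => ?_⟩, fun h3 => ?_⟩
        · have := h1 j (Or.inr hj)
          simpa [hne j hj] using this
        · have := h2 j
          by_cases hji : j = i
          · subst hji; simpa [hL.1] using this
          · simpa [hji] using this
        · have h4 := h1 i (Or.inl rfl)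
          have h5 := h3.2 i
          rw [if_neg hL.1] at h5
          linarith
      · rintro ⟨⟨h1, h2⟩, h3⟩
        have h1' : ∀ j ∈ L, h j < inner ℝ (u j) x := fun j hj => by
          simpa [hne j hj] using h1 j hj
        have h2' : ∀ j, inner ℝ (u j) x ≤ if j = i ∨ j ∈ L then h j + s j else h j := fun j => by
          have := h2 j
          by_cases hji : j = i
          · subst hji; simpa [hL.1] using this
          · simpa [hji] using this
        refine ⟨fun j hj => ?_, h2'⟩
        rcases hj with rfl | hj
        · by_contra hc
          push Not at hc
          refine h3 ⟨h1', fun k => ?_⟩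
          by_cases hk : k = j
          · subst hk; simpa [hL.1] using hc
          · simpa [hk] using h2' k
        · exact h1' j hj
    have hsub : Slab u L s h ⊆ Slab u L s (h + Pi.single i (s i)) := by
      rintro x ⟨h1, h2⟩
      refine ⟨fun j hj => by simpa [hne j hj] using h1 j hj, fun j => ?_⟩
      have := h2 j
      by_cases hji : j = i
      · subst hji; simp [hL.1] at this ⊢; linarith [hs j]
      · simpa [hji] using this
    rw [e, measureReal_sdiff hsub (Slab_meas u L s h) ((hb _).subset (Slab_sub u L s _)).measure_lt_top.ne]

theorem slab_bm (u : ι → EE' n) (hb : ∀ h, Bornology.IsBounded (Pol u h)) (L : List ι)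
    (s : ι → ℝ) (h h' : ι → ℝ) :
    volume.real (Slab u L s h) * volume.real (Slab u L s h') ≤
      volume.real (Slab u L s ((1 / 2 : ℝ) • (h + h'))) ^ 2 := by
  have := bm (Slab_meas u L s h) (Slab_meas u L s h') (Slab_meas u L s ((1 / 2 : ℝ) • (h + h'))) (by
    rintro x ⟨h1, h2⟩ y ⟨h3, h4⟩
    refine ⟨fun j hj => ?_, fun j => ?_⟩
    · have := h1 j hj
      have := h3 j hj
      simp only [inner_smul_right, inner_add_right, Pi.smul_apply, Pi.add_apply, smul_eq_mul]
      linarith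
    · have h5 := h2 j
      have h6 := h4 j
      simp only [inner_smul_right, inner_add_right, Pi.smul_apply, Pi.add_apply, smul_eq_mul]
      split_ifs at * <;> linarith)
  have h2 := ENNReal.toReal_mono (by
    refine ENNReal.pow_ne_top ?_
    exact ((hb _).subset (Slab_sub u L s _)).measure_lt_top.ne) this
  rwa [ENNReal.toReal_mul, ENNReal.toReal_pow] at h2

theorem slab_empty {u : ι → EE' n} {Γ : Set (ι → ℝ)} {Fc : Finset ι → Prop} (G : Geo u Γ Fc)
    (L : List ι) (hL : ¬ Fc L.toFinset) (s h : ι → ℝ)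
    (hΓ : ∀ h', (∀ i, h i ≤ h' i ∧ h' i ≤ h i + s i) → h' ∈ Γ) (hs : ∀ i, 0 ≤ s i) : Slab u L s h = ∅ := by
  rw [Set.eq_empty_iff_forall_notMem]
  rintro x ⟨h1, h2⟩
  obtain ⟨j, hj, hlt⟩ := G.nonface _ hL (fun i => if i ∈ L then inner ℝ (u i) x else h i) (hΓ _ fun i => by
    have h3 := h2 i
    by_cases hi : i ∈ L
    · have h4 := h1 i hi
      simp only [hi, if_true] at h3 ⊢
      exact ⟨h4.le, h3⟩
    · simp only [hi, if_false]; exact ⟨le_refl _, by linarith [hs i]⟩) x (fun i => by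
      have h3 := h2 i
      by_cases hi : i ∈ L
      · simp [hi]
      · simpa [hi] using h3)
  simp [List.mem_toFinset.mp hj] at hlt

theorem Pol_transl (u : ι → EE' n) (h : ι → ℝ) (z : EE' n) :
    Pol u (h + Uz u z) = (fun x => x + z) '' Pol u h := by
  ext x
  simp only [Pol, Uz, Set.mem_ofPred_eq, image_add_right, mem_preimage, Pi.add_apply, inner_add_right,
    inner_neg_right]
  exact forall_congr' fun i => by constructor <;> intro h <;> linarith

theorem gv_transl (u : ι → EE' n) (h : ι → ℝ) (z : EE' n) : gv u (h + Uz u z) = gv u h := by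
  rw [gv, Pol_transl, measureReal_def]
  simp only [image_add_right, measure_preimage_add_right]
  rfl

theorem gv_smul (u : ι → EE' n) (h : ι → ℝ) (c : ℝ) (hc : 0 < c) : gv u (c • h) = c ^ n * gv u h := by
  have : Pol u (c • h) = c • Pol u h := by
    ext x
    rw [Set.mem_smul_set_iff_inv_smul_mem₀ hc.ne']
    simp only [Pol, Set.mem_ofPred_eq, inner_smul_right, Pi.smul_apply, smul_eq_mul]
    exact forall_congr' fun i => by rw [inv_mul_le_iff₀ hc]
  rw [gv, this, measureReal_def, Measure.addHaar_smul]
  simp [gv, measureReal_def, abs_of_pos hc, hc.le]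

theorem gv_mono (u : ι → EE' n) (hb : ∀ h, Bornology.IsBounded (Pol u h)) {h h' : ι → ℝ} (hh : h ≤ h') :
    gv u h ≤ gv u h' :=
  measureReal_mono (fun _ hx i => (hx i).trans (hh i)) (hb _).measure_lt_top.ne

end AFS
end PartJ

section PartK
namespace AFS

open MeasureTheory Set
open scoped ENNReal Pointwise

section
variable {ι : Type} [Fintype ι] [DecidableEq ι] {n : ℕ}

def sg (p : List (ι × ℝ)) : List (ι → ℝ) := p.map fun q => Pi.single q.1 q.2

theorem sg_cons (q : ι × ℝ) (p : List (ι × ℝ)) : sg (q :: p) = Pi.single q.1 q.2 :: sg p := rfl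

theorem sg_perm {p p' : List (ι × ℝ)} (h : p.Perm p') : (sg p).Perm (sg p') := h.map _

/-- steps smaller than `r`. -/
def Sm (r : ℝ) (p : List (ι × ℝ)) : Prop := ∀ q ∈ p, |q.2| < r

def LV (Γ : Set (ι → ℝ)) (F : (ι → ℝ) → ℝ) (L : List ι) : Prop :=
  ∀ h0 ∈ Γ, ∃ r > 0, ∀ h, ‖h - h0‖ < r → ∀ p : List (ι × ℝ), (p.map Prod.fst).Perm L → Sm r p →
    dif (sg p) F h = 0

theorem norm_single (i : ι) (s : ℝ) : ‖(Pi.single i s : ι → ℝ)‖ = |s| := by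
  rw [Pi.norm_single]; rfl

theorem LV.perm {Γ : Set (ι → ℝ)} {F : (ι → ℝ) → ℝ} {L L' : List ι} (h : LV Γ F L) (hp : L.Perm L') : LV Γ F L' := by
  intro h0 hh0
  obtain ⟨r, hr, H⟩ := h h0 hh0
  exact ⟨r, hr, fun h hh p hp' => H h hh p (hp'.trans hp.symm)⟩

theorem split_perm {p : List (ι × ℝ)} {i : ι} {L : List ι} (h : (p.map Prod.fst).Perm (i :: L)) :
    ∃ s p', p.Perm ((i, s) :: p') ∧ (p'.map Prod.fst).Perm L := by
  have : i ∈ p.map Prod.fst := h.symm.subset (by simp)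
  obtain ⟨⟨j, s⟩, hq, rfl⟩ := List.mem_map.mp this
  refine ⟨s, p.erase (j, s), List.perm_cons_erase hq, ?_⟩
  have h2 := ((List.perm_cons_erase hq).map Prod.fst).symm.trans h
  exact List.Perm.cons_inv h2

theorem Sm.perm {r : ℝ} {p p' : List (ι × ℝ)} (h : Sm r p) (hp : p.Perm p') : Sm r p' :=
  fun q hq => h q (hp.symm.subset hq)

theorem LV.cons {Γ : Set (ι → ℝ)} {F : (ι → ℝ) → ℝ} {L : List ι} (h : LV Γ F L) (i : ι) : LV Γ F (i :: L) := by
  intro h0 hh0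
  obtain ⟨r, hr, H⟩ := h h0 hh0
  refine ⟨r / 2, by positivity, fun h hh p hp hs => ?_⟩
  obtain ⟨s, p', h1, h2⟩ := split_perm hp
  have hs' := hs.perm h1
  have hs2 : |s| < r / 2 := hs' (i, s) (by simp)
  have hs3 : Sm r p' := fun q hq => lt_trans (hs' q (by simp [hq])) (by linarith)
  rw [dif_perm (sg_perm h1), sg_cons, dif_cons', H _ _ p' h2 hs3, H _ (by linarith) p' h2 hs3, sub_zero]
  calc ‖h + Pi.single i s - h0‖ = ‖(h - h0) + Pi.single i s‖ := by congr 1; abel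
    _ ≤ ‖h - h0‖ + |s| := by rw [← norm_single i s]; exact norm_add_le _ _
    _ < r := by linarith

theorem LV.append {Γ : Set (ι → ℝ)} {F : (ι → ℝ) → ℝ} {L : List ι} (h : LV Γ F L) (L' : List ι) : LV Γ F (L' ++ L) := by
  induction L' with
  | nil => exact h
  | cons i L' ih => exact ih.cons i

theorem dif_abs (p : List (ι × ℝ)) (F : (ι → ℝ) → ℝ) (h : ι → ℝ)
    (H : ∀ h', ‖h' - h‖ ≤ (p.map fun q => |q.2|).sum → dif (sg (p.map fun q => (q.1, |q.2|))) F h' = 0) :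
    dif (sg p) F h = 0 := by
  induction p generalizing F with
  | nil => exact H h (by simp)
  | cons q p ih =>
    rw [sg_cons, dif_cons]
    apply ih
    intro h' hh'
    rcases le_total 0 q.2 with h0 | h0
    · have := H h' (by rw [List.map_cons, List.sum_cons]; linarith [abs_nonneg q.2])
      rw [List.map_cons, sg_cons, dif_cons] at this
      rwa [abs_of_nonneg h0] at this
    · have := H (h' + Pi.single q.1 q.2) (by
        rw [List.map_cons, List.sum_cons]
        calc ‖h' + Pi.single q.1 q.2 - h‖ = ‖(h' - h) + Pi.single q.1 q.2‖ := by congr 1; abel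
          _ ≤ ‖h' - h‖ + |q.2| := by rw [← norm_single q.1 q.2]; exact norm_add_le _ _
          _ ≤ _ := by linarith)
      rw [List.map_cons, sg_cons, dif_cons'] at this
      rw [← dif_cons, dif_cons']
      rw [abs_of_nonpos h0] at this
      have e : h' + Pi.single q.1 q.2 + Pi.single q.1 (-q.2) = h' := by
        rw [add_assoc, ← Pi.single_add]; simp
      have this : dif (sg (p.map fun q => (q.1, |q.2|))) F (h' + Pi.single q.1 q.2 + Pi.single q.1 (-q.2)) - dif (sg (p.map fun q => (q.1, |q.2|))) F (h' + Pi.single q.1 q.2) = 0 := this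
      rw [e] at this
      linarith

theorem exists_s (p : List (ι × ℝ)) (hp : (p.map Prod.fst).Nodup) (r : ℝ) (hr : 0 < r)
    (h : ∀ q ∈ p, 0 ≤ q.2 ∧ q.2 < r) :
    ∃ s : ι → ℝ, (∀ i, 0 ≤ s i ∧ s i < r) ∧ sg p = (p.map Prod.fst).map fun j => Pi.single j (s j) := by
  induction p with
  | nil => exact ⟨fun _ => 0, fun i => ⟨le_refl _, hr⟩, rfl⟩
  | cons q p ih =>
    rw [List.map_cons, List.nodup_cons] at hp
    obtain ⟨s, hs, hs'⟩ := ih hp.2 (fun q' hq' => h q' (by simp [hq']))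
    refine ⟨Function.update s q.1 q.2, fun i => ?_, ?_⟩
    · by_cases hi : i = q.1
      · subst hi; simpa using h q (by simp)
      · simpa [hi] using hs i
    · rw [sg_cons, List.map_cons, List.map_cons, hs']
      congr 1
      · simp
      · refine List.map_congr_left fun j hj => ?_
        have : j ≠ q.1 := fun e => hp.1 (e ▸ hj)
        simp [this]

theorem ball_sub {Γ : Set (ι → ℝ)} (hΓ : IsOpen Γ) {h0 : ι → ℝ} (hh0 : h0 ∈ Γ) :
    ∃ r > 0, ∀ h, ‖h - h0‖ < r → h ∈ Γ := by
  obtain ⟨r, hr, H⟩ := Metric.isOpen_iff.mp hΓ h0 hh0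
  exact ⟨r, hr, fun h hh => H (by rwa [Metric.mem_ball, dist_eq_norm])⟩

theorem sum_lt_of_Sm {r : ℝ} (hr : 0 < r) {p : List (ι × ℝ)} (h : Sm r p) :
    (p.map fun q => |q.2|).sum ≤ p.length * r := by
  induction p with
  | nil => simp
  | cons q p ih =>
    have h1 := ih (fun q' hq' => h q' (by simp [hq']))
    have h2 := h q (by simp)
    rw [List.map_cons, List.sum_cons, List.length_cons]; push_cast; linarith

theorem LV_nonface {u : ι → EE' n} {Γ : Set (ι → ℝ)} {Fc : Finset ι → Prop} (G : Geo u Γ Fc)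
    (L : List ι) (hn : L.Nodup) (hL : ¬ Fc L.toFinset) : LV Γ (gv u) L := by
  intro h0 hh0
  obtain ⟨R, hR, HR⟩ := ball_sub G.isOpen hh0
  set r := R / (L.length + 2) with hr
  have hr0 : 0 < r := by positivity
  have hrR : (L.length + 2) * r = R := by rw [hr]; field_simp
  refine ⟨r, hr0, fun h hh p hp hs => ?_⟩
  apply dif_abs
  intro h' hh'
  have hnd : (p.map Prod.fst).Nodup := hp.nodup_iff.mpr hn
  set p' := p.map fun q => (q.1, |q.2|) with hp'
  have e1 : p'.map Prod.fst = p.map Prod.fst := by rw [hp', List.map_map]; rfl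
  obtain ⟨s, hs1, hs2⟩ := exists_s p' (by rwa [e1]) r hr0 (by
    intro q hq
    rw [hp'] at hq
    obtain ⟨q', hq', rfl⟩ := List.mem_map.mp hq
    exact ⟨abs_nonneg _, hs q' hq'⟩)
  rw [hs2, e1, slab_vol u G.bdd _ hnd s (fun j => (hs1 j).1), slab_empty G]
  · simp
  · rwa [List.toFinset_eq_of_perm _ _ hp]
  · intro h'' hh''
    apply HR
    have h3 : ‖h'' - h'‖ ≤ r := by
      rw [pi_norm_le_iff_of_nonneg hr0.le]
      intro i
      rw [Pi.sub_apply, Real.norm_eq_abs, abs_le]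
      constructor <;> linarith [(hh'' i).1, (hh'' i).2, (hs1 i).2]
    have h4 := sum_lt_of_Sm hr0 hs
    have h5 : p.length = L.length := by simpa using hp.length_eq
    rw [h5] at h4
    calc ‖h'' - h0‖ = ‖(h'' - h') + ((h' - h) + (h - h0))‖ := by congr 1; abel
      _ ≤ ‖h'' - h'‖ + (‖h' - h‖ + ‖h - h0‖) := (norm_add_le _ _).trans (by gcongr; exact norm_add_le _ _)
      _ < (L.length + 2) * r := by linarith
      _ = R := hrR
  · exact fun i => (hs1 i).1

theorem exists_pos_le (r : ι → ℝ) (h : ∀ l, 0 < r l) : ∃ ρ > 0, ∀ l, ρ ≤ r l := by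
  rcases isEmpty_or_nonempty ι with he | he
  · exact ⟨1, one_pos, fun l => he.elim l⟩
  · obtain ⟨l, hl⟩ := Finite.exists_min r
    exact ⟨r l, h l, hl⟩

theorem sum_single_apply (T : Finset ι) (w : ι → ℝ) (k : ι) :
    (∑ l ∈ T, (Pi.single l (w l) : ι → ℝ)) k = if k ∈ T then w k else 0 := by
  rw [Finset.sum_apply]
  simp only [Pi.single_apply]
  simp

theorem walk (F : (ι → ℝ) → ℝ) (h0 : ι → ℝ) (r : ℝ) (S : Finset ι)
    (H : ∀ l ∈ S, ∀ h, ‖h - h0‖ < r → ∀ t, |t| < r → F (h + Pi.single l t) = F h)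
    (h : ι → ℝ) (hh : ‖h - h0‖ < r / 2) (w : ι → ℝ) (hw : ∀ l, |w l| < r / 2) (hw0 : ∀ l ∉ S, w l = 0) :
    F (h + w) = F h := by
  have hr : 0 < r := by linarith [norm_nonneg (h - h0)]
  have key : ∀ T ⊆ S, F (h + ∑ l ∈ T, (Pi.single l (w l) : ι → ℝ)) = F h := by
    intro T
    induction T using Finset.induction_on with
    | empty => simp
    | insert a T ha ih =>
      intro hT
      rw [Finset.sum_insert ha, add_comm (Pi.single a (w a) : ι → ℝ), ← add_assoc, H a (hT (by simp)) _ _ _ (by linarith [hw a])]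
      · exact ih (fun x hx => hT (by simp [hx]))
      · have : ‖∑ l ∈ T, (Pi.single l (w l) : ι → ℝ)‖ ≤ r / 2 := by
          rw [pi_norm_le_iff_of_nonneg (by positivity)]
          intro i
          rw [sum_single_apply]
          split_ifs
          · exact (hw i).le
          · simp; positivity
        calc _ = ‖(h - h0) + ∑ l ∈ T, (Pi.single l (w l) : ι → ℝ)‖ := by congr 1; abel
          _ ≤ _ := norm_add_le _ _
          _ < r := by linarith
  have e : ∑ l ∈ S, (Pi.single l (w l) : ι → ℝ) = w := by
    funext k
    rw [sum_single_apply]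
    split_ifs with hk
    · rfl
    · exact (hw0 k hk).symm
  rw [← e]; exact key S (Finset.Subset.refl _)

theorem dif_transl (u : ι → EE' n) (L : List (ι → ℝ)) (h : ι → ℝ) (z : EE' n) :
    dif L (gv u) (h + Uz u z) = dif L (gv u) h := by
  rw [← dif_shift]; congr 1; funext x; exact gv_transl u x z

theorem LV_main {u : ι → EE' n} {Γ : Set (ι → ℝ)} {Fc : Finset ι → Prop} (G : Geo u Γ Fc)
    (m : ℕ) : ∀ L : List ι, n < L.length → Fintype.card ι - L.toFinset.card ≤ m → LV Γ (gv u) L := by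
  have nf : ∀ L : List ι, ¬ Fc L.toFinset → LV Γ (gv u) L := by
    intro L hL
    obtain ⟨l, hl⟩ := (List.dedup_sublist L).exists_perm_append
    refine LV.perm (LV.append (LV_nonface G L.dedup (List.nodup_dedup L) ?_) l) ?_
    · have e : L.dedup.toFinset = L.toFinset := by ext; simp
      rwa [e]
    · exact (List.perm_append_comm).trans hl.symm
  induction m with
  | zero =>
    intro L hlen hm
    apply nf
    intro hF
    obtain ⟨i, hi⟩ := List.exists_duplicate_iff_not_nodup.mpr (fun hnd : L.Nodup => by
      have := G.card _ hF
      rw [List.toFinset_card_of_nodup hnd] at this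
      omega)
    -- all indices belong to the face
    have hall : L.toFinset = Finset.univ := by
      apply Finset.eq_univ_of_card
      have := Finset.card_le_univ L.toFinset
      omega
    obtain ⟨h, hh⟩ := G.nonempty
    obtain ⟨z, hz⟩ := G.indep _ hF (fun j => if j = i then -1 else 0)
    -- then the polytope contains a ray
    have hb := G.bdd h
    obtain ⟨x, hx, -⟩ := G.face _ hF h hh
    obtain ⟨C, hC⟩ := hb.exists_norm_le
    have hz0 : z ≠ 0 := by
      rintro rfl
      have := hz i (by rw [hall]; simp)
      simp at this
    have hray : ∀ t : ℝ, 0 ≤ t → x + t • z ∈ Pol u h := by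
      intro t ht j
      rw [inner_add_right, inner_smul_right, hx j (by rw [hall]; simp), hz j (by rw [hall]; simp)]
      split_ifs <;> nlinarith
    have hzn : 0 < ‖z‖ := norm_pos_iff.mpr hz0
    have h1 := hC _ (hray ((C + ‖x‖ + 1) / ‖z‖) (by
      have := hC _ (hray 0 (le_refl _))
      have h2 : 0 ≤ C := (norm_nonneg _).trans this
      positivity))
    have h2 : 0 ≤ C := (norm_nonneg _).trans h1
    have h3 : ‖((C + ‖x‖ + 1) / ‖z‖) • z‖ = C + ‖x‖ + 1 := by
      rw [norm_smul, Real.norm_of_nonneg (by positivity)]; field_simp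
    have h4 := norm_sub_norm_le (((C + ‖x‖ + 1) / ‖z‖) • z) (-x)
    rw [sub_neg_eq_add, norm_neg, h3, add_comm _ x] at h4
    linarith
  | succ m ih =>
    intro L hlen hm
    by_cases hF : Fc L.toFinset
    swap
    · exact nf L hF
    obtain ⟨i, hi⟩ := List.exists_duplicate_iff_not_nodup.mpr (fun hnd : L.Nodup => by
      have := G.card _ hF
      rw [List.toFinset_card_of_nodup hnd] at this
      omega)
    rw [List.duplicate_iff_sublist] at hi
    obtain ⟨l, hl⟩ := hi.exists_perm_append
    refine LV.perm (L := i :: (i :: l)) ?_ hl.symm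
    set L' := i :: l with hL'
    have hJ : L.toFinset = L'.toFinset := by
      rw [List.toFinset_eq_of_perm _ _ hl]; ext x; simp [hL']
    set J := L'.toFinset with hJdef
    obtain ⟨z, hz⟩ := G.indep _ hF (fun j => if j = i then 1 else 0)
    rw [hJ] at hz hm
    have IH : ∀ k : {k // k ∉ J}, LV Γ (gv u) (k.1 :: L') := by
      intro k
      apply ih
      · rw [List.length_cons]
        have := hl.length_eq
        simp only [List.length_append, List.length_cons, List.length_nil] at this
        rw [hL', List.length_cons]
        omega
      · rw [List.toFinset_cons, Finset.card_insert_of_notMem k.2]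
        omega
    intro h0 hh0
    choose r hr H using fun k => IH k h0 hh0
    obtain ⟨ρ, hρ, hρr⟩ := exists_pos_le r hr
    set C := 1 + ∑ k, |inner ℝ (u k) z| with hC
    have hC1 : 1 ≤ C := by
      have : 0 ≤ ∑ k, |inner ℝ (u k) z| := Finset.sum_nonneg fun k _ => abs_nonneg _
      linarith
    have hkC : ∀ k, |inner ℝ (u k) z| ≤ C := fun k => by
      have := Finset.single_le_sum (f := fun k => |inner ℝ (u k) z|) (fun k _ => abs_nonneg _) (Finset.mem_univ k)
      linarith
    refine ⟨ρ / (2 * C), by positivity, fun h hh p hp hs => ?_⟩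
    obtain ⟨s, p', h1, h2⟩ := split_perm hp
    have hs' := hs.perm h1
    have hs2 : |s| < ρ / (2 * C) := hs' (i, s) (by simp)
    have hle : ρ / (2 * C) ≤ ρ / 2 := by
      gcongr; linarith
    have hs3 : Sm ρ p' := fun q hq => lt_of_lt_of_le (hs' q (by simp [hq])) (by linarith)
    rw [dif_perm (sg_perm h1), sg_cons, dif_cons']
    set F := dif (sg p') (gv u) with hFdef
    set w : ι → ℝ := Pi.single i s + Uz u (-s • z) with hw
    have e1 : F (h + Pi.single i s) = F (h + w) := by
      rw [hw, ← add_assoc, hFdef, dif_transl]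
    have hiJ : i ∈ J := by simp [hJdef, hL']
    have hw0 : ∀ k ∉ Finset.univ \ J, w k = 0 := by
      intro k hk
      have hkJ : k ∈ J := by simpa using hk
      rw [hw, Pi.add_apply, Uz, inner_smul_right, hz k hkJ, Pi.single_apply]
      split_ifs <;> simp
    have hwk : ∀ k, |w k| < ρ / 2 := by
      intro k
      by_cases hkJ : k ∈ J
      · rw [hw0 k (by simpa using hkJ)]; simp; positivity
      · have hki : k ≠ i := fun h => hkJ (h ▸ hiJ)
        rw [hw, Pi.add_apply, Uz, inner_smul_right, Pi.single_apply, if_neg hki, zero_add, abs_mul, abs_neg]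
        calc |s| * |inner ℝ (u k) z| ≤ |s| * C := by gcongr; exact hkC k
          _ < ρ / (2 * C) * C := by gcongr
          _ = ρ / 2 := by field_simp
    rw [e1, walk F h0 ρ (Finset.univ \ J) ?_ h (by linarith) w hwk hw0, sub_self]
    intro k hk h' hh' t ht
    have hkJ : k ∉ J := by simpa using hk
    have h3 := H ⟨k, hkJ⟩ h' (lt_of_lt_of_le hh' (hρr _)) ((k, t) :: p') (by simpa using h2) (by
      intro q hq
      rcases List.mem_cons.mp hq with rfl | hq
      · exact lt_of_lt_of_le ht (hρr _)
      · exact lt_of_lt_of_le (hs3 q hq) (hρr _))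
    rw [sg_cons, dif_cons'] at h3
    linarith

end
end AFS
end PartK

section PartL
namespace AFS

open MeasureTheory Set
open scoped ENNReal Pointwise

section
variable {ι : Type} [Fintype ι] [DecidableEq ι] {n : ℕ}

/-- bounded additive functions on an interval are linear -/
theorem add_lin (T : ℝ → ℝ) (r C : ℝ) (hr : 0 < r)
    (hadd : ∀ s t, |s| < r → |t| < r → |s + t| < r → T (s + t) = T s + T t)
    (hb : ∀ s, |s| < r → |T s| ≤ C) (s : ℝ) (hs : |s| < r) : T s = s / (r / 2) * T (r / 2) := by
  set c := r / 2 with hc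
  have hc0 : 0 < c := by positivity
  have hcr : |c| < r := by rw [abs_of_pos hc0]; linarith
  set E : ℝ → ℝ := fun s => T s - s / c * T c with hE
  have Eadd : ∀ s t, |s| < r → |t| < r → |s + t| < r → E (s + t) = E s + E t := by
    intro s t h1 h2 h3
    simp only [hE]; rw [hadd s t h1 h2 h3]; ring
  have Ec : E c = 0 := by simp only [hE]; field_simp; ring
  have E0 : E 0 = 0 := by
    have := Eadd 0 0 (by simpa) (by simpa) (by simpa)
    rw [add_zero] at this; linarith
  have Enc : E (-c) = 0 := by
    have := Eadd c (-c) hcr (by rwa [abs_neg]) (by simpa)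
    rw [add_neg_cancel, E0, Ec] at this; linarith
  have key : ∀ k : ℕ, ∀ s, |s| < r → |E s| ≤ (C + 2 * C) / 2 ^ k := by
    intro k
    induction k with
    | zero =>
      intro s hs
      have h1 := hb s hs
      have h2 := hb c hcr
      have h3 : |s / c| ≤ 2 := by
        rw [abs_div, abs_of_pos hc0, div_le_iff₀ hc0]; linarith
      calc |E s| ≤ |T s| + |s / c * T c| := abs_sub _ _
        _ ≤ C + 2 * C := by rw [abs_mul]; gcongr
        _ = _ := by simp
    | succ k ih =>
      have half : ∀ s, |s| < c → |E s| ≤ (C + 2 * C) / 2 ^ (k + 1) := by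
        intro s hs
        have h1 : |s + s| < r := by rw [← two_mul, abs_mul, abs_two]; linarith
        have h2 := Eadd s s (by linarith) (by linarith) h1
        have h3 := ih _ h1
        rw [h2, ← two_mul, abs_mul, abs_two] at h3
        rw [pow_succ, ← div_div, le_div_iff₀ (by norm_num)]; linarith
      intro s hs
      rw [abs_lt] at hs
      by_cases h1 : |s| < c
      · exact half s h1
      · rcases le_abs.mp (not_lt.mp h1) with h2 | h2
        · have h3 : |s - c| < c := by rw [abs_lt]; constructor <;> linarith
          have := Eadd c (s - c) hcr (by linarith) (by rw [abs_lt]; constructor <;> linarith)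
          rw [add_sub_cancel, Ec, zero_add] at this
          rw [this]; exact half _ h3
        · have h3 : |s + c| < c := by rw [abs_lt]; constructor <;> linarith
          have := Eadd (-c) (s + c) (by rwa [abs_neg]) (by linarith) (by rw [abs_lt]; constructor <;> linarith)
          rw [neg_add_cancel_comm_assoc, Enc, zero_add] at this
          rw [this]; exact half _ h3
  have hz : E s = 0 := by
    by_contra hne
    have h1 : 0 < |E s| := abs_pos.mpr hne
    have ht : Filter.Tendsto (fun k : ℕ => (C + 2 * C) / (2 : ℝ) ^ k) Filter.atTop (nhds 0) :=
      Filter.Tendsto.div_atTop tendsto_const_nhds (tendsto_pow_atTop_atTop_of_one_lt one_lt_two)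
    have := ge_of_tendsto' ht fun k => key k s hs
    linarith
  simp only [hE] at hz; linarith

theorem LM (L : List ι) : ∀ (F : (ι → ℝ) → ℝ) (h0 : ι → ℝ) (r C : ℝ), 0 < r →
    (∀ i, ∀ p : List (ι × ℝ), (p.map Prod.fst).Perm (i :: L) → Sm r p → dif (sg p) F h0 = 0) →
    (∀ p : List (ι × ℝ), (p.map Prod.fst).Perm L → Sm r p → |dif (sg p) F h0| ≤ C) →
    ∃ τ : ℝ, ∀ p : List (ι × ℝ), p.map Prod.fst = L → Sm r p → dif (sg p) F h0 = τ * (p.map Prod.snd).prod := by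
  induction L with
  | nil =>
    intro F h0 r C hr H0 HB
    refine ⟨F h0, fun p hp hs => ?_⟩
    rw [List.map_eq_nil_iff] at hp
    subst hp; simp [sg, dif_nil]
  | cons i L ih =>
    intro F h0 r C hr H0 HB
    have hcr : |r / 2| < r := by rw [abs_of_pos (by positivity)]; linarith
    obtain ⟨τ, hτ⟩ := ih (fun h => F (h + Pi.single i (r / 2)) - F h) h0 r C hr (fun j p hp hs => by
        have := H0 j ((i, r / 2) :: p) (by
          rw [List.map_cons]; exact (hp.cons i).trans (List.Perm.swap _ _ _)) (by
          intro q hq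
          rcases List.mem_cons.mp hq with rfl | hq
          · exact hcr
          · exact hs q hq)
        rwa [sg_cons, dif_cons] at this) (fun p hp hs => by
        have := HB ((i, r / 2) :: p) (by rw [List.map_cons]; exact hp.cons i) (by
          intro q hq
          rcases List.mem_cons.mp hq with rfl | hq
          · exact hcr
          · exact hs q hq)
        rwa [sg_cons, dif_cons] at this)
    refine ⟨τ / (r / 2), fun p hp hs => ?_⟩
    match p, hp, hs with
    | (j, s) :: p, hp, hs =>
      rw [List.map_cons, List.cons.injEq] at hp
      obtain ⟨rfl, hp2⟩ := hp
      have hs1 : |s| < r := hs (j, s) (by simp)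
      have hs2 : Sm r p := fun q hq => hs q (by simp [hq])
      have := add_lin (fun s => dif (sg ((j, s) :: p)) F h0) r C hr (by
        intro s t h1 h2 h3
        have h4 := H0 j ((j, s) :: (j, t) :: p) (by simp [hp2]) (by
          intro q hq
          rcases List.mem_cons.mp hq with rfl | hq
          · exact h1
          rcases List.mem_cons.mp hq with rfl | hq
          · exact h2
          · exact hs2 q hq)
        simp only [sg_cons, dif_cons'] at h4 ⊢
        rw [Pi.single_add, ← add_assoc]
        linarith) (by
        intro s h1
        refine HB _ (by simp [hp2]) ?_
        intro q hq
        rcases List.mem_cons.mp hq with rfl | hq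
        · exact h1
        · exact hs2 q hq) s hs1
      rw [this, List.map_cons, List.prod_cons, sg_cons, dif_cons, hτ p hp2 hs2]
      field_simp

theorem dif_bound (p : List (ι × ℝ)) (F : (ι → ℝ) → ℝ) (h : ι → ℝ) (C : ℝ)
    (H : ∀ h', ‖h' - h‖ ≤ (p.map fun q => |q.2|).sum → |F h'| ≤ C) :
    |dif (sg p) F h| ≤ 2 ^ p.length * C := by
  induction p generalizing h with
  | nil => simpa [sg, dif_nil] using H h (by simp)
  | cons q p ih =>
    rw [sg_cons, dif_cons', List.length_cons, pow_succ]
    have h1 := ih h (fun h' hh' => H h' (by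
      rw [List.map_cons, List.sum_cons]; linarith [abs_nonneg q.2]))
    have h2 := ih (h + Pi.single q.1 q.2) (fun h' hh' => H h' (by
      rw [List.map_cons, List.sum_cons]
      calc ‖h' - h‖ = ‖(h' - (h + Pi.single q.1 q.2)) + Pi.single q.1 q.2‖ := by congr 1; abel
        _ ≤ _ + |q.2| := by rw [← norm_single q.1 q.2]; exact norm_add_le _ _
        _ ≤ _ := by linarith))
    have h3 := abs_sub (dif (sg p) F (h + Pi.single q.1 q.2)) (dif (sg p) F h)
    linarith

def LB (Γ : Set (ι → ℝ)) (F : (ι → ℝ) → ℝ) : Prop :=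
  ∀ h0 ∈ Γ, ∃ r > 0, ∃ C, ∀ h, ‖h - h0‖ < r → |F h| ≤ C

def Der (Γ : Set (ι → ℝ)) (F : (ι → ℝ) → ℝ) (L : List ι) (τ : ℝ) : Prop :=
  ∀ h0 ∈ Γ, ∃ r > 0, ∀ h, ‖h - h0‖ < r → ∀ p : List (ι × ℝ), p.map Prod.fst = L → Sm r p →
    dif (sg p) F h = τ * (p.map Prod.snd).prod

/-- test list of constant steps -/
def cst (L : List ι) (c : ℝ) : List (ι × ℝ) := L.map fun i => (i, c)
theorem cst_fst (L : List ι) (c : ℝ) : (cst L c).map Prod.fst = L := by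
  rw [cst, List.map_map]; simp [Function.comp_def]
theorem cst_snd (L : List ι) (c : ℝ) : ((cst L c).map Prod.snd).prod = c ^ L.length := by
  rw [cst, List.map_map]; simp [Function.comp_def]
theorem cst_Sm (L : List ι) (c r : ℝ) (hc : |c| < r) : Sm r (cst L c) := by
  intro q hq
  rw [cst, List.mem_map] at hq
  obtain ⟨i, -, rfl⟩ := hq
  exact hc

theorem Der_local {Γ : Set (ι → ℝ)} {F : (ι → ℝ) → ℝ} {L : List ι} (hB : LB Γ F) (hL : ∀ i, LV Γ F (i :: L))
    (h0 : ι → ℝ) (hh0 : h0 ∈ Γ) :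
    ∃ r > 0, ∃ τ, ∀ h, ‖h - h0‖ < r → ∀ p : List (ι × ℝ), p.map Prod.fst = L → Sm r p →
    dif (sg p) F h = τ * (p.map Prod.snd).prod := by
  obtain ⟨R, hR, C, HC⟩ := hB h0 hh0
  choose r hr H using fun i => hL i h0 hh0
  obtain ⟨ρ, hρ, hρr⟩ := exists_pos_le r hr
  set r' := min ρ (R / (L.length + 1)) with hr'
  have hr0 : 0 < r' := lt_min hρ (by positivity)
  have hr1 : r' ≤ ρ := min_le_left _ _
  have hr2 : (L.length + 1) * r' ≤ R := by
    have : r' ≤ R / (L.length + 1) := min_le_right _ _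
    rw [le_div_iff₀ (by positivity)] at this; linarith
  have loc : ∀ h, ‖h - h0‖ < r' → ∃ τ : ℝ, ∀ p : List (ι × ℝ), p.map Prod.fst = L → Sm r' p →
      dif (sg p) F h = τ * (p.map Prod.snd).prod := by
    intro h hh
    apply LM L F h r' (2 ^ L.length * C) hr0
    · intro i p hp hs
      exact H i h (by linarith [hρr i]) p hp fun q hq => by linarith [hs q hq, hρr i]
    · intro p hp hs
      have h5 : p.length = L.length := by simpa using hp.length_eq
      rw [← h5]
      apply dif_bound
      intro h' hh'
      apply HC
      have h4 := sum_lt_of_Sm hr0 hs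
      rw [h5] at h4
      calc ‖h' - h0‖ = ‖(h' - h) + (h - h0)‖ := by congr 1; abel
        _ ≤ ‖h' - h‖ + ‖h - h0‖ := norm_add_le _ _
        _ < R := by linarith
  obtain ⟨τ, hτ⟩ := loc h0 (by simpa)
  refine ⟨r' / 2, by positivity, τ, fun h hh p hp hs => ?_⟩
  obtain ⟨τ', hτ'⟩ := loc h (by linarith)
  rw [hτ' p hp (fun q hq => by linarith [hs q hq])]
  congr 1
  have hc : |r' / 2| < r' := by rw [abs_of_pos (by positivity)]; linarith
  have e1 := hτ _ (cst_fst L (r' / 2)) (cst_Sm L _ r' hc)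
  have e2 := hτ' _ (cst_fst L (r' / 2)) (cst_Sm L _ r' hc)
  have e3 := walk (dif (sg (cst L (r' / 2))) F) h0 r' Finset.univ (by
    intro l _ h' hh' t ht
    have := H l h' (by linarith [hρr l]) ((l, t) :: cst L (r' / 2)) (by rw [List.map_cons, cst_fst]) (by
      intro q hq
      rcases List.mem_cons.mp hq with rfl | hq
      · exact lt_of_lt_of_le ht (hr1.trans (hρr l))
      · exact lt_of_lt_of_le (cst_Sm L _ r' hc q hq) (hr1.trans (hρr l)))
    rw [sg_cons, dif_cons'] at this
    linarith) h0 (by simpa) (h - h0) (fun l => lt_of_le_of_lt (norm_le_pi_norm (h - h0) l) hh) (by simp)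
  rw [add_sub_cancel, e1, e2, cst_snd] at e3
  exact mul_right_cancel₀ (by positivity) e3

theorem Der_exists {Γ : Set (ι → ℝ)} {F : (ι → ℝ) → ℝ} {L : List ι} (hne : Γ.Nonempty)
    (hconv : Convex ℝ Γ) (hB : LB Γ F) (hL : ∀ i, LV Γ F (i :: L)) :
    ∃ τ, Der Γ F L τ := by
  choose! r hr τ hτ using Der_local hB hL
  obtain ⟨h1, hh1⟩ := hne
  have loc : ∀ h0 ∈ Γ, ∀ h ∈ Γ, ‖h - h0‖ < r h0 → τ h = τ h0 := by
    intro h0 hh0 h hh hlt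
    set c := min (r h0) (r h) / 2 with hc
    have hc0 : 0 < c := by have := lt_min (hr h0 hh0) (hr h hh); positivity
    have e1 := hτ h0 hh0 h hlt _ (cst_fst L c) (cst_Sm L _ _ (by
      rw [abs_of_pos hc0]; linarith [min_le_left (r h0) (r h)]))
    have e2 := hτ h hh h (by simpa using hr h hh) _ (cst_fst L c) (cst_Sm L _ _ (by
      rw [abs_of_pos hc0]; linarith [min_le_right (r h0) (r h)]))
    rw [e1, cst_snd] at e2
    exact (mul_right_cancel₀ (by positivity) e2).symm
  have hcont : ContinuousOn τ Γ := by
    intro h0 hh0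
    rw [Metric.continuousWithinAt_iff]
    intro ε hε
    refine ⟨r h0, hr h0 hh0, fun {h} hh hd => ?_⟩
    rw [loc h0 hh0 h hh (by rwa [← dist_eq_norm]), dist_self]; exact hε
  have const : ∀ h0 ∈ Γ, τ h0 = τ h1 := by
    intro h0 hh0
    refine hconv.isPreconnected.induction₂ (fun a b => τ a = τ b) ?_ ?_ ?_ hh0 hh1
    · intro x hx
      rw [eventually_nhdsWithin_iff]
      filter_upwards [Metric.ball_mem_nhds x (hr x hx)] with y hy hyΓ
      exact (loc x hx y hyΓ (by rwa [← dist_eq_norm])).symm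
    · intro a b c _ _ _ h1 h2
      exact h1.trans h2
    · intro a b _ _ h; exact h.symm
  refine ⟨τ h1, fun h0 hh0 => ⟨r h0, hr h0 hh0, ?_⟩⟩
  rw [← const h0 hh0]; exact hτ h0 hh0

theorem dif_homog (F : (ι → ℝ) → ℝ) (n : ℕ) (hF : ∀ h, F ((2 : ℝ) • h) = 2 ^ n * F h) (p : List (ι × ℝ)) (h : ι → ℝ) :
    dif (sg (p.map fun q => (q.1, 2 * q.2))) F ((2 : ℝ) • h) = 2 ^ n * dif (sg p) F h := by
  induction p generalizing h with
  | nil => exact hF h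
  | cons q p ih =>
    rw [List.map_cons, sg_cons, dif_cons', sg_cons, dif_cons', mul_sub, ← ih, ← ih, smul_add]
    congr 3
    rw [← Pi.single_smul]; rfl

theorem Der.homog {Γ : Set (ι → ℝ)} {F : (ι → ℝ) → ℝ} {L : List ι} {τ : ℝ} (hne : Γ.Nonempty)
    (hsm : ∀ h ∈ Γ, (2 : ℝ) • h ∈ Γ) (hF : ∀ h, F ((2 : ℝ) • h) = 2 ^ n * F h) (hL : L.length < n)
    (H : Der Γ F L τ) : τ = 0 := by
  obtain ⟨h, hh⟩ := hne
  obtain ⟨r1, hr1, H1⟩ := H h hh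
  obtain ⟨r2, hr2, H2⟩ := H _ (hsm h hh)
  set c := min r1 r2 / 4 with hc
  have hc0 : 0 < c := by have := lt_min hr1 hr2; positivity
  have e1 := H1 h (by simpa) _ (cst_fst L c) (cst_Sm L _ _ (by
      rw [abs_of_pos hc0]; linarith [min_le_left r1 r2]))
  have e2 := H2 ((2 : ℝ) • h) (by simpa) _ (cst_fst L (2 * c)) (cst_Sm L _ _ (by
      rw [abs_of_pos (by positivity)]; linarith [min_le_right r1 r2]))
  have e3 := dif_homog F n hF (cst L c) h
  have e4 : (cst L c).map (fun q => (q.1, 2 * q.2)) = cst L (2 * c) := by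
    simp [cst, Function.comp_def]
  rw [e4, e1, e2, cst_snd, cst_snd, mul_pow] at e3
  have h5 : (2 : ℝ) ^ L.length < 2 ^ n := pow_lt_pow_right₀ one_lt_two hL
  have h6 : τ * c ^ L.length * (2 ^ n - 2 ^ L.length) = 0 := by linarith
  rcases mul_eq_zero.mp h6 with h7 | h7
  · rcases mul_eq_zero.mp h7 with h8 | h8
    · exact h8
    · exact absurd h8 (by positivity)
  · linarith

theorem LV_of_Der {Γ : Set (ι → ℝ)} {F : (ι → ℝ) → ℝ} {L : List ι} 
    (H : Der Γ F L 0) : LV Γ F L := by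
  intro h0 hh0
  obtain ⟨r, hr, H⟩ := H h0 hh0
  refine ⟨r, hr, fun h hh p hp hs => ?_⟩
  -- reorder
  have : ∃ p' : List (ι × ℝ), p.Perm p' ∧ p'.map Prod.fst = L := by
    clear H hs
    clear * - hp
    induction L generalizing p with
    | nil => exact ⟨p, List.Perm.refl _, by simpa using hp.length_eq⟩
    | cons i L ih =>
      obtain ⟨s, p', h1, h2⟩ := split_perm hp
      obtain ⟨p'', h3, h4⟩ := ih p' h2
      exact ⟨(i, s) :: p'', h1.trans (h3.cons _), by simp [h4]⟩
  obtain ⟨p', h1, h2⟩ := this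
  rw [dif_perm (sg_perm h1), H h hh p' h2 (hs.perm h1), zero_mul]

theorem descend {Γ : Set (ι → ℝ)} {F : (ι → ℝ) → ℝ} (hne : Γ.Nonempty)
    (hconv : Convex ℝ Γ) (hsm : ∀ h ∈ Γ, (2 : ℝ) • h ∈ Γ) (hF : ∀ h, F ((2 : ℝ) • h) = 2 ^ n * F h)
    (hB : LB Γ F) (k : ℕ) (hk : k ≤ n) (H : ∀ L : List ι, L.length = k → LV Γ F L) (h : ι → ℝ) (hh : h ∈ Γ) : F h = 0 := by
  induction k with
  | zero =>
    obtain ⟨r, hr, H⟩ := H [] rfl h hh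
    exact H h (by simpa) [] (by simp) (by intro q hq; simp at hq)
  | succ k ih =>
    apply ih (by omega)
    intro L hL
    obtain ⟨τ, hτ⟩ := Der_exists hne hconv hB (L := L) (fun i => H _ (by simp [hL]))
    have := hτ.homog hne hsm hF (by omega)
    rw [this] at hτ
    exact LV_of_Der hτ

end
end AFS
end PartL

section PartM
namespace AFS

open MeasureTheory Set MvPolynomial
open scoped ENNReal Pointwise

section
variable {ι : Type} [Fintype ι] [DecidableEq ι] {n : ℕ}

theorem mon_eq (s : Multiset ι) : mon s = monomial (Multiset.toFinsupp s) (1 : ℝ) := by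
  induction s using Multiset.induction_on with
  | empty => simp [mon]
  | cons a s ih =>
    rw [mon_cons, ih, ← Multiset.singleton_add, map_add, Multiset.toFinsupp_singleton, X, monomial_mul, one_mul]

theorem mon_ind (P : MvPolynomial ι ℝ → Prop) (hadd : ∀ p q, P p → P q → P (p + q))
    (hs : ∀ (c : ℝ) p, P p → P (c • p)) (hm : ∀ s, P (mon s)) (p : MvPolynomial ι ℝ) : P p := by
  induction p using MvPolynomial.induction_on' with
  | monomial μ c =>
    have := hs c _ (hm (Finsupp.toMultiset μ))
    rwa [mon_eq, Finsupp.toMultiset_toFinsupp, smul_monomial, smul_eq_mul, mul_one] at this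
  | add p q hp hq => exact hadd p q hp hq

noncomputable def mkΦ (n : ℕ) (τ : List ι → ℝ) : MvPolynomial ι ℝ →ₗ[ℝ] ℝ :=
  (basisMonomials ι ℝ).constr ℝ (fun μ => if (Finsupp.toMultiset μ).card = n then τ (Finsupp.toMultiset μ).toList else 0)

theorem mkΦ_mon (n : ℕ) (τ : List ι → ℝ) (s : Multiset ι) :
    mkΦ n τ (mon s) = if s.card = n then τ s.toList else 0 := by
  have := (basisMonomials ι ℝ).constr_basis ℝ (fun μ => if (Finsupp.toMultiset μ).card = n then τ (Finsupp.toMultiset μ).toList else 0) (Multiset.toFinsupp s)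
  rw [coe_basisMonomials] at this
  rw [mon_eq, mkΦ, this, Multiset.toFinsupp_toMultiset]

variable (Φ : MvPolynomial ι ℝ →ₗ[ℝ] ℝ)

theorem pow_diff (q : MvPolynomial ι ℝ) (m : ℕ) (h v : ι → ℝ) :
    Φ (q * ell (h + v) ^ m) - Φ (q * ell h ^ m) =
      ∑ i ∈ Finset.range m, (m.choose i : ℝ) * Φ (q * ell v ^ (m - i) * ell h ^ i) := by
  rw [map_add, add_pow, Finset.sum_range_succ, mul_add, map_add, Finset.mul_sum, map_sum]
  simp only [Nat.sub_self, pow_zero, mul_one, Nat.choose_self, Nat.cast_one]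
  rw [add_sub_cancel_right]
  refine Finset.sum_congr rfl fun i _ => ?_
  rw [← smul_eq_mul (m.choose i : ℝ), ← map_smul, smul_eq_C_mul]
  congr 1
  simp only [map_natCast]
  ring

theorem difpoly_lt (vs : List (ι → ℝ)) : ∀ (q : MvPolynomial ι ℝ) (m : ℕ), m < vs.length → ∀ h,
    dif vs (fun h => Φ (q * ell h ^ m)) h = 0 := by
  induction vs with
  | nil => intro q m hm; simp at hm
  | cons v vs ih =>
    intro q m hm h
    rw [dif_cons]
    simp only [pow_diff]
    rw [dif_sum]
    refine Finset.sum_eq_zero fun i hi => ?_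
    rw [dif_smul, ih, mul_zero]
    rw [Finset.mem_range] at hi; rw [List.length_cons] at hm; omega

theorem difpoly (vs : List (ι → ℝ)) : ∀ (q : MvPolynomial ι ℝ), ∀ h,
    dif vs (fun h => Φ (q * ell h ^ vs.length)) h = (vs.length.factorial : ℝ) * Φ (q * (vs.map ell).prod) := by
  induction vs with
  | nil => intro q h; simp [dif_nil]
  | cons v vs ih =>
    intro q h
    rw [dif_cons]
    simp only [pow_diff]
    rw [dif_sum, List.length_cons, Finset.sum_range_succ, Finset.sum_eq_zero, zero_add, dif_smul]
    · simp only [Nat.add_sub_cancel_left, pow_one]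
      rw [ih, Nat.choose_succ_self_right, List.map_cons, List.prod_cons, Nat.factorial_succ, mul_assoc q]
      push_cast; ring
    · intro i hi
      rw [dif_smul, difpoly_lt, mul_zero]
      simpa using hi

theorem difpoly_lim (vs : List (ι → ℝ)) : ∀ (q : MvPolynomial ι ℝ) (m : ℕ), ∀ h,
    Filter.Tendsto (fun t : ℝ => (t ^ vs.length)⁻¹ * dif (vs.map fun v => t • v) (fun h => Φ (q * ell h ^ m)) h)
      (nhdsWithin 0 (Ioi 0)) (nhds ((m.descFactorial vs.length : ℝ) * Φ (q * (vs.map ell).prod * ell h ^ (m - vs.length)))) := by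
  induction vs with
  | nil => intro q m h; simp [dif_nil]
  | cons v vs ih =>
    intro q m h
    simp only [List.map_cons, dif_cons, pow_diff, dif_sum, dif_smul, List.length_cons, List.prod_cons]
    have e : ∀ t : ℝ, 0 < t → (t ^ (vs.length + 1))⁻¹ * ∑ i ∈ Finset.range m, (m.choose i : ℝ) * 
        dif (vs.map fun v => t • v) (fun h => Φ (q * ell (t • v) ^ (m - i) * ell h ^ i)) h =
        ∑ i ∈ Finset.range m, t ^ (m - i - 1) * ((m.choose i : ℝ) * ((t ^ vs.length)⁻¹ * 
        dif (vs.map fun v => t • v) (fun h => Φ (q * ell v ^ (m - i) * ell h ^ i)) h)) := by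
      intro t ht
      rw [Finset.mul_sum]
      refine Finset.sum_congr rfl fun i hi => ?_
      rw [Finset.mem_range] at hi
      obtain ⟨j, hj⟩ : ∃ j, m - i = j + 1 := ⟨m - i - 1, by omega⟩
      have e2 : (fun h => Φ (q * ell (t • v) ^ (m - i) * ell h ^ i)) = 
          fun h => t ^ (m - i) * Φ (q * ell v ^ (m - i) * ell h ^ i) := by
        funext h
        rw [map_smul, smul_pow, ← smul_eq_mul (t ^ _), ← map_smul]
        congr 1
        simp only [mul_smul_comm, smul_mul_assoc]
      rw [e2, dif_smul, hj, Nat.add_sub_cancel]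
      field_simp
      ring
    have lim : Filter.Tendsto (fun t : ℝ => ∑ i ∈ Finset.range m, t ^ (m - i - 1) * ((m.choose i : ℝ) * ((t ^ vs.length)⁻¹ * 
        dif (vs.map fun v => t • v) (fun h => Φ (q * ell v ^ (m - i) * ell h ^ i)) h)))
        (nhdsWithin 0 (Ioi 0)) (nhds (∑ i ∈ Finset.range m, (0 : ℝ) ^ (m - i - 1) * ((m.choose i : ℝ) * 
        ((i.descFactorial vs.length : ℝ) * Φ (q * ell v ^ (m - i) * (vs.map ell).prod * ell h ^ (i - vs.length)))))) := by
      refine tendsto_finsetSum _ fun i _ => Filter.Tendsto.mul ?_ ((ih _ _ _).const_mul _)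
      exact ((continuous_pow _).tendsto 0).mono_left nhdsWithin_le_nhds
    have e3 : ∑ i ∈ Finset.range m, (0 : ℝ) ^ (m - i - 1) * ((m.choose i : ℝ) * 
        ((i.descFactorial vs.length : ℝ) * Φ (q * ell v ^ (m - i) * (vs.map ell).prod * ell h ^ (i - vs.length)))) =
        (m.descFactorial (vs.length + 1) : ℝ) * Φ (q * (ell v * (vs.map ell).prod) * ell h ^ (m - (vs.length + 1))) := by
      cases m with
      | zero => simp
      | succ m =>
        rw [Finset.sum_range_succ, Finset.sum_eq_zero, zero_add]
        · simp only [Nat.add_sub_cancel_left, pow_one, Nat.sub_self, pow_zero, one_mul, Nat.choose_succ_self_right,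
            Nat.add_sub_add_right, Nat.succ_descFactorial_succ]
          rw [mul_assoc q (ell v)]; push_cast; ring
        · intro i hi
          rw [Finset.mem_range] at hi
          rw [zero_pow (by omega), zero_mul]
    rw [e3] at lim
    refine lim.congr' ?_
    filter_upwards [self_mem_nhdsWithin] with t ht
    exact (e t ht).symm

theorem ell_cont (q : MvPolynomial ι ℝ) (m : ℕ) : Continuous fun h => Φ (q * ell h ^ m) := by
  induction m generalizing q with
  | zero => simp only [pow_zero]; exact continuous_const
  | succ m ih =>
    have : (fun h => Φ (q * ell h ^ (m + 1))) = fun h => ∑ i, h i * Φ (q * X i * ell h ^ m) := by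
      funext h
      rw [pow_succ']
      nth_rw 1 [ell]
      rw [Fintype.linearCombination_apply, Finset.sum_mul, Finset.mul_sum, map_sum]
      refine Finset.sum_congr rfl fun i _ => ?_
      rw [← smul_eq_mul (h i), ← map_smul]
      congr 1
      simp only [mul_smul_comm, smul_mul_assoc, mul_assoc]
    rw [this]
    exact continuous_finsetSum _ fun i _ => (continuous_apply i).mul (ih _)

theorem sg_ell (p : List (ι × ℝ)) : ((sg p).map ell).prod = (p.map Prod.snd).prod • mon (↑(p.map Prod.fst) : Multiset ι) := by
  induction p with
  | nil => simp [sg, mon]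
  | cons q p ih =>
    rw [sg_cons, List.map_cons, List.prod_cons, ih, ell_single, List.map_cons, List.prod_cons, List.map_cons, ← Multiset.cons_coe, mon_cons,
      smul_mul_smul_comm]

theorem Geo.convex {u : ι → EE' n} {Γ : Set (ι → ℝ)} {Fc : Finset ι → Prop} (G : Geo u Γ Fc) : Convex ℝ Γ := by
  intro x hx y hy a b ha hb hab
  rcases ha.eq_or_lt with h | h
  · have : b = 1 := by linarith
    rw [← h, this]; simpa
  rcases hb.eq_or_lt with h' | h'
  · have : a = 1 := by linarith
    rw [← h', this]; simpa
  exact G.add _ (G.smul _ hx _ h) _ (G.smul _ hy _ h')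

theorem LB_gv {u : ι → EE' n} {Γ : Set (ι → ℝ)} {Fc : Finset ι → Prop} (G : Geo u Γ Fc) : LB Γ (gv u) := by
  intro h0 _
  refine ⟨1, one_pos, gv u (fun i => h0 i + 1), fun h hh => ?_⟩
  have hg : 0 ≤ gv u h := measureReal_nonneg
  rw [abs_of_nonneg hg]
  apply gv_mono u G.bdd
  intro i
  have := lt_of_le_of_lt (norm_le_pi_norm (h - h0) i) hh
  rw [Pi.sub_apply, Real.norm_eq_abs, abs_lt] at this
  show h i ≤ h0 i + 1
  linarith

theorem Der.unique {Γ : Set (ι → ℝ)} {F : (ι → ℝ) → ℝ} {L : List ι} {τ τ' : ℝ} (hne : Γ.Nonempty)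
    (H : Der Γ F L τ) (H' : ∀ h0 ∈ Γ, ∃ r > 0, ∀ c, 0 < c → c < r → dif (sg (cst L c)) F h0 = τ' * c ^ L.length) : τ = τ' := by
  obtain ⟨h, hh⟩ := hne
  obtain ⟨r1, hr1, H1⟩ := H h hh
  obtain ⟨r2, hr2, H2⟩ := H' h hh
  set c := min r1 r2 / 2 with hc
  have hc0 : 0 < c := by have := lt_min hr1 hr2; positivity
  have e1 := H1 h (by simpa) _ (cst_fst L c) (cst_Sm L _ _ (by
      rw [abs_of_pos hc0]; linarith [min_le_left r1 r2]))
  have e2 := H2 c hc0 (by linarith [min_le_right r1 r2])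
  rw [e1, cst_snd] at e2
  exact mul_right_cancel₀ (by positivity) e2

/-- The volume polynomial. -/
theorem structure_thm {u : ι → EE' n} {Γ : Set (ι → ℝ)} {Fc : Finset ι → Prop} (G : Geo u Γ Fc) :
    ∃ Φ : MvPolynomial ι ℝ →ₗ[ℝ] ℝ, (∀ h ∈ Γ, gv u h = (n.factorial : ℝ)⁻¹ * Φ (ell h ^ n)) ∧
      (∀ s : Multiset ι, s.card ≠ n → Φ (mon s) = 0) ∧
      (∀ s : Multiset ι, ¬ Fc s.toFinset → Φ (mon s) = 0) := by
  have hex : ∀ L : List ι, L.length = n → ∃ τ, Der Γ (gv u) L τ := fun L hL =>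
    Der_exists G.nonempty G.convex (LB_gv G) fun i => LV_main G _ _ (by simp [hL]) le_rfl
  choose! τ hτ using hex
  have hperm : ∀ L L' : List ι, L.length = n → L.Perm L' → τ L = τ L' := by
    intro L L' hL hp
    refine (hτ L hL).unique G.nonempty fun h0 hh0 => ?_
    obtain ⟨r, hr, H⟩ := hτ L' (hp.length_eq ▸ hL) h0 hh0
    refine ⟨r, hr, fun c hc hcr => ?_⟩
    rw [dif_perm (sg_perm (hp.map fun i => (i, c)) : (sg (cst L c)).Perm (sg (cst L' c))), H h0 (by simpa) _ (cst_fst L' c)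
      (cst_Sm L' _ _ (by rwa [abs_of_pos hc])), cst_snd, hp.length_eq]
  refine ⟨mkΦ n τ, ?_, fun s hs => by rw [mkΦ_mon, if_neg hs], fun s hs => ?_⟩
  · have hD : ∀ L : List ι, L.length = n → ∀ p : List (ι × ℝ), p.map Prod.fst = L → ∀ h,
        dif (sg p) (fun h => (n.factorial : ℝ)⁻¹ * mkΦ n τ (1 * ell h ^ n)) h = τ L * (p.map Prod.snd).prod := by
      intro L hL p hp h
      have hlen : (sg p).length = n := by rw [← hL, ← hp]; simp [sg]
      have := difpoly (mkΦ n τ) (sg p) 1 h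
      rw [hlen] at this
      rw [dif_smul, this, sg_ell, one_mul, map_smul, mkΦ_mon, hp, if_pos (by simpa using hL), smul_eq_mul,
        hperm _ L (by simpa using hL) (Multiset.coe_eq_coe.mp (Multiset.coe_toList _))]
      have : (n.factorial : ℝ) ≠ 0 := by positivity
      field_simp
    have hz := descend (n := n) (F := fun h => gv u h - (n.factorial : ℝ)⁻¹ * mkΦ n τ (1 * ell h ^ n)) G.nonempty G.convex
      (fun h hh => G.smul h hh 2 two_pos) (fun h => by
        rw [gv_smul u h 2 two_pos, map_smul, smul_pow, mul_smul_comm, map_smul, smul_eq_mul]; ring) (by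
        intro h0 hh0
        obtain ⟨r, hr, C, HC⟩ := LB_gv G h0 hh0
        have hc : Continuous fun h => (n.factorial : ℝ)⁻¹ * mkΦ n τ (1 * ell h ^ n) := (ell_cont _ _ _).const_mul _
        obtain ⟨δ, hδ, Hδ⟩ := Metric.continuous_iff.mp hc h0 1 one_pos
        refine ⟨min r δ, lt_min hr hδ, C + (|(n.factorial : ℝ)⁻¹ * mkΦ n τ (1 * ell h0 ^ n)| + 1), fun h hh => ?_⟩
        have h1 := HC h (lt_of_lt_of_le hh (min_le_left _ _))
        have h2 := Hδ h (by rw [dist_eq_norm]; exact lt_of_lt_of_le hh (min_le_right _ _))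
        rw [Real.dist_eq] at h2
        have h3 := abs_sub_abs_le_abs_sub ((n.factorial : ℝ)⁻¹ * mkΦ n τ (1 * ell h ^ n)) ((n.factorial : ℝ)⁻¹ * mkΦ n τ (1 * ell h0 ^ n))
        refine (abs_sub _ _).trans ?_
        linarith) n le_rfl (by
        intro L hL
        apply LV_of_Der
        intro h0 hh0
        obtain ⟨r, hr, H⟩ := hτ L hL h0 hh0
        refine ⟨r, hr, fun h hh p hp hs => ?_⟩
        rw [dif_sub, H h hh p hp hs, hD L hL p hp]; ring)
    intro h hh
    have := hz h hh
    rw [one_mul] at this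
    linarith
  · rw [mkΦ_mon]
    split_ifs with hc
    · refine (hτ _ (by simpa using hc)).unique G.nonempty fun h0 hh0 => ?_
      have hnf : ¬ Fc (s.toList.toFinset) := by
        have : s.toList.toFinset = s.toFinset := by ext; simp
        rwa [this]
      obtain ⟨l, hl⟩ := (List.dedup_sublist s.toList).exists_perm_append
      have hLV : LV Γ (gv u) s.toList := by
        refine LV.perm (LV.append (LV_nonface G s.toList.dedup (List.nodup_dedup _) ?_) l) ?_
        · have e : s.toList.dedup.toFinset = s.toList.toFinset := by ext; simp
          rwa [e]
        · exact (List.perm_append_comm).trans hl.symm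
      obtain ⟨r, hr, H⟩ := hLV h0 hh0
      refine ⟨r, hr, fun c hc hcr => ?_⟩
      rw [H h0 (by simpa) _ (by rw [cst_fst]) (cst_Sm _ _ _ (by rwa [abs_of_pos hc])), zero_mul]
    · rfl

end
end AFS
end PartM

section PartN
namespace AFS

open MeasureTheory Set MvPolynomial
open scoped ENNReal Pointwise

section
variable {ι : Type} [Fintype ι] [DecidableEq ι] {n : ℕ}

theorem norm_sum_sublist (L L' : List (ι → ℝ)) (h : L'.Sublist L) : ‖L'.sum‖ ≤ (L.map norm).sum := by
  have h1 : ‖L'.sum‖ ≤ (L'.map norm).sum := by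
    clear h
    induction L' with
    | nil => simp
    | cons a l ih =>
      rw [List.sum_cons, List.map_cons, List.sum_cons]
      exact (norm_add_le _ _).trans (by linarith)
  refine h1.trans (List.Sublist.sum_le_sum (h.map _) fun a ha => ?_)
  obtain ⟨b, -, rfl⟩ := List.mem_map.mp ha
  exact norm_nonneg b

theorem gv_lim {u : ι → EE' n} {Γ : Set (ι → ℝ)} {Fc : Finset ι → Prop} (G : Geo u Γ Fc)
    (Φ : MvPolynomial ι ℝ →ₗ[ℝ] ℝ) (hΦ : ∀ h ∈ Γ, gv u h = (n.factorial : ℝ)⁻¹ * Φ (ell h ^ n))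
    (vs : List (ι → ℝ)) (h : ι → ℝ) (hh : h ∈ Γ) :
    Filter.Tendsto (fun t : ℝ => (t ^ vs.length)⁻¹ * dif (vs.map fun v => t • v) (gv u) h)
      (nhdsWithin 0 (Ioi 0)) (nhds ((n.factorial : ℝ)⁻¹ *
        ((n.descFactorial vs.length : ℝ) * Φ ((vs.map ell).prod * ell h ^ (n - vs.length))))) := by
  have h1 := (difpoly_lim Φ vs 1 n h).const_mul (n.factorial : ℝ)⁻¹
  rw [one_mul] at h1
  refine h1.congr' ?_
  obtain ⟨r, hr, H⟩ := ball_sub G.isOpen hh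
  set C := (vs.map norm).sum with hC
  have hC0 : 0 ≤ C := by
    apply List.sum_nonneg
    intro a ha
    obtain ⟨b, -, rfl⟩ := List.mem_map.mp ha
    exact norm_nonneg b
  have : ∀ᶠ t : ℝ in nhdsWithin 0 (Ioi 0), t < r / (C + 1) :=
    mem_nhdsWithin_of_mem_nhds (Iio_mem_nhds (by positivity))
  filter_upwards [self_mem_nhdsWithin, this] with t ht ht2
  have ht : 0 < t := ht
  rw [dif_congr (gv u) (fun h => (n.factorial : ℝ)⁻¹ * Φ (ell h ^ n)) _ Γ hΦ h, dif_smul]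
  · simp only [one_mul]; ring
  · intro L' hL'
    apply H
    rw [add_sub_cancel_left]
    refine lt_of_le_of_lt (norm_sum_sublist _ _ hL') ?_
    have e : (List.map norm (List.map (fun v => t • v) vs)).sum = t * C := by
      rw [hC, List.map_map, ← List.sum_map_mul_left]
      congr 1
      refine List.map_congr_left fun v _ => ?_
      simp [norm_smul, abs_of_pos ht]
    rw [e]
    rw [lt_div_iff₀ (by positivity)] at ht2
    linarith

structure Alg (u : ι → EE' n) (Γ : Set (ι → ℝ)) (Fc : Finset ι → Prop) (Φ : MvPolynomial ι ℝ →ₗ[ℝ] ℝ) : Prop where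
  deg : ∀ s : Multiset ι, s.card ≠ n → Φ (mon s) = 0
  transl : ∀ z q, Φ (ell (Uz u z) * q) = 0
  nonf : ∀ I : Finset ι, ¬ Fc I → ∀ q, Φ (mon I.val * q) = 0
  nn : ∀ I : Finset ι, I.card = n → 0 ≤ Φ (mon I.val)
  lc : ∀ (I : Finset ι) (d : ℕ), I.card + d = n → ∀ h ∈ Γ, ∀ h' ∈ Γ,
    Φ (mon I.val * ell h ^ d) * Φ (mon I.val * ell h' ^ d) ≤ Φ (mon I.val * ell ((1 / 2 : ℝ) • (h + h')) ^ d) ^ 2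

theorem Geo.mono {u : ι → EE' n} {Γ : Set (ι → ℝ)} {Fc : Finset ι → Prop} (G : Geo u Γ Fc) {J J' : Finset ι}
    (h : J ⊆ J') (hJ : Fc J') : Fc J := by
  by_contra hn
  obtain ⟨h0, hh0⟩ := G.nonempty
  obtain ⟨z, h1, h2⟩ := G.face _ hJ h0 hh0
  obtain ⟨j, hj, hlt⟩ := G.nonface _ hn h0 hh0 z (fun i => by
    by_cases hi : i ∈ J'
    · exact (h1 i hi).le
    · exact (h2 i hi).le)
  have := h1 j (h hj)
  linarith

theorem list_ell_single (L : List ι) : ((L.map fun j => (Pi.single j 1 : ι → ℝ)).map ell).prod = mon (L : Multiset ι) := by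
  induction L with
  | nil => simp [mon]
  | cons a L ih => 
    rw [List.map_cons, List.map_cons, List.prod_cons, ih, ell_single, one_smul, ← Multiset.cons_coe, mon_cons]

theorem Geo.alg {u : ι → EE' n} {Γ : Set (ι → ℝ)} {Fc : Finset ι → Prop} (G : Geo u Γ Fc) :
    ∃ Φ : MvPolynomial ι ℝ →ₗ[ℝ] ℝ, (∀ h ∈ Γ, gv u h = (n.factorial : ℝ)⁻¹ * Φ (ell h ^ n)) ∧ Alg u Γ Fc Φ := by
  obtain ⟨Φ, hΦ, hdeg, hnf⟩ := structure_thm G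
  have hfac : (0 : ℝ) < n.factorial := by positivity
  -- limit for slabs
  have slab : ∀ (I : Finset ι) (d : ℕ), I.card + d = n → ∀ h ∈ Γ,
      Filter.Tendsto (fun t : ℝ => (t ^ I.card)⁻¹ * volume.real (Slab u I.toList (fun _ => t) h))
      (nhdsWithin 0 (Ioi 0)) (nhds ((n.factorial : ℝ)⁻¹ *
        ((n.descFactorial I.card : ℝ) * Φ (mon I.val * ell h ^ d)))) := by
    intro I d hd h hh
    have h1 := gv_lim G Φ hΦ (I.toList.map fun j => (Pi.single j 1 : ι → ℝ)) h hh
    have e1 : (↑(I.toList) : Multiset ι) = I.val := Multiset.coe_toList _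
    rw [list_ell_single, e1, List.length_map, Finset.length_toList, show n - I.card = d by omega] at h1
    refine h1.congr' ?_
    filter_upwards [self_mem_nhdsWithin] with t ht
    rw [← slab_vol u G.bdd _ (Finset.nodup_toList I) _ (fun j => le_of_lt ht)]
    congr 2
    rw [List.map_map]
    refine List.map_congr_left fun j _ => ?_
    simp [← Pi.single_smul]
  refine ⟨Φ, hΦ, hdeg, ?_, ?_, ?_, ?_⟩
  · intro z q
    induction q using mon_ind with
    | hadd p q hp hq => rw [mul_add, map_add, hp, hq, add_zero]
    | hs c p hp => rw [mul_smul_comm, map_smul, hp, smul_zero]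
    | hm s =>
      by_cases hs : s.card + 1 = n
      · obtain ⟨h, hh⟩ := G.nonempty
        have h1 := gv_lim G Φ hΦ (Uz u z :: (s.toList.map fun j => (Pi.single j 1 : ι → ℝ))) h hh
        rw [List.map_cons, List.prod_cons, list_ell_single, Multiset.coe_toList, List.length_cons, List.length_map, 
          Multiset.length_toList, hs, Nat.sub_self, pow_zero, mul_one] at h1
        have h2 : ∀ t : ℝ, (t ^ n)⁻¹ * dif (List.map (fun v => t • v) (Uz u z :: List.map (fun j => Pi.single j 1) s.toList)) (gv u) h = 0 := by
          intro t
          have e : t • Uz u z = Uz u (t • z) := by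
            funext i; simp [Uz, inner_smul_right]
          rw [List.map_cons, dif_cons', e, dif_transl, sub_self, mul_zero]
        simp only [h2] at h1
        have h3 := tendsto_nhds_unique tendsto_const_nhds h1
        rw [Nat.descFactorial_self, inv_mul_cancel_left₀ hfac.ne'] at h3
        exact h3.symm
      · have : ell (Uz u z) * mon s = ∑ i, Uz u z i • mon (i ::ₘ s) := by
          nth_rw 1 [ell]
          rw [Fintype.linearCombination_apply, Finset.sum_mul]
          refine Finset.sum_congr rfl fun i _ => ?_
          rw [smul_mul_assoc, mon_cons]
        rw [this, map_sum]
        refine Finset.sum_eq_zero fun i _ => ?_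
        rw [map_smul, hdeg _ (by rw [Multiset.card_cons]; exact hs), smul_zero]
  · intro I hI q
    induction q using mon_ind with
    | hadd p q hp hq => rw [mul_add, map_add, hp, hq, add_zero]
    | hs c p hp => rw [mul_smul_comm, map_smul, hp, smul_zero]
    | hm s =>
      rw [← mon_add]
      apply hnf
      intro hF
      apply hI
      refine G.mono ?_ hF
      intro i hi
      simp [hi]
  · intro I hI
    obtain ⟨h, hh⟩ := G.nonempty
    have h1 := slab I 0 (by omega) h hh
    rw [pow_zero, mul_one, hI, Nat.descFactorial_self, inv_mul_cancel_left₀ hfac.ne'] at h1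
    refine ge_of_tendsto h1 ?_
    filter_upwards [self_mem_nhdsWithin] with t ht
    have ht : 0 < t := ht
    positivity
  · intro I d hd h hh h' hh'
    have h1 := slab I d hd h hh
    have h2 := slab I d hd h' hh'
    have h3 := slab I d hd ((1 / 2 : ℝ) • (h + h')) (G.smul _ (G.add _ hh _ hh') _ (by norm_num))
    have h4 := le_of_tendsto_of_tendsto (h1.mul h2) (h3.pow 2) (by
      filter_upwards [self_mem_nhdsWithin] with t ht
      have ht : 0 < t := ht
      have := slab_bm u G.bdd I.toList (fun _ => t) h h'
      have h5 : 0 ≤ ((t ^ I.card)⁻¹) ^ 2 := by positivity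
      have h6 := mul_le_mul_of_nonneg_left this h5
      rw [mul_pow]
      refine le_trans (le_of_eq ?_) h6
      ring)
    set c : ℝ := (n.factorial : ℝ)⁻¹ * (n.descFactorial I.card : ℝ) with hc
    have hc0 : 0 < c := by
      have : 0 < n.descFactorial I.card := Nat.pos_of_ne_zero (by
        rw [Ne, Nat.descFactorial_eq_zero_iff_lt]; omega)
      positivity
    simp only [← mul_assoc] at h4
    rw [← hc, mul_pow] at h4
    have h5 : c ^ 2 * (Φ (mon I.val * ell h ^ d) * Φ (mon I.val * ell h' ^ d)) ≤
        c ^ 2 * Φ (mon I.val * ell ((1 / 2 : ℝ) • (h + h')) ^ d) ^ 2 := by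
      refine le_trans (le_of_eq ?_) h4
      ring
    exact le_of_mul_le_mul_left h5 (by positivity)

end
end AFS
end PartN

section PartO
namespace AFS

section matrix
open Matrix
variable {κ : Type} [Fintype κ] [DecidableEq κ]

theorem mat_norm (A : Matrix κ κ ℝ) (hA : A.IsHermitian) (s : κ → ℝ) (hs0 : s ≠ 0) (hs : A *ᵥ s = s)
    (h1 : ∀ x, x ⬝ᵥ (A *ᵥ x) ≤ (A *ᵥ x) ⬝ᵥ (A *ᵥ x))
    (h3 : ∀ x, x ≠ 0 → s ⬝ᵥ x = 0 → x ⬝ᵥ (A *ᵥ x) < x ⬝ᵥ x) (x : κ → ℝ) (hx : s ⬝ᵥ x = 0) :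
    x ⬝ᵥ (A *ᵥ x) ≤ 0 := by
  have hss : s ⬝ᵥ s ≠ 0 := fun h => hs0 (dotProduct_self_eq_zero.mp h)
  set B : Matrix κ κ ℝ := -(A - (s ⬝ᵥ s)⁻¹ • vecMulVec s s) with hBdef
  have hAt : Aᵀ = A := by simpa [IsHermitian] using hA
  have hB : B.IsHermitian := by
    show Bᴴ = B
    rw [conjTranspose_eq_transpose_of_trivial, hBdef, transpose_neg, transpose_sub, hAt, transpose_smul]
    congr 3
    ext i j; simp [vecMulVec_apply, mul_comm]
  have Bv : ∀ v, B *ᵥ v = -(A *ᵥ v) + ((s ⬝ᵥ s)⁻¹ * (s ⬝ᵥ v)) • s := by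
    intro v
    rw [hBdef, neg_mulVec, sub_mulVec, smul_mulVec, vecMulVec_mulVec, neg_sub, sub_eq_neg_add, op_smul_eq_smul, smul_smul]
  have hpsd : B.PosSemidef := by
    rw [hB.posSemidef_iff_eigenvalues_nonneg]
    intro i
    by_contra hneg
    push Not at hneg
    set μ := hB.eigenvalues i with hμ
    set v := (hB.eigenvectorBasis i).ofLp with hv
    have hev : B *ᵥ v = μ • v := hB.mulVec_eigenvectorBasis i
    have hneg : μ < 0 := hneg
    have hv0 : v ≠ 0 := by
      intro h0
      have h2 := hB.eigenvectorBasis.orthonormal.ne_zero i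
      apply h2
      ext j
      exact congrFun h0 j
    have hvv : 0 < v ⬝ᵥ v := lt_of_le_of_ne (by rw [dotProduct]; exact Finset.sum_nonneg fun i _ => mul_self_nonneg _)
      (fun h => hv0 (dotProduct_self_eq_zero.mp h.symm))
    have hsA : s ⬝ᵥ (A *ᵥ v) = s ⬝ᵥ v := by
      rw [dotProduct_mulVec, ← hAt, vecMul_transpose, hs]
    have hsv : s ⬝ᵥ v = 0 := by
      have h2 : s ⬝ᵥ (B *ᵥ v) = 0 := by
        rw [Bv, dotProduct_add, dotProduct_neg, hsA, dotProduct_smul, smul_eq_mul]; field_simp; ring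
      rw [hev, dotProduct_smul, smul_eq_mul] at h2
      exact (mul_eq_zero.mp h2).resolve_left hneg.ne
    have hAv : A *ᵥ v = (-μ) • v := by
      have := Bv v
      rw [hev, hsv, mul_zero, zero_smul, add_zero] at this
      rw [neg_smul, this, neg_neg]
    have e1 := h1 v
    have e2 := h3 v hv0 hsv
    rw [hAv, dotProduct_smul, smul_eq_mul] at e2
    rw [hAv, dotProduct_smul, smul_dotProduct, dotProduct_smul, smul_eq_mul, smul_eq_mul] at e1
    nlinarith [mul_pos (neg_pos.mpr hneg) hvv]
  have := hpsd.dotProduct_mulVec_nonneg x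
  rw [star_trivial, Bv, hx, mul_zero, zero_smul, add_zero, dotProduct_neg] at this
  linarith

theorem mat_lemma (M : κ → κ → ℝ) (hM : ∀ i j, M i j = M j i) (hoff : ∀ i j, i ≠ j → 0 ≤ M i j)
    (y p : κ → ℝ) (hy : ∀ i, 0 < y i) (hp : ∀ i, 0 < p i) (hpy : ∀ i, p i = ∑ j, M i j * y j)
    (hB : ∀ x : κ → ℝ, ∑ i, x i * ∑ j, M i j * x j ≤ ∑ k, y k * (∑ j, M k j * x j) ^ 2 / p k)
    (conn : ∀ c : κ → ℝ, (∀ i j, i ≠ j → M i j ≠ 0 → c i = c j) → ∀ i j, c i = c j)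
    (x : κ → ℝ) (hx : ∑ i, p i * x i = 0) : ∑ i, x i * ∑ j, M i j * x j ≤ 0 := by
  rcases isEmpty_or_nonempty κ with hκ | ⟨⟨i0⟩⟩
  · simp
  set r : κ → ℝ := fun i => Real.sqrt (y i / p i) with hr
  have hr0 : ∀ i, 0 < r i := fun i => Real.sqrt_pos.mpr (div_pos (hy i) (hp i))
  have hr2 : ∀ i, r i * r i = y i / p i := fun i => Real.mul_self_sqrt (div_pos (hy i) (hp i)).le
  have hrp : ∀ i, r i * p i = y i / r i := fun i => by
    have := hr2 i
    have h1 := (hp i).ne'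
    have h2 := (hr0 i).ne'
    rw [eq_div_iff h1] at this
    rw [eq_div_iff h2]; linarith
  set A : Matrix κ κ ℝ := Matrix.of fun i j => r i * M i j * r j with hA
  have Av : ∀ ξ : κ → ℝ, A *ᵥ ξ = fun i => r i * ∑ j, M i j * (r j * ξ j) := by
    intro ξ; funext i
    rw [mulVec, dotProduct, Finset.mul_sum]
    refine Finset.sum_congr rfl fun j _ => ?_
    rw [hA, Matrix.of_apply]; ring
  have xAx : ∀ ξ : κ → ℝ, ξ ⬝ᵥ (A *ᵥ ξ) = ∑ i, (r i * ξ i) * ∑ j, M i j * (r j * ξ j) := by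
    intro ξ
    rw [Av, dotProduct]
    refine Finset.sum_congr rfl fun i _ => ?_
    ring
  have key := mat_norm A (by
    show Aᴴ = A
    rw [conjTranspose_eq_transpose_of_trivial]
    ext i j; simp only [hA, transpose_apply, of_apply]; rw [hM j i]; ring) (fun i => y i / r i) (fun h => by
      have := congrFun h i0
      have h2 : 0 < y i0 / r i0 := div_pos (hy i0) (hr0 i0)
      simp only [Pi.zero_apply] at this
      linarith) (by
      rw [Av]; funext i
      rw [← hrp, hpy]
      congr 1
      refine Finset.sum_congr rfl fun j _ => ?_
      have := (hr0 j).ne'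
      field_simp) (by
      intro ξ
      rw [xAx]
      refine (hB _).trans (le_of_eq ?_)
      rw [Av, dotProduct]
      refine Finset.sum_congr rfl fun i _ => ?_
      have := hr2 i
      calc _ = (y i / p i) * (∑ j, M i j * (r j * ξ j)) ^ 2 := by ring
        _ = _ := by rw [← this]; ring) (by
      intro ξ hξ hs
      rw [xAx]
      -- the identity
      set c : κ → ℝ := fun i => r i * ξ i / y i with hc
      have hcy : ∀ i, r i * ξ i = y i * c i := fun i => by
        have := (hy i).ne'
        simp only [hc]; field_simp
      have e1 : ξ ⬝ᵥ ξ = ∑ i, p i * y i * c i ^ 2 := by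
        rw [dotProduct]
        refine Finset.sum_congr rfl fun i _ => ?_
        have h1 := (hy i).ne'
        have h2 := (hr0 i).ne'
        have h3 := hrp i
        have h4 : ξ i = y i * c i / r i := by rw [← hcy]; field_simp
        rw [h4]
        have h5 : y i = r i * p i * r i := by rw [h3]; field_simp
        field_simp
        nth_rw 1 [h5]; ring
      have e2 : ∑ i, p i * y i * c i ^ 2 - ∑ i, (r i * ξ i) * ∑ j, M i j * (r j * ξ j) =
          (1 / 2) * ∑ i, ∑ j, M i j * y i * y j * (c i - c j) ^ 2 := by
        have a1 : ∑ i, p i * y i * c i ^ 2 = ∑ i, ∑ j, M i j * y i * y j * c i ^ 2 := by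
          refine Finset.sum_congr rfl fun i _ => ?_
          rw [hpy, Finset.sum_mul, Finset.sum_mul]
          refine Finset.sum_congr rfl fun j _ => ?_
          ring
        have a2 : ∑ i, p i * y i * c i ^ 2 = ∑ i, ∑ j, M i j * y i * y j * c j ^ 2 := by
          rw [a1, Finset.sum_comm]
          refine Finset.sum_congr rfl fun i _ => Finset.sum_congr rfl fun j _ => ?_
          rw [hM]; ring
        have a3 : ∑ i, (r i * ξ i) * ∑ j, M i j * (r j * ξ j) = ∑ i, ∑ j, M i j * y i * y j * (c i * c j) := by
          refine Finset.sum_congr rfl fun i _ => ?_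
          rw [Finset.mul_sum]
          refine Finset.sum_congr rfl fun j _ => ?_
          rw [hcy, hcy]; ring
        have a4 : ∑ i, ∑ j, M i j * y i * y j * (c i - c j) ^ 2 = ∑ i, ∑ j, M i j * y i * y j * c i ^ 2 +
            ∑ i, ∑ j, M i j * y i * y j * c j ^ 2 - 2 * ∑ i, ∑ j, M i j * y i * y j * (c i * c j) := by
          rw [Finset.mul_sum, ← Finset.sum_add_distrib, ← Finset.sum_sub_distrib]
          refine Finset.sum_congr rfl fun i _ => ?_
          rw [Finset.mul_sum, ← Finset.sum_add_distrib, ← Finset.sum_sub_distrib]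
          refine Finset.sum_congr rfl fun j _ => ?_
          ring
        rw [a4, a3, ← a1, ← a2]; ring
      have tnn : ∀ i j, 0 ≤ M i j * y i * y j * (c i - c j) ^ 2 := by
        intro i j
        by_cases hij : i = j
        · subst hij; simp
        · have := hoff i j hij
          have := (hy i).le
          have := (hy j).le
          positivity
      rw [e1]
      by_contra hge
      have hle : ∑ i, ∑ j, M i j * y i * y j * (c i - c j) ^ 2 ≤ 0 := by linarith
      have hall : ∀ i j, M i j * y i * y j * (c i - c j) ^ 2 = 0 := by
        have hz := le_antisymm hle (Finset.sum_nonneg fun i _ => Finset.sum_nonneg fun j _ => tnn i j)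
        intro i j
        have := (Finset.sum_eq_zero_iff_of_nonneg fun i _ => Finset.sum_nonneg fun j _ => tnn i j).mp hz i (Finset.mem_univ i)
        exact (Finset.sum_eq_zero_iff_of_nonneg fun j _ => tnn i j).mp this j (Finset.mem_univ j)
      have hcc := conn c (by
        intro i j _ hMij
        have := hall i j
        have h1 := (hy i).ne'
        have h2 := (hy j).ne'
        have h3 : (c i - c j) ^ 2 = 0 := by
          rcases mul_eq_zero.mp this with h | h
          · simp [hMij, h1, h2] at h
          · exact h
        exact sub_eq_zero.mp (pow_eq_zero_iff (two_ne_zero) |>.mp h3))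
      have hs2 : c i0 * ∑ i, y i * p i = 0 := by
        rw [← hs, dotProduct, Finset.mul_sum]
        refine Finset.sum_congr rfl fun i _ => ?_
        rw [hcc i0 i]
        have h1 := (hr0 i).ne'
        have h2 := hrp i
        have h4 : ξ i = y i * c i / r i := by rw [← hcy]; field_simp
        rw [← h2, h4]; field_simp
      have hpos : 0 < ∑ i, y i * p i := Finset.sum_pos (fun i _ => mul_pos (hy i) (hp i)) ⟨i0, Finset.mem_univ _⟩
      have hc0 : c i0 = 0 := (mul_eq_zero.mp hs2).resolve_right hpos.ne'
      apply hξ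
      funext i
      have h1 := hcy i
      rw [hcc i i0, hc0, mul_zero] at h1
      exact (mul_eq_zero.mp h1).resolve_left (hr0 i).ne') (fun i => x i / r i) (by
      rw [dotProduct, ← hx]
      refine Finset.sum_congr rfl fun i _ => ?_
      have h1 := (hr0 i).ne'
      rw [← hrp]; field_simp)
  rw [xAx] at key
  have e : ∀ i, r i * (x i / r i) = x i := fun i => by
    have h1 := (hr0 i).ne'
    field_simp
  simpa only [e] using key

end matrix
end AFS
end PartO

section PartP
namespace AFS

open MeasureTheory Set MvPolynomial
open scoped ENNReal Pointwise

section
variable {ι : Type} [Fintype ι] [DecidableEq ι] {n : ℕ}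

def Nz (Φ : MvPolynomial ι ℝ →ₗ[ℝ] ℝ) (I : Finset ι) : Prop := ∃ s, Φ (mon I.val * mon s) ≠ 0

theorem Nz.of {Φ : MvPolynomial ι ℝ →ₗ[ℝ] ℝ} {I : Finset ι} {q} (h : Φ (mon I.val * q) ≠ 0) : Nz Φ I := by
  by_contra hn
  apply h
  simp only [Nz, not_exists, not_not] at hn
  induction q using mon_ind with
  | hadd p q hp hq =>
    have hp' : Φ (mon I.val * p) = 0 := by_contra fun h => h (hp h)
    have hq' : Φ (mon I.val * q) = 0 := by_contra fun h => h (hq h)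
    rw [mul_add, map_add, hp', hq', add_zero]
  | hs c p hp =>
    have hp' : Φ (mon I.val * p) = 0 := by_contra fun h => h (hp h)
    rw [mul_smul_comm, map_smul, hp', smul_zero]
  | hm s => exact hn s

theorem not_Nz {Φ : MvPolynomial ι ℝ →ₗ[ℝ] ℝ} {I : Finset ι} (h : ¬ Nz Φ I) (q) : Φ (mon I.val * q) = 0 := by
  by_contra hn
  exact h (Nz.of hn)

theorem mon_insert {I : Finset ι} {k : ι} (hk : k ∉ I) : mon (insert k I).val = X k * mon I.val := by
  rw [Finset.insert_val_of_notMem hk, mon_cons]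

abbrev Kap (Φ : MvPolynomial ι ℝ →ₗ[ℝ] ℝ) (I : Finset ι) := {k : ι // k ∉ I ∧ Nz Φ (insert k I)}

noncomputable instance (Φ : MvPolynomial ι ℝ →ₗ[ℝ] ℝ) (I : Finset ι) : Fintype (Kap Φ I) := Fintype.ofFinite _

theorem red0 (Φ : MvPolynomial ι ℝ →ₗ[ℝ] ℝ) (I : Finset ι) (w : ι → ℝ) (hw : ∀ i ∈ I, w i = 0) (q) :
    Φ (mon I.val * (ell w * q)) = ∑ k : Kap Φ I, w k * Φ (mon (insert k.1 I).val * q) := by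
  classical
  have e : Φ (mon I.val * (ell w * q)) = ∑ k, w k * Φ (mon I.val * (X k * q)) := by
    rw [ell, Fintype.linearCombination_apply, Finset.sum_mul, Finset.mul_sum, map_sum]
    refine Finset.sum_congr rfl fun i _ => ?_
    rw [← smul_eq_mul (w i), ← map_smul]
    congr 1
    simp only [mul_smul_comm, smul_mul_assoc]
  rw [e]
  have h2 : ∑ k ∈ Finset.univ.filter (fun k => k ∉ I ∧ Nz Φ (insert k I)), w k * Φ (mon (insert k I).val * q)
      = ∑ k, w k * Φ (mon I.val * (X k * q)) := by
    have h3 : ∑ k ∈ Finset.univ.filter (fun k => k ∉ I ∧ Nz Φ (insert k I)), w k * Φ (mon (insert k I).val * q) =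
      ∑ k ∈ Finset.univ.filter (fun k => k ∉ I ∧ Nz Φ (insert k I)), w k * Φ (mon I.val * (X k * q)) := by
      refine Finset.sum_congr rfl fun k hk => ?_
      rw [Finset.mem_filter] at hk
      rw [mon_insert hk.2.1]
      congr 2; ring
    rw [h3]
    refine Finset.sum_subset (Finset.subset_univ _) fun k _ hk => ?_
    simp only [Finset.mem_filter, Finset.mem_univ, true_and, not_and] at hk
    by_cases hkI : k ∈ I
    · rw [hw k hkI, zero_mul]
    · have := not_Nz (hk hkI) q
      rw [mon_insert hkI] at this
      rw [show mon I.val * (X k * q) = X k * mon I.val * q by ring, this, mul_zero]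
  rw [← h2]
  exact Finset.sum_subtype _ (by simp) _

variable {u : ι → EE' n} {Γ : Set (ι → ℝ)} {Fc : Finset ι → Prop} {Φ : MvPolynomial ι ℝ →ₗ[ℝ] ℝ}

theorem Alg.Fc_of (A : Alg u Γ Fc Φ) {I : Finset ι} (h : Nz Φ I) : Fc I := by
  by_contra hn
  obtain ⟨s, hs⟩ := h
  exact hs (A.nonf I hn _)

theorem Alg.tr (A : Alg u Γ Fc Φ) (w : ι → ℝ) (z) (q r) :
    Φ (r * (ell w * q)) = Φ (r * (ell (w - Uz u z) * q)) := by
  rw [map_sub, sub_mul, mul_sub, map_sub, show r * (ell (Uz u z) * q) = ell (Uz u z) * (r * q) by ring, A.transl, sub_zero]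

theorem norm_any (G : Geo u Γ Fc) (A : Alg u Γ Fc Φ) {I : Finset ι} (hI : Fc I) (w : ι → ℝ) :
    ∃ y : ι → ℝ, (∀ i ∈ I, y i = 0) ∧ ∀ r q, Φ (r * (ell w * q)) = Φ (r * (ell y * q)) := by
  obtain ⟨z, hz⟩ := G.indep I hI w
  refine ⟨w - Uz u z, fun i hi => ?_, fun r q => A.tr w z q r⟩
  simp [Uz, hz i hi]

theorem norm_pos (G : Geo u Γ Fc) (A : Alg u Γ Fc Φ) {I : Finset ι} (hI : Fc I) {w : ι → ℝ} (hw : w ∈ Γ) :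
    ∃ y : ι → ℝ, (∀ i ∈ I, y i = 0) ∧ (∀ i ∉ I, 0 < y i) ∧ ∀ r q, Φ (r * (ell w * q)) = Φ (r * (ell y * q)) := by
  obtain ⟨z, hz, hz2⟩ := G.face I hI w hw
  refine ⟨w - Uz u z, fun i hi => ?_, fun i hi => ?_, fun r q => A.tr w z q r⟩
  · simp [Uz, hz i hi]
  · simpa [Uz] using hz2 i hi

theorem Alg.pos (G : Geo u Γ Fc) (A : Alg u Γ Fc Φ) : ∀ (vs : List (ι → ℝ)) (I : Finset ι),
    I.card + vs.length = n → (∀ v ∈ vs, v ∈ Γ) →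
    0 ≤ Φ (mon I.val * (vs.map ell).prod) ∧ (Nz Φ I → 0 < Φ (mon I.val * (vs.map ell).prod)) := by
  intro vs
  induction vs with
  | nil =>
    intro I hI _
    rw [List.map_nil, List.prod_nil, mul_one]
    have h0 := A.nn I (by simpa using hI)
    refine ⟨h0, fun ⟨s, hs⟩ => lt_of_le_of_ne h0 fun h => ?_⟩
    rw [← mon_add] at hs
    have hc : (I.val + s).card = n := by
      by_contra hc
      exact hs (A.deg _ hc)
    have : s = 0 := by
      rw [← Multiset.card_eq_zero]
      rw [Multiset.card_add, Finset.card_val] at hc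
      simp at hI; omega
    rw [this, add_zero] at hs
    exact hs h.symm
  | cons v vs ih =>
    intro I hI hv
    by_cases hF : Fc I
    · obtain ⟨y, y0, yp, hy⟩ := norm_pos G A hF (hv v (by simp))
      rw [List.map_cons, List.prod_cons, hy, red0 Φ I y y0]
      have hk : ∀ k : Kap Φ I, 0 < y k * Φ (mon (insert k.1 I).val * (vs.map ell).prod) := fun k =>
        mul_pos (yp _ k.2.1) ((ih (insert k.1 I) (by
          rw [Finset.card_insert_of_notMem k.2.1]; simp at hI; omega) (fun v h => hv v (by simp [h]))).2 k.2.2)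
      refine ⟨Finset.sum_nonneg fun k _ => (hk k).le, fun ⟨s, hs⟩ => Finset.sum_pos (fun k _ => hk k) ?_⟩
      have hc : (I.val + s).card = n := by
        by_contra hc
        rw [← mon_add] at hs
        exact hs (A.deg _ hc)
      have hs1 : s ≠ 0 := by
        rintro rfl
        rw [add_zero, Finset.card_val] at hc
        simp at hI; omega
      obtain ⟨a, ha⟩ := Multiset.exists_mem_of_ne_zero hs1
      obtain ⟨s', rfl⟩ := Multiset.exists_cons_of_mem ha
      obtain ⟨y', y0', hy'⟩ := norm_any G A hF (Pi.single a 1)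
      rw [mon_cons, show (X a : MvPolynomial ι ℝ) = ell (Pi.single a 1) by rw [ell_single, one_smul], hy', red0 Φ I y' y0'] at hs
      obtain ⟨k, hk, -⟩ := Finset.exists_ne_zero_of_sum_ne_zero hs
      exact ⟨k, hk⟩
    · rw [A.nonf I hF]
      exact ⟨le_rfl, fun h => absurd (A.Fc_of h) hF⟩

theorem bf_symm (Φ : MvPolynomial ι ℝ →ₗ[ℝ] ℝ) (p) (x y : ι → ℝ) : bf Φ p x y = bf Φ p y x := by
  rw [bf_apply, bf_apply, mul_comm (ell x)]

theorem bf_zero {I : Finset ι} (h : ¬ Nz Φ I) (p) : Lor (bf Φ (mon I.val * p)) := by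
  refine Lor.zero fun x y => ?_
  rw [bf_apply, mul_assoc, not_Nz h]

theorem pow_list (h : ι → ℝ) (d : ℕ) : ell h ^ d = ((List.replicate d h).map ell).prod := by simp

theorem Alg.eqLor (G : Geo u Γ Fc) (A : Alg u Γ Fc Φ) (I : Finset ι) (d : ℕ) (hd : I.card + (d + 2) = n) (h : ι → ℝ)
    (hh : h ∈ Γ) : Lor (bf Φ (mon I.val * ell h ^ d)) := by
  by_cases hN : Nz Φ I
  swap
  · exact bf_zero hN _
  refine Lor.of_orth _ (bf_symm Φ _) h fun x hx => ?_
  have hf : 0 < Φ (mon I.val * ell h ^ (d + 2)) := by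
    rw [pow_list]
    exact (A.pos G _ I (by simpa using hd) (by simp +contextual [hh])).2 hN
  set f := Φ (mon I.val * ell h ^ (d + 2)) with hfd
  rw [bf_apply] at hx ⊢
  set a : ℝ → ℝ := fun ε => ∑ i ∈ Finset.range (d + 1), ((d + 2).choose i : ℝ) * (ε ^ (d - i) * Φ (mon I.val * ell x ^ (d + 2 - i) * ell h ^ i)) with ha
  have hac : Continuous a := by rw [ha]; fun_prop
  have ha0 : a 0 = ((d + 2).choose d : ℝ) * Φ (mon I.val * ell h ^ d * (ell x * ell x)) := by
    rw [ha]
    simp only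
    rw [Finset.sum_range_succ, Finset.sum_eq_zero, zero_add, Nat.sub_self, pow_zero, one_mul, Nat.add_sub_cancel_left]
    · congr 2; ring
    · intro i hi
      rw [Finset.mem_range] at hi
      rw [zero_pow (by omega), zero_mul, mul_zero]
  have hg : ∀ ε : ℝ, Φ (mon I.val * ell (h + ε • x) ^ (d + 2)) = f + ε ^ 2 * a ε := by
    intro ε
    have h1 := pow_diff Φ (mon I.val) (d + 2) h (ε • x)
    rw [Finset.sum_range_succ] at h1
    have h2 : Φ (mon I.val * ell (ε • x) ^ (d + 2 - (d + 1)) * ell h ^ (d + 1)) = 0 := by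
      rw [show d + 2 - (d + 1) = 1 by omega, pow_one, map_smul, mul_smul_comm, smul_mul_assoc, map_smul,
        show mon I.val * ell x * ell h ^ (d + 1) = mon I.val * ell h ^ d * (ell h * ell x) by ring, hx, smul_zero]
    rw [h2, mul_zero, add_zero, ← hfd] at h1
    have h3 : ∑ i ∈ Finset.range (d + 1), ((d + 2).choose i : ℝ) * Φ (mon I.val * ell (ε • x) ^ (d + 2 - i) * ell h ^ i) = ε ^ 2 * a ε := by
      rw [ha]; simp only
      rw [Finset.mul_sum]
      refine Finset.sum_congr rfl fun i hi => ?_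
      rw [Finset.mem_range] at hi
      rw [map_smul, smul_pow, mul_smul_comm, smul_mul_assoc, map_smul, smul_eq_mul, show d + 2 - i = (d - i) + 2 by omega, pow_add]
      ring
    linarith
  clear_value a f
  obtain ⟨r, hr, H⟩ := ball_sub G.isOpen hh
  have hev : ∀ᶠ ε : ℝ in nhdsWithin 0 (Ioi 0), f * (a ε + a (-ε)) + ε ^ 2 * (a ε * a (-ε)) ≤ 0 := by
    have : ∀ᶠ t : ℝ in nhdsWithin 0 (Ioi 0), t < r / (‖x‖ + 1) :=
      mem_nhdsWithin_of_mem_nhds (Iio_mem_nhds (by positivity))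
    filter_upwards [self_mem_nhdsWithin, this] with ε hε hε2
    have hε : 0 < ε := hε
    rw [lt_div_iff₀ (by positivity)] at hε2
    have m1 : h + ε • x ∈ Γ := by
      apply H
      rw [add_sub_cancel_left, norm_smul, Real.norm_of_nonneg hε.le]; nlinarith [norm_nonneg x]
    have m2 : h + (-ε) • x ∈ Γ := by
      apply H
      rw [add_sub_cancel_left, norm_smul, norm_neg, Real.norm_of_nonneg hε.le]; nlinarith [norm_nonneg x]
    have := A.lc I (d + 2) hd _ m1 _ m2
    rw [show (1 / 2 : ℝ) • (h + ε • x + (h + (-ε) • x)) = h by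
      funext i; simp; ring, hg, hg, ← hfd] at this
    have h3 : ε ^ 2 * (f * (a ε + a (-ε)) + ε ^ 2 * (a ε * a (-ε))) ≤ 0 := by
      have e : ε ^ 2 * (f * (a ε + a (-ε)) + ε ^ 2 * (a ε * a (-ε))) =
        (f + ε ^ 2 * a ε) * (f + (-ε) ^ 2 * a (-ε)) - f ^ 2 := by ring
      rw [e]; linarith
    by_contra hc
    push Not at hc
    have : 0 < ε ^ 2 * (f * (a ε + a (-ε)) + ε ^ 2 * (a ε * a (-ε))) := by positivity
    linarith
  have hcont : Continuous fun ε : ℝ => f * (a ε + a (-ε)) + ε ^ 2 * (a ε * a (-ε)) := by fun_prop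
  have h4 := le_of_tendsto (hcont.tendsto 0 |>.mono_left nhdsWithin_le_nhds) hev
  have hcc : (0:ℝ) < ((d + 2).choose d : ℝ) := by
    exact_mod_cast Nat.choose_pos (by omega)
  simp only [neg_zero, ne_eq, OfNat.ofNat_ne_zero, not_false_eq_true, zero_pow, zero_mul, add_zero] at h4
  have h5 : a 0 ≤ 0 := by nlinarith
  rw [ha0] at h5
  by_contra hc
  push Not at hc
  nlinarith [mul_pos hcc hc]

theorem red2 (Φ : MvPolynomial ι ℝ →ₗ[ℝ] ℝ) (I : Finset ι) (w w' : ι → ℝ) (hw : ∀ i ∈ I, w i = 0) 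
    (hw' : ∀ i ∈ I, w' i = 0) (q) :
    Φ (mon I.val * (q * (ell w * ell w'))) = ∑ i : Kap Φ I, w i * ∑ j : Kap Φ I, Φ (mon I.val * (q * (X i.1 * X j.1))) * w' j := by
  rw [show mon I.val * (q * (ell w * ell w')) = mon I.val * (ell w * (q * ell w')) by ring, red0 Φ I w hw]
  refine Finset.sum_congr rfl fun i _ => ?_
  rw [show mon (insert i.1 I).val * (q * ell w') = mon I.val * (ell w' * (X i.1 * q)) by
    rw [mon_insert i.2.1]; ring, red0 Φ I w' hw']
  congr 1
  refine Finset.sum_congr rfl fun j _ => ?_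
  rw [show mon (insert j.1 I).val * (X i.1 * q) = mon I.val * (q * (X i.1 * X j.1)) by
    rw [mon_insert j.2.1]; ring, mul_comm]

/-- connectivity from a Lorentzian form. -/
theorem conn_of_lor {κ : Type} [Fintype κ] (M : κ → κ → ℝ)
    (y : κ → ℝ) (hy : ∀ i, 0 < y i) (hp : ∀ i, 0 < ∑ j, M i j * y j)
    (hL : ∀ x : κ → ℝ, ∑ i, y i * ∑ j, M i j * x j = 0 → ∑ i, x i * ∑ j, M i j * x j ≤ 0)
    (c : κ → ℝ) (hc : ∀ i j, i ≠ j → M i j ≠ 0 → c i = c j) : ∀ i j, c i = c j := by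
  intro i0 j0
  set p : κ → ℝ := fun i => ∑ j, M i j * y j with hpd
  have hS : 0 < ∑ i, y i * p i := Finset.sum_pos (fun i _ => mul_pos (hy i) (hp i)) ⟨i0, Finset.mem_univ _⟩
  set S := ∑ i, y i * p i with hSd
  set b := (∑ i, c i * (y i * p i)) / S with hb
  have key : ∀ i, ∑ j, M i j * ((c j - b) * y j) = (c i - b) * p i := by
    intro i
    rw [hpd]; simp only
    rw [Finset.mul_sum]
    refine Finset.sum_congr rfl fun j _ => ?_
    by_cases hij : i = j
    · subst hij; ring
    by_cases h0 : M i j = 0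
    · rw [h0]; ring
    · rw [hc i j hij h0]; ring
  have h1 := hL (fun j => (c j - b) * y j) (by
    simp only [key]
    have : ∑ i, y i * ((c i - b) * p i) = ∑ i, c i * (y i * p i) - b * S := by
      rw [hSd, Finset.mul_sum, ← Finset.sum_sub_distrib]
      refine Finset.sum_congr rfl fun i _ => by ring
    rw [this, hb]; field_simp; ring)
  simp only [key] at h1
  have h2 : ∀ i ∈ Finset.univ, 0 ≤ (c i - b) * y i * ((c i - b) * p i) := by
    intro i _
    have := mul_nonneg (sq_nonneg (c i - b)) (mul_pos (hy i) (hp i)).le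
    nlinarith
  have h3 := (Finset.sum_eq_zero_iff_of_nonneg h2).mp (le_antisymm h1 (Finset.sum_nonneg h2))
  have h4 : ∀ i, c i = b := by
    intro i
    have h5 := h3 i (Finset.mem_univ i)
    have h6 : (c i - b) ^ 2 * (y i * p i) = 0 := by rw [← h5]; ring
    have := (mul_eq_zero.mp h6).resolve_right (mul_pos (hy i) (hp i)).ne'
    have := pow_eq_zero_iff (two_ne_zero) |>.mp this
    linarith
  rw [h4, h4]

end
end AFS
end PartP

section PartQ
namespace AFS

open MeasureTheory Set MvPolynomial
open scoped ENNReal Pointwise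

section
variable {ι : Type} [Fintype ι] [DecidableEq ι] {n : ℕ}
variable {u : ι → EE' n} {Γ : Set (ι → ℝ)} {Fc : Finset ι → Prop} {Φ : MvPolynomial ι ℝ →ₗ[ℝ] ℝ}

theorem kap_pair (Φ : MvPolynomial ι ℝ →ₗ[ℝ] ℝ) {I : Finset ι} (i j : Kap Φ I) (hij : i ≠ j) (q) :
    mon I.val * (q * (X i.1 * X j.1)) = mon (insert i.1 (insert j.1 I)).val * q ∧ 
      (insert i.1 (insert j.1 I)).card = I.card + 2 := by
  have h1 : i.1 ∉ insert j.1 I := by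
    rw [Finset.mem_insert, not_or]
    exact ⟨fun h => hij (Subtype.ext h), i.2.1⟩
  rw [mon_insert h1, mon_insert j.2.1, Finset.card_insert_of_notMem h1, Finset.card_insert_of_notMem j.2.1]
  exact ⟨by ring, rfl⟩

theorem Alg.mixLor (G : Geo u Γ Fc) (A : Alg u Γ Fc Φ) : ∀ (vs : List (ι → ℝ)) (I : Finset ι), 
    I.card + (vs.length + 2) = n → (∀ v ∈ vs, v ∈ Γ) → Lor (bf Φ (mon I.val * (vs.map ell).prod)) := by
  classical
  intro vs
  induction vs with
  | nil =>
    intro I hI _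
    obtain ⟨h, hh⟩ := G.nonempty
    simpa using A.eqLor G I 0 (by simpa using hI) h hh
  | cons v vs ih =>
    intro I hI hv
    by_cases hN : Nz Φ I
    swap
    · exact bf_zero hN _
    have hF := A.Fc_of hN
    have hvG : v ∈ Γ := hv v (by simp)
    have hvs : ∀ w ∈ vs, w ∈ Γ := fun w hw => hv w (by simp [hw])
    rw [List.length_cons] at hI
    obtain ⟨y, y0, yp, hy⟩ := norm_pos G A hF hvG
    rw [List.map_cons, List.prod_cons]
    set P := (vs.map ell).prod with hP
    refine Lor.of_orth _ (bf_symm Φ _) v fun x hx => ?_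
    obtain ⟨x', x0, hx'⟩ := norm_any G A hF x
    rw [bf_apply] at hx ⊢
    have hcard : ∀ k : Kap Φ I, (insert k.1 I).card = I.card + 1 := fun k => Finset.card_insert_of_notMem k.2.1
    -- the matrix
    have hoff : ∀ q : List (ι → ℝ), q.length = vs.length + 1 → (∀ w ∈ q, w ∈ Γ) → ∀ i j : Kap Φ I, i ≠ j →
        0 ≤ Φ (mon I.val * ((q.map ell).prod * (X i.1 * X j.1))) ∧
        (Φ (mon I.val * ((q.map ell).prod * (X i.1 * X j.1))) ≠ 0 ↔ Nz Φ (insert i.1 (insert j.1 I))) := by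
      intro q hq hqG i j hij
      obtain ⟨e1, e2⟩ := kap_pair Φ i j hij (q.map ell).prod
      rw [e1]
      have := A.pos G q (insert i.1 (insert j.1 I)) (by omega) hqG
      exact ⟨this.1, Nz.of, fun h => (this.2 h).ne'⟩
    have hpp : ∀ q : List (ι → ℝ), q.length = vs.length + 1 → (∀ w ∈ q, w ∈ Γ) → ∀ i : Kap Φ I,
        Φ (mon (insert i.1 I).val * ((q.map ell).prod * ell v)) = ∑ j : Kap Φ I, Φ (mon I.val * ((q.map ell).prod * (X i.1 * X j.1))) * y j ∧
        0 < ∑ j : Kap Φ I, Φ (mon I.val * ((q.map ell).prod * (X i.1 * X j.1))) * y j := by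
      intro q hq hqG i
      have e : Φ (mon (insert i.1 I).val * ((q.map ell).prod * ell v)) = ∑ j : Kap Φ I, Φ (mon I.val * ((q.map ell).prod * (X i.1 * X j.1))) * y j := by
        rw [show mon (insert i.1 I).val * ((q.map ell).prod * ell v) = mon I.val * (ell v * (X i.1 * (q.map ell).prod)) by
          rw [mon_insert i.2.1]; ring, hy, red0 Φ I y y0]
        refine Finset.sum_congr rfl fun j _ => ?_
        rw [show mon (insert j.1 I).val * (X i.1 * (q.map ell).prod) = mon I.val * ((q.map ell).prod * (X i.1 * X j.1)) by
          rw [mon_insert j.2.1]; ring, mul_comm]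
      refine ⟨e, ?_⟩
      rw [← e]
      have := (A.pos G (q ++ [v]) (insert i.1 I) (by rw [hcard, List.length_append, List.length_singleton]; omega) (by
        intro w hw
        rw [List.mem_append, List.mem_singleton] at hw
        rcases hw with hw | rfl
        · exact hqG w hw
        · exact hvG)).2 i.2.2
      simpa using this
    set M : Kap Φ I → Kap Φ I → ℝ := fun i j => Φ (mon I.val * (ell v * P * (X i.1 * X j.1))) with hM
    have hq1 : ((v :: vs).map ell).prod = ell v * P := by rw [List.map_cons, List.prod_cons]
    have hoff1 := hoff (v :: vs) (by simp) hv
    have hpp1 := hpp (v :: vs) (by simp) hv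
    rw [hq1] at hoff1 hpp1
    -- rewriting
    have hxx : Φ (mon I.val * (ell v * P) * (ell x * ell x)) = ∑ i : Kap Φ I, x' i * ∑ j : Kap Φ I, M i j * x' j := by
      rw [hx', show mon I.val * (ell v * P) * (ell x' * ell x) = mon I.val * (ell v * P) * (ell x * ell x') by ring, hx',
        mul_assoc, red2 Φ I x' x' x0 x0]
    have hvx : ∑ i : Kap Φ I, (∑ j : Kap Φ I, M i j * y j) * x' i = 0 := by
      rw [hy, show mon I.val * (ell v * P) * (ell y * ell x) = mon I.val * (ell v * P) * (ell x * ell y) by ring, hx',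
        mul_assoc, red2 Φ I x' y x0 y0] at hx
      rw [← hx]
      exact Finset.sum_congr rfl fun i _ => mul_comm _ _
    rw [hxx]
    refine mat_lemma M ?_ ?_ (fun i => y i) (fun i => ∑ j : Kap Φ I, M i j * y j) (fun i => yp _ i.2.1) (fun i => (hpp1 i).2) (fun _ => rfl) ?_ ?_ _ hvx
    · intro i j
      simp only [hM]; rw [mul_comm (X i.1)]
    · intro i j hij
      exact (hoff1 i j hij).1
    · intro t
      set T : ι → ℝ := fun i => if h : i ∉ I ∧ Nz Φ (insert i I) then t ⟨i, h⟩ else 0 with hT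
      have T0 : ∀ i ∈ I, T i = 0 := fun i hi => by rw [hT]; simp [hi]
      have Tt : ∀ i : Kap Φ I, T i = t i := fun i => by rw [hT]; simp [i.2]
      have e := red2 Φ I T T T0 T0 (ell v * P)
      simp only [Tt] at e
      rw [← e, mul_assoc (ell v), hy, red0 Φ I y y0]
      refine Finset.sum_le_sum fun k _ => ?_
      rw [mul_div_assoc]
      refine mul_le_mul_of_nonneg_left ?_ (yp _ k.2.1).le
      have hL := ih (insert k.1 I) (by rw [hcard]; omega) hvs
      have e2 : bf Φ (mon (insert k.1 I).val * P) v v = ∑ j : Kap Φ I, M k j * y j := by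
        rw [← (hpp1 k).1, bf_apply]; congr 1; ring
      have := hL.bochner (v := v) (by rw [e2]; exact (hpp1 k).2) T
      rw [e2] at this
      have e3 : bf Φ (mon (insert k.1 I).val * P) v T = ∑ j : Kap Φ I, M k j * t j := by
        rw [bf_apply, show mon (insert k.1 I).val * P * (ell v * ell T) = mon I.val * (ell T * (ell v * P * X k.1)) by
          rw [mon_insert k.2.1]; ring, red0 Φ I T T0]
        refine Finset.sum_congr rfl fun j _ => ?_
        rw [Tt, mul_comm, mon_insert j.2.1]
        simp only [hM]
        congr 2; ring
      rw [e3, bf_apply, mul_assoc] at this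
      exact this
    · intro c hc
      have hq0 : ((List.replicate (vs.length + 1) v).map ell).prod = ell v ^ (vs.length + 1) := (pow_list _ _).symm
      have hoff0 := hoff (List.replicate (vs.length + 1) v) (by simp) (by simp [hvG])
      have hpp0 := hpp (List.replicate (vs.length + 1) v) (by simp) (by simp [hvG])
      rw [hq0] at hoff0 hpp0
      refine conn_of_lor (fun i j : Kap Φ I => Φ (mon I.val * (ell v ^ (vs.length + 1) * (X i.1 * X j.1)))) (fun i => y i) (fun i => yp _ i.2.1) (fun i => (hpp0 i).2) ?_ c ?_
      · intro t ht
        set T : ι → ℝ := fun i => if h : i ∉ I ∧ Nz Φ (insert i I) then t ⟨i, h⟩ else 0 with hT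
        have T0 : ∀ i ∈ I, T i = 0 := fun i hi => by rw [hT]; simp [hi]
        have Tt : ∀ i : Kap Φ I, T i = t i := fun i => by rw [hT]; simp [i.2]
        have hL := A.eqLor G I (vs.length + 1) (by omega) v hvG
        have e1 := red2 Φ I T T T0 T0 (ell v ^ (vs.length + 1))
        have e2 := red2 Φ I y T y0 T0 (ell v ^ (vs.length + 1))
        simp only [Tt] at e1 e2
        rw [← e1, ← mul_assoc]
        have hvv : 0 < bf Φ (mon I.val * ell v ^ (vs.length + 1)) v v := by
          have := (A.pos G (List.replicate (vs.length + 3) v) I (by rw [List.length_replicate]; omega) (by simp [hvG])).2 hN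
          rw [← pow_list] at this
          rw [bf_apply]
          convert this using 2; ring
        refine hL.orth hvv ?_
        rw [bf_apply, hy, mul_assoc, e2]
        exact ht
      · intro i j hij h0
        exact hc i j hij ((hoff1 i j hij).2.mpr ((hoff0 i j hij).2.mp h0))

/-- pull back along a finite family of elements of `Γ`. -/
noncomputable def pullF {σ : Type} [Fintype σ] (Φ : MvPolynomial ι ℝ →ₗ[ℝ] ℝ) (h : σ → ι → ℝ) : MvPolynomial σ ℝ →ₗ[ℝ] ℝ :=
  Φ.comp (aeval (R := ℝ) (fun s => ell (h s))).toLinearMap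

theorem pullF_apply {σ : Type} [Fintype σ] (h : σ → ι → ℝ) (q) : pullF Φ h q = Φ (aeval (fun s => ell (h s)) q) := rfl

theorem aeval_mon {σ : Type} [Fintype σ] (h : σ → ι → ℝ) (s : Multiset σ) :
    aeval (R := ℝ) (fun s => ell (h s)) (mon s) = ((s.toList.map h).map ell).prod := by
  rw [mon, map_multiset_prod, Multiset.map_map, List.map_map, ← Multiset.prod_coe, ← Multiset.map_coe, Multiset.coe_toList]
  congr 1
  refine Multiset.map_congr rfl fun x _ => ?_
  simp

theorem Alg.AFpos (G : Geo u Γ Fc) (A : Alg u Γ Fc Φ) (hN : Nz Φ ∅) {σ : Type} [Fintype σ] (h : σ → ι → ℝ) (hh : ∀ s, h s ∈ Γ) : 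
    AFpos (pullF Φ h) n := by
  have hm : ∀ s : Multiset σ, ∀ v ∈ s.toList.map h, v ∈ Γ := by
    intro s v hv
    obtain ⟨a, -, rfl⟩ := List.mem_map.mp hv
    exact hh a
  have h0 : mon (∅ : Finset ι).val = 1 := by simp [mon]
  constructor
  · intro s hs
    rw [pullF_apply, aeval_mon]
    have := (A.pos G (s.toList.map h) ∅ (by simpa using hs) (hm s)).2 hN
    rwa [h0, one_mul] at this
  · intro s hs
    have := A.mixLor G (s.toList.map h) ∅ (by simpa using hs) (hm s)
    rw [h0, one_mul] at this
    refine this.comp (Fintype.linearCombination ℝ h) ?_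
    intro x y
    have hl : ∀ z : σ → ℝ, aeval (R := ℝ) (fun s => ell (h s)) (ell z) = ell (Fintype.linearCombination ℝ h z) := by
      intro z
      have e : ell z = ∑ i, z i • (X i : MvPolynomial σ ℝ) := by rw [ell, Fintype.linearCombination_apply]
      rw [e, Fintype.linearCombination_apply, map_sum, map_sum]
      simp
    rw [bf_apply, pullF_apply, map_mul (aeval _), map_mul (aeval _), hl, hl, aeval_mon, bf_apply]

end
end AFS
end PartQ

section PartR
namespace AFS

open MeasureTheory Set
open scoped ENNReal Pointwise

section cone
variable {n : ℕ}

/-- `u` lies in the closed cell of `w` of the central arrangement `D`. -/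
def Cpt (D : Finset (EE' n)) (w u : EE' n) : Prop :=
  ∀ d ∈ D, (0 ≤ inner ℝ d w → 0 ≤ inner ℝ d u) ∧ (inner ℝ d w ≤ 0 → inner ℝ d u ≤ 0)

theorem Cpt.trans {D : Finset (EE' n)} {w u v : EE' n} (h : Cpt D w u) (h' : Cpt D u v) : Cpt D w v :=
  fun d hd => ⟨fun h0 => (h' d hd).1 ((h d hd).1 h0), fun h0 => (h' d hd).2 ((h d hd).2 h0)⟩

theorem cpt_step (D : Finset (EE' n)) (w ν : EE' n) (hz : ∀ d ∈ D, inner ℝ d w = 0 → inner ℝ d ν = 0)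
    (hd : ∃ d ∈ D, 0 < inner ℝ d ν * inner ℝ d w) : ∃ t : ℝ, 0 < t ∧ Cpt D w (w - t • ν) ∧
      ∃ d ∈ D, inner ℝ d w ≠ 0 ∧ inner ℝ d (w - t • ν) = 0 := by
  classical
  obtain ⟨d0, hd0, hp0⟩ := hd
  obtain ⟨d1, hd1, hmin⟩ := Finset.exists_min_image (D.filter fun d => 0 < inner ℝ d ν * inner ℝ d w)
    (fun d => inner ℝ d w / inner ℝ d ν) ⟨d0, by simp [hd0, hp0]⟩
  rw [Finset.mem_filter] at hd1
  have hne : inner ℝ d1 ν ≠ 0 := fun h => by simp [h] at hd1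
  have hne' : inner ℝ d1 w ≠ 0 := fun h => by simp [h] at hd1
  have ht : 0 < inner ℝ d1 w / inner ℝ d1 ν := by
    rw [div_eq_mul_inv, show inner ℝ d1 w * (inner ℝ d1 ν)⁻¹ = (inner ℝ d1 ν * inner ℝ d1 w) * ((inner ℝ d1 ν)⁻¹) ^ 2 by field_simp]
    have : 0 < ((inner ℝ d1 ν)⁻¹) ^ 2 := by positivity
    exact mul_pos hd1.2 this
  set t := inner ℝ d1 w / inner ℝ d1 ν with htd
  refine ⟨t, ht, ?_, d1, hd1.1, hne', ?_⟩
  · intro d hd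
    rw [inner_sub_right, inner_smul_right]
    rcases lt_trichotomy (inner ℝ d w) 0 with hw | hw | hw
    · refine ⟨fun h => absurd h (not_le.mpr hw), fun _ => ?_⟩
      by_cases hν : 0 ≤ inner ℝ d ν
      · nlinarith
      · push Not at hν
        have h1 := hmin d (by simp [hd, mul_pos_of_neg_of_neg hν hw])
        rw [le_div_iff_of_neg hν] at h1
        linarith
    · rw [hw, hz d hd hw]; simp
    · refine ⟨fun _ => ?_, fun h => absurd h (not_le.mpr hw)⟩
      by_cases hν : inner ℝ d ν ≤ 0
      · nlinarith
      · push Not at hν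
        have h1 := hmin d (by simp [hd, mul_pos hν hw])
        rw [le_div_iff₀ hν] at h1
        linarith
  · rw [inner_sub_right, inner_smul_right, htd]
    field_simp; ring

/-- index type for the rays -/
abbrev RI (D : Finset (EE' n)) := {A : Finset (EE' n) // A ⊆ D} × Bool

noncomputable instance (D : Finset (EE' n)) : Fintype (RI D) :=
  letI : Fintype {A : Finset (EE' n) // A ⊆ D} := Fintype.subtype D.powerset (by simp)
  inferInstance

theorem exists_nuR (hn : 1 ≤ n) (A : Finset (EE' n)) : ∃ ν : EE' n, ν ≠ 0 ∧ 
    ((∃ w : EE' n, w ≠ 0 ∧ ∀ d ∈ A, inner ℝ d w = 0) → ∀ d ∈ A, inner ℝ d ν = 0) := by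
  by_cases h : ∃ w : EE' n, w ≠ 0 ∧ ∀ d ∈ A, inner ℝ d w = 0
  · obtain ⟨w, hw, hw2⟩ := h
    exact ⟨w, hw, fun _ => hw2⟩
  · have : Nonempty (Fin n) := ⟨⟨0, hn⟩⟩
    obtain ⟨w, hw⟩ := exists_ne (0 : EE' n)
    exact ⟨w, hw, fun h' => absurd h' h⟩

noncomputable def nu (hn : 1 ≤ n) (A : Finset (EE' n)) : EE' n := Classical.choose (exists_nuR hn A)

noncomputable def ray (hn : 1 ≤ n) (D : Finset (EE' n)) (i : RI D) : EE' n := 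
  if i.2 then nu hn i.1.1 else - nu hn i.1.1

theorem ray_ne (hn : 1 ≤ n) (D : Finset (EE' n)) (i : RI D) : ray hn D i ≠ 0 := by
  have := (Classical.choose_spec (exists_nuR hn i.1.1)).1
  unfold ray
  split_ifs
  · exact this
  · exact neg_ne_zero.mpr this

def InC (hn : 1 ≤ n) (D : Finset (EE' n)) (w v : EE' n) : Prop :=
  ∃ c : RI D → ℝ, (∀ i, 0 ≤ c i) ∧ (∀ i, c i ≠ 0 → Cpt D w (ray hn D i)) ∧ v = ∑ i, c i • ray hn D i

theorem InC.add {hn : 1 ≤ n} {D : Finset (EE' n)} {w v v' : EE' n} (h : InC hn D w v) (h' : InC hn D w v') : 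
    InC hn D w (v + v') := by
  obtain ⟨c, c0, c1, rfl⟩ := h
  obtain ⟨c', c0', c1', rfl⟩ := h'
  refine ⟨c + c', fun i => add_nonneg (c0 i) (c0' i), fun i hi => ?_, ?_⟩
  · by_cases h : c i = 0
    · refine c1' i fun h' => hi ?_
      simp [h, h']
    · exact c1 i h
  · rw [← Finset.sum_add_distrib]
    exact Finset.sum_congr rfl fun i _ => by rw [Pi.add_apply, add_smul]

theorem InC.smul {hn : 1 ≤ n} {D : Finset (EE' n)} {w v : EE' n} (h : InC hn D w v) {t : ℝ} (ht : 0 ≤ t) : 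
    InC hn D w (t • v) := by
  obtain ⟨c, c0, c1, rfl⟩ := h
  refine ⟨t • c, fun i => mul_nonneg ht (c0 i), fun i hi => c1 i fun h => hi (by simp [h]), ?_⟩
  rw [Finset.smul_sum]
  exact Finset.sum_congr rfl fun i _ => by rw [Pi.smul_apply, smul_assoc]

theorem InC.zero {hn : 1 ≤ n} {D : Finset (EE' n)} {w : EE' n} : InC hn D w 0 :=
  ⟨0, fun _ => le_rfl, fun i hi => absurd rfl hi, by simp⟩

theorem InC.ray {hn : 1 ≤ n} {D : Finset (EE' n)} {w : EE' n} (i : RI D) (h : Cpt D w (ray hn D i)) : 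
    InC hn D w (ray hn D i) := by
  classical
  refine ⟨Pi.single i 1, fun j => ?_, fun j hj => ?_, ?_⟩
  · by_cases h : j = i
    · subst h; simp
    · simp [h]
  · by_cases h' : j = i
    · subst h'; exact h
    · simp [h'] at hj
  · rw [Finset.sum_eq_single i]
    · simp
    · intro j _ hj; simp [hj]
    · simp

theorem InC.mono {hn : 1 ≤ n} {D : Finset (EE' n)} {w w' v : EE' n} (hw : Cpt D w w') (h : InC hn D w' v) : 
    InC hn D w v := by
  obtain ⟨c, c0, c1, rfl⟩ := h
  exact ⟨c, c0, fun i hi => hw.trans (c1 i hi), rfl⟩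

theorem cone_main (hn : 1 ≤ n) (D : Finset (EE' n)) (hD : ∀ w, (∀ d ∈ D, inner ℝ d w = 0) → w = 0) :
    ∀ (m : ℕ) (w : EE' n), (D.filter fun d => inner ℝ d w ≠ 0).card = m → InC hn D w w := by
  classical
  intro m
  induction m using Nat.strong_induction_on with
  | _ m ih =>
    intro w hm
    by_cases hw : w = 0
    · subst hw; exact InC.zero
    set A := D.filter fun d => inner ℝ d w = 0 with hA
    have hAD : A ⊆ D := Finset.filter_subset _ _
    set ν := nu hn A with hν
    have hν0 : ν ≠ 0 := (Classical.choose_spec (exists_nuR hn A)).1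
    have hνA : ∀ d ∈ D, inner ℝ d w = 0 → inner ℝ d ν = 0 := by
      intro d hd h0
      refine (Classical.choose_spec (exists_nuR hn A)).2 ⟨w, hw, ?_⟩ d (by simp [hA, hd, h0])
      intro d' hd'
      simp [hA] at hd'
      exact hd'.2
    have hνA' : ∀ d ∈ D, inner ℝ d w = 0 → inner ℝ d (-ν) = 0 := by
      intro d hd h0
      rw [inner_neg_right, hνA d hd h0, neg_zero]
    have hrec : ∀ w', Cpt D w w' → (∃ d ∈ D, inner ℝ d w ≠ 0 ∧ inner ℝ d w' = 0) → InC hn D w w' := by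
      intro w' hc ⟨d, hd, h1, h2⟩
      refine InC.mono hc (ih _ ?_ w' rfl)
      rw [← hm]
      apply Finset.card_lt_card
      rw [Finset.ssubset_iff_of_subset]
      · exact ⟨d, by simp [hd, h1], by simp [h2]⟩
      · intro e he
        simp only [Finset.mem_filter] at he ⊢
        refine ⟨he.1, fun h0 => he.2 ?_⟩
        exact le_antisymm ((hc e he.1).2 h0.le) ((hc e he.1).1 h0.ge)
    have hrp : ray hn D (⟨A, hAD⟩, true) = ν := by simp [ray, hν]
    have hrm : ray hn D (⟨A, hAD⟩, false) = -ν := by simp [ray, hν]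
    obtain ⟨d0, hd0, hdν⟩ : ∃ d ∈ D, inner ℝ d ν ≠ 0 := by
      by_contra hc
      push Not at hc
      exact hν0 (hD ν hc)
    have hdw : inner ℝ d0 w ≠ 0 := fun h => hdν (hνA d0 hd0 h)
    have one : ∀ ν' : EE' n, (∀ d ∈ D, inner ℝ d w = 0 → inner ℝ d ν' = 0) → (∃ d ∈ D, 0 < inner ℝ d ν' * inner ℝ d w) →
        (¬ ∃ d ∈ D, 0 < inner ℝ d (-ν') * inner ℝ d w) → (Cpt D w ν' → InC hn D w ν') → InC hn D w w := by
      intro ν' h0 h1 h2 h3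
      obtain ⟨t, ht, hc, hd⟩ := cpt_step D w ν' h0 h1
      have h4 := hrec _ hc hd
      have h5 : Cpt D w ν' := by
        intro d hd
        push Not at h2
        have h6 := h2 d hd
        rw [inner_neg_right] at h6
        rcases lt_trichotomy (inner ℝ d w) 0 with hw | hw | hw
        · exact ⟨fun h => absurd h (not_le.mpr hw), fun _ => by nlinarith⟩
        · rw [h0 d hd hw]; simp
        · exact ⟨fun _ => by nlinarith, fun h => absurd h (not_le.mpr hw)⟩
      have := h4.add ((h3 h5).smul ht.le)
      simpa using this
    by_cases h1 : ∃ d ∈ D, 0 < inner ℝ d ν * inner ℝ d w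
    · by_cases h2 : ∃ d ∈ D, 0 < inner ℝ d (-ν) * inner ℝ d w
      · obtain ⟨t, ht, hc, hd⟩ := cpt_step D w ν hνA h1
        obtain ⟨t', ht', hc', hd'⟩ := cpt_step D w (-ν) hνA' h2
        have h3 := ((hrec _ hc hd).smul ht'.le).add ((hrec _ hc' hd').smul ht.le)
        have h4 := h3.smul (t := (t + t')⁻¹) (by positivity)
        have e : (t + t')⁻¹ • (t' • (w - t • ν) + t • (w - t' • (-ν))) = w := by
          have e1 : t' • (w - t • ν) + t • (w - t' • (-ν)) = (t + t') • w := by module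
          rw [e1, smul_smul, inv_mul_cancel₀ (by positivity), one_smul]
        rwa [e] at h4
      · exact one ν hνA h1 h2 (fun h => by rw [← hrp] at h ⊢; exact InC.ray _ h)
    · have h2 : ∃ d ∈ D, 0 < inner ℝ d (-ν) * inner ℝ d w := by
        refine ⟨d0, hd0, ?_⟩
        push Not at h1
        rw [inner_neg_right]
        have := h1 d0 hd0
        have h3 : inner ℝ d0 ν * inner ℝ d0 w ≠ 0 := mul_ne_zero hdν hdw
        have := lt_of_le_of_ne this h3
        linarith
      exact one (-ν) hνA' h2 (by rwa [neg_neg]) (fun h => by rw [← hrm] at h ⊢; exact InC.ray _ h)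

end cone
end AFS
end PartR

section PartS
namespace AFS

open MeasureTheory Set
open scoped ENNReal Pointwise

section poly
variable {ι : Type} [Fintype ι] [DecidableEq ι] {n : ℕ}

def PosSp (u : ι → EE' n) : Prop := ∀ w, ∃ c : ι → ℝ, (∀ i, 0 ≤ c i) ∧ w = ∑ i, c i • u i

theorem Pol_cone {u : ι → EE' n} {h : ι → ℝ} {x : EE' n} (hx : x ∈ Pol u h) (c : ι → ℝ) (hc : ∀ i, 0 ≤ c i) :
    inner ℝ (∑ i, c i • u i) x ≤ ∑ i, c i * h i := by
  rw [sum_inner]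
  refine Finset.sum_le_sum fun i _ => ?_
  rw [real_inner_smul_left]
  exact mul_le_mul_of_nonneg_left (hx i) (hc i)

theorem PosSp.bdd {u : ι → EE' n} (hu : PosSp u) (h : ι → ℝ) : Bornology.IsBounded (Pol u h) := by
  set b := EuclideanSpace.basisFun (Fin n) ℝ
  have : ∀ w : EE' n, ∃ C : ℝ, ∀ x ∈ Pol u h, inner ℝ w x ≤ C := by
    intro w
    obtain ⟨c, c0, rfl⟩ := hu w
    exact ⟨_, fun x hx => Pol_cone hx c c0⟩
  choose C hC using this
  rw [isBounded_iff_forall_norm_le]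
  refine ⟨∑ i, max (C (b i)) (C (-(b i))), fun x hx => ?_⟩
  have e := b.sum_repr' x
  calc ‖x‖ = ‖∑ i, inner ℝ (b i) x • b i‖ := by rw [e]
    _ ≤ ∑ i, ‖inner ℝ (b i) x • b i‖ := norm_sum_le _ _
    _ ≤ _ := by
      refine Finset.sum_le_sum fun i _ => ?_
      rw [norm_smul, b.orthonormal.norm_eq_one i, mul_one, Real.norm_eq_abs, abs_le']
      refine ⟨(hC _ x hx).trans (le_max_left _ _), ?_⟩
      rw [← inner_neg_left]
      exact (hC _ x hx).trans (le_max_right _ _)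

theorem Pol_closed (u : ι → EE' n) (h : ι → ℝ) : IsClosed (Pol u h) := by
  have : Pol u h = ⋂ i, {x | inner ℝ (u i) x ≤ h i} := by ext x; simp [Pol]
  rw [this]
  exact isClosed_iInter fun i => isClosed_le (by fun_prop) continuous_const

theorem PosSp.cpt {u : ι → EE' n} (hu : PosSp u) (h : ι → ℝ) : IsCompact (Pol u h) :=
  Metric.isCompact_of_isClosed_isBounded (Pol_closed u h) (hu.bdd h)

noncomputable def act (u : ι → EE' n) (h : ι → ℝ) (x : EE' n) : Finset ι := Finset.univ.filter fun i => inner ℝ (u i) x = h i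

theorem mem_act {u : ι → EE' n} {h : ι → ℝ} {x : EE' n} {i : ι} : i ∈ act u h x ↔ inner ℝ (u i) x = h i := by simp [act]

def Sep (u : ι → EE' n) (B : Finset ι) : Prop := ∀ z, (∀ j ∈ B, inner ℝ (u j) z = 0) → z = 0

structure DB (u : ι → EE' n) (B : Finset ι) (e : ι → EE' n) : Prop where
  sep : Sep u B
  one : ∀ i ∈ B, ∀ j ∈ B, inner ℝ (u i) (e j) = if i = j then 1 else 0

noncomputable def xB (e : ι → EE' n) (B : Finset ι) (h : ι → ℝ) : EE' n := ∑ j ∈ B, h j • e j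

theorem DB.inner_xB {u : ι → EE' n} {B : Finset ι} {e : ι → EE' n} (H : DB u B e) (h : ι → ℝ) {i : ι} (hi : i ∈ B) :
    inner ℝ (u i) (xB e B h) = h i := by
  rw [xB, inner_sum, Finset.sum_eq_single i]
  · rw [inner_smul_right, H.one i hi i hi, if_pos rfl, mul_one]
  · intro j hj hji
    rw [inner_smul_right, H.one i hi j hj, if_neg hji.symm, mul_zero]
  · exact fun h => absurd hi h

theorem DB.uniq {u : ι → EE' n} {B : Finset ι} {e : ι → EE' n} (H : DB u B e) {h : ι → ℝ} {z : EE' n}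
    (hz : ∀ i ∈ B, inner ℝ (u i) z = h i) : z = xB e B h := by
  rw [← sub_eq_zero]
  refine H.sep _ fun j hj => ?_
  rw [inner_sub_right, H.inner_xB h hj, hz j hj, sub_self]

theorem DB.expand {u : ι → EE' n} {B : Finset ι} {e : ι → EE' n} (H : DB u B e) (w : EE' n) :
    w = ∑ j ∈ B, inner ℝ w (e j) • u j := by
  refine ext_inner_right ℝ fun z => ?_
  have hz := H.uniq (h := Uz u z) (z := z) (fun i _ => rfl)
  conv_lhs => rw [hz, xB, inner_sum]
  rw [sum_inner]
  refine Finset.sum_congr rfl fun j _ => ?_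
  rw [inner_smul_right, real_inner_smul_left, Uz, mul_comm]

theorem DB.card {u : ι → EE' n} {B : Finset ι} {e : ι → EE' n} (H : DB u B e) : B.card = n := by
  let f : EE' n →ₗ[ℝ] (B → ℝ) := LinearMap.pi fun j => (innerₛₗ ℝ (u j.1))
  have hf : ∀ z (j : B), f z j = inner ℝ (u j.1) z := fun z j => rfl
  have hb : Function.Bijective f := by
    constructor
    · rw [← LinearMap.ker_eq_bot, LinearMap.ker_eq_bot']
      intro z hz
      refine H.sep z fun j hj => ?_
      rw [← hf z ⟨j, hj⟩, hz]; rfl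
    · intro c
      refine ⟨xB e B (fun i => if h : i ∈ B then c ⟨i, h⟩ else 0), ?_⟩
      funext j
      rw [hf, H.inner_xB _ j.2, dif_pos j.2]
  have := (LinearEquiv.ofBijective f hb).finrank_eq
  simpa using this.symm

theorem exists_DB {u : ι → EE' n} {A : Finset ι} (hA : Sep u A) : ∃ B ⊆ A, ∃ e, DB u B e := by
  classical
  obtain ⟨B, hB, hmin⟩ := Finset.exists_min_image (A.powerset.filter fun B => Sep u B) Finset.card ⟨A, by simp [hA]⟩
  rw [Finset.mem_filter, Finset.mem_powerset] at hB
  refine ⟨B, hB.1, ?_⟩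
  have : ∀ j, ∃ z, j ∈ B → inner ℝ (u j) z = 1 ∧ ∀ i ∈ B, i ≠ j → inner ℝ (u i) z = 0 := by
    intro j
    by_cases hj : j ∈ B
    · have hns : ¬ Sep u (B.erase j) := by
        intro hs
        have := hmin (B.erase j) (by simp [hs, (Finset.erase_subset j B).trans hB.1])
        rw [Finset.card_erase_of_mem hj] at this
        have := Finset.card_pos.mpr ⟨j, hj⟩
        omega
      simp only [Sep, not_forall] at hns
      obtain ⟨z, hz, hz0⟩ := hns
      have hne : inner ℝ (u j) z ≠ 0 := by
        intro h0
        apply hz0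
        refine hB.2 z fun i hi => ?_
        by_cases hij : i = j
        · rw [hij, h0]
        · exact hz i (Finset.mem_erase.mpr ⟨hij, hi⟩)
      refine ⟨(inner ℝ (u j) z)⁻¹ • z, fun _ => ⟨?_, fun i hi hij => ?_⟩⟩
      · rw [inner_smul_right, inv_mul_cancel₀ hne]
      · rw [inner_smul_right, hz i (Finset.mem_erase.mpr ⟨hij, hi⟩), mul_zero]
    · exact ⟨0, fun h => absurd h hj⟩
  choose e he using this
  refine ⟨e, hB.2, fun i hi j hj => ?_⟩
  split_ifs with hij
  · subst hij; exact (he i hi).1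
  · exact (he j hj).2 i hi hij

theorem vert_step {u : ι → EE' n} (hu : PosSp u) {h : ι → ℝ} {x v : EE' n} (hx : x ∈ Pol u h) (hv : v ≠ 0)
    (hz : ∀ i ∈ act u h x, inner ℝ (u i) v = 0) : ∃ t : ℝ, 0 < t ∧ x + t • v ∈ Pol u h ∧
      ∃ i ∉ act u h x, i ∈ act u h (x + t • v) := by
  classical
  obtain ⟨c, c0, hc⟩ := hu v
  have hvv : 0 < inner ℝ v v := real_inner_self_pos.mpr hv
  obtain ⟨i0, hi0⟩ : ∃ i, 0 < inner ℝ (u i) v := by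
    by_contra hcon
    push Not at hcon
    nth_rw 1 [hc] at hvv
    rw [sum_inner] at hvv
    have : ∑ i, inner ℝ (c i • u i) v ≤ 0 := Finset.sum_nonpos fun i _ => by
      rw [real_inner_smul_left]; exact mul_nonpos_of_nonneg_of_nonpos (c0 i) (hcon i)
    linarith
  obtain ⟨i1, hi1, hmin⟩ := Finset.exists_min_image (Finset.univ.filter fun i => 0 < inner ℝ (u i) v)
    (fun i => (h i - inner ℝ (u i) x) / inner ℝ (u i) v) ⟨i0, by simp [hi0]⟩
  simp only [Finset.mem_filter, Finset.mem_univ, true_and] at hi1 hmin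
  have hna : i1 ∉ act u h x := fun h => by rw [hz i1 h] at hi1; exact lt_irrefl _ hi1
  have hlt : inner ℝ (u i1) x < h i1 := lt_of_le_of_ne (hx i1) fun h => hna (mem_act.mpr h)
  have ht : 0 < (h i1 - inner ℝ (u i1) x) / inner ℝ (u i1) v := div_pos (by linarith) hi1
  refine ⟨_, ht, fun i => ?_, i1, hna, mem_act.mpr ?_⟩
  · rw [inner_add_right, inner_smul_right]
    by_cases hi : 0 < inner ℝ (u i) v
    · have := hmin i hi
      rw [le_div_iff₀ hi] at this
      linarith
    · push Not at hi
      have := mul_nonpos_of_nonneg_of_nonpos ht.le hi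
      have := hx i
      linarith
  · rw [inner_add_right, inner_smul_right]
    field_simp; ring

theorem vert {u : ι → EE' n} (hu : PosSp u) {h : ι → ℝ} (w : EE' n) : ∀ (m : ℕ) (x : EE' n), 
    Fintype.card ι - (act u h x).card = m → x ∈ Pol u h → 
    (∀ y ∈ Pol u h, inner ℝ w y ≤ inner ℝ w x) → ∃ x' ∈ Pol u h, (∀ y ∈ Pol u h, inner ℝ w y ≤ inner ℝ w x') ∧
      act u h x ⊆ act u h x' ∧ Sep u (act u h x') := by
  intro m
  induction m using Nat.strong_induction_on with
  | _ m ih =>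
    intro x hm hx hmax
    by_cases hs : Sep u (act u h x)
    · exact ⟨x, hx, hmax, subset_rfl, hs⟩
    simp only [Sep, not_forall] at hs
    obtain ⟨v, hv, hv0⟩ := hs
    obtain ⟨t, ht, hP, i, hi, hi'⟩ := vert_step hu hx hv0 hv
    obtain ⟨t', ht', hP', -⟩ := vert_step hu hx (neg_ne_zero.mpr hv0) (fun i hi => by rw [inner_neg_right, hv i hi, neg_zero])
    have h1 := hmax _ hP
    have h2 := hmax _ hP'
    rw [inner_add_right, inner_smul_right] at h1 h2
    rw [inner_neg_right] at h2
    have hw : inner ℝ w v = 0 := by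
      apply le_antisymm
      · by_contra hc; push Not at hc; nlinarith [mul_pos ht hc]
      · by_contra hc; push Not at hc; nlinarith [mul_pos ht' (neg_pos.mpr hc)]
    have hsub : act u h x ⊆ act u h (x + t • v) := by
      intro j hj
      rw [mem_act, inner_add_right, inner_smul_right, hv j hj, mul_zero, add_zero]
      exact mem_act.mp hj
    have hcard : (act u h x).card < (act u h (x + t • v)).card := by
      apply Finset.card_lt_card
      rw [Finset.ssubset_iff_of_subset hsub]
      exact ⟨i, hi', hi⟩
    have hle : (act u h (x + t • v)).card ≤ Fintype.card ι := Finset.card_le_univ _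
    obtain ⟨x', a1, a2, a3, a4⟩ := ih _ (by omega) (x + t • v) rfl hP (fun y hy => by
      rw [inner_add_right, inner_smul_right, hw, mul_zero, add_zero]; exact hmax y hy)
    exact ⟨x', a1, a2, hsub.trans a3, a4⟩

theorem small_move (u : ι → EE' n) (h : ι → ℝ) (x z : EE' n) (J : Finset ι) (hJ : ∀ l ∉ J, inner ℝ (u l) x < h l) :
    ∃ t : ℝ, 0 < t ∧ ∀ l ∉ J, inner ℝ (u l) (x + t • z) < h l := by
  have : ∀ᶠ t : ℝ in nhdsWithin 0 (Ioi 0), ∀ l, l ∉ J → inner ℝ (u l) (x + t • z) < h l := by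
    rw [Filter.eventually_all]
    intro l
    by_cases hl : l ∈ J
    · simp [hl]
    · have hc : Continuous fun t : ℝ => inner ℝ (u l) (x + t • z) := by fun_prop
      have := (hc.tendsto 0).eventually_lt_const (by simpa using hJ l hl)
      filter_upwards [mem_nhdsWithin_of_mem_nhds this] with t ht _ using ht
  obtain ⟨t, ht, ht2⟩ := (this.and self_mem_nhdsWithin).exists
  exact ⟨t, ht2, ht⟩

theorem opt_nonneg {u : ι → EE' n} {B : Finset ι} {e : ι → EE' n} (H : DB u B e) {h : ι → ℝ}
    (hs : ∀ l ∉ B, inner ℝ (u l) (xB e B h) < h l) (w : EE' n) (hmax : ∀ y ∈ Pol u h, inner ℝ w y ≤ inner ℝ w (xB e B h))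
    (j : ι) (hj : j ∈ B) : 0 ≤ inner ℝ w (e j) := by
  by_contra hc
  push Not at hc
  obtain ⟨t, ht, hl⟩ := small_move u h (xB e B h) (-(e j)) B hs
  have := hmax (xB e B h + t • (-(e j))) (fun i => by
    by_cases hi : i ∈ B
    · rw [inner_add_right, inner_smul_right, inner_neg_right, H.inner_xB h hi, H.one i hi j hj]
      split_ifs <;> linarith
    · exact (hl i hi).le)
  rw [inner_add_right, inner_smul_right, inner_neg_right] at this
  nlinarith [mul_pos ht (neg_pos.mpr hc)]

open Classical in
noncomputable def du (u : ι → EE' n) (B : Finset ι) : ι → EE' n := if h : ∃ e, DB u B e then Classical.choose h else 0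

def IsB (u : ι → EE' n) (B : Finset ι) : Prop := DB u B (du u B)

theorem IsB.of {u : ι → EE' n} {B : Finset ι} (h : ∃ e, DB u B e) : IsB u B := by
  unfold IsB du
  rw [dif_pos h]
  exact Classical.choose_spec h

noncomputable def phi (u : ι → EE' n) (B : Finset ι) (l : ι) (h : ι → ℝ) : ℝ := inner ℝ (u l) (xB (du u B) B h) - h l

theorem xB_add (e : ι → EE' n) (B : Finset ι) (h h' : ι → ℝ) : xB e B (h + h') = xB e B h + xB e B h' := by
  simp [xB, add_smul, Finset.sum_add_distrib]
theorem xB_smul (e : ι → EE' n) (B : Finset ι) (c : ℝ) (h : ι → ℝ) : xB e B (c • h) = c • xB e B h := by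
  simp [xB, mul_smul, Finset.smul_sum]
theorem phi_add (u : ι → EE' n) (B : Finset ι) (l : ι) (h h' : ι → ℝ) : phi u B l (h + h') = phi u B l h + phi u B l h' := by
  simp only [phi, xB_add, inner_add_right, Pi.add_apply]; ring
theorem phi_smul (u : ι → EE' n) (B : Finset ι) (l : ι) (c : ℝ) (h : ι → ℝ) : phi u B l (c • h) = c * phi u B l h := by
  simp only [phi, xB_smul, inner_smul_right, Pi.smul_apply, smul_eq_mul]; ring
theorem phi_cont (u : ι → EE' n) (B : Finset ι) (l : ι) : Continuous (phi u B l) := by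
  unfold phi xB
  fun_prop

def S0 (u : ι → EE' n) (h0 : ι → ℝ) (B : Finset ι) : Prop := IsB u B ∧ xB (du u B) B h0 ∈ Pol u h0
def Gam (u : ι → EE' n) (h0 : ι → ℝ) : Set (ι → ℝ) := {h | ∀ B, S0 u h0 B → ∀ l ∉ B, phi u B l h < 0}
def FF (u : ι → EE' n) (h0 : ι → ℝ) (J : Finset ι) : Prop := ∃ B, S0 u h0 B ∧ J ⊆ B

theorem Gam_h0 {u : ι → EE' n} {h0 : ι → ℝ} (hg : ∀ B, IsB u B → ∀ l ∉ B, phi u B l h0 ≠ 0) : h0 ∈ Gam u h0 := by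
  intro B hB l hl
  refine lt_of_le_of_ne ?_ (hg B hB.1 l hl)
  rw [phi, sub_nonpos]
  exact hB.2 l

theorem S0_of {u : ι → EE' n} {h0 : ι → ℝ} (hg : ∀ B, IsB u B → ∀ l ∉ B, phi u B l h0 ≠ 0) {x : EE' n} (hx : x ∈ Pol u h0)
    (hs : Sep u (act u h0 x)) : ∃ B, S0 u h0 B ∧ x = xB (du u B) B h0 := by
  obtain ⟨B, hB, hB2⟩ := exists_DB hs
  have hB3 := IsB.of hB2
  have := hB3.uniq (h := h0) (z := x) (fun i hi => mem_act.mp (hB hi))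
  exact ⟨B, ⟨hB3, this ▸ hx⟩, this⟩

theorem geo_of_generic {u : ι → EE' n} (hu : PosSp u) {h0 : ι → ℝ} (hne : (Pol u h0).Nonempty)
    (hg : ∀ B, IsB u B → ∀ l ∉ B, phi u B l h0 ≠ 0) : Geo u (Gam u h0) (FF u h0) ∧ FF u h0 ∅ := by
  have hstrict : ∀ h ∈ Gam u h0, ∀ B, S0 u h0 B → ∀ l ∉ B, inner ℝ (u l) (xB (du u B) B h) < h l := by
    intro h hh B hB l hl
    have := hh B hB l hl
    rw [phi, sub_neg] at this
    exact this
  have hmem : ∀ h ∈ Gam u h0, ∀ B, S0 u h0 B → xB (du u B) B h ∈ Pol u h := by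
    intro h hh B hB i
    by_cases hi : i ∈ B
    · exact (hB.1.inner_xB h hi).le
    · exact (hstrict h hh B hB i hi).le
  -- optimal bases
  have opt : ∀ w : EE' n, ∃ B, S0 u h0 B ∧ ∀ j ∈ B, 0 ≤ inner ℝ w (du u B j) := by
    intro w
    have hcont : ContinuousOn (fun y : EE' n => (inner ℝ w y : ℝ)) (Pol u h0) := by fun_prop
    obtain ⟨x, hx, hmax⟩ := (hu.cpt h0).exists_isMaxOn hne hcont
    obtain ⟨x', a1, a2, a3, a4⟩ := vert hu w _ x rfl hx (fun y hy => hmax hy)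
    obtain ⟨B, hB, rfl⟩ := S0_of hg a1 a4
    exact ⟨B, hB, opt_nonneg hB.1 (hstrict h0 (Gam_h0 hg) B hB) w a2⟩
  refine ⟨⟨?_, ⟨h0, Gam_h0 hg⟩, ?_, ?_, ?_, hu.bdd, ?_, ?_, ?_, ?_⟩, ?_⟩
  · have : Gam u h0 = ⋂ B, ⋂ (_ : S0 u h0 B), ⋂ l, ⋂ (_ : l ∉ B), {h | phi u B l h < 0} := by
      ext h; simp [Gam]
    rw [this]
    exact isOpen_iInter_of_finite fun B => isOpen_iInter_of_finite fun _ => isOpen_iInter_of_finite fun l =>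
      isOpen_iInter_of_finite fun _ => isOpen_lt (phi_cont u B l) continuous_const
  · intro h hh h' hh' B hB l hl
    rw [phi_add]
    linarith [hh B hB l hl, hh' B hB l hl]
  · intro h hh c hc B hB l hl
    rw [phi_smul]
    exact mul_neg_of_pos_of_neg hc (hh B hB l hl)
  · intro h hh z B hB l hl
    rw [phi_add]
    have : phi u B l (Uz u z) = 0 := by
      rw [phi, ← hB.1.uniq (h := Uz u z) (z := z) (fun i _ => rfl), Uz, sub_self]
    rw [this, add_zero]
    exact hh B hB l hl
  · intro J hJ h hh x hx
    by_contra hc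
    push Not at hc
    apply hJ
    obtain ⟨x', a1, -, a3, a4⟩ := vert hu 0 _ x rfl hx (fun y _ => by simp)
    set w := ∑ i ∈ act u h x', u i with hw
    obtain ⟨B, hB, hB2⟩ := opt w
    have hwx : ∀ y ∈ Pol u h, inner ℝ w y ≤ inner ℝ w (xB (du u B) B h) := by
      intro y hy
      rw [hB.1.expand w, sum_inner, sum_inner]
      refine Finset.sum_le_sum fun j hj => ?_
      rw [real_inner_smul_left, real_inner_smul_left, hB.1.inner_xB h hj]
      exact mul_le_mul_of_nonneg_left (hy j) (hB2 j hj)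
    have hx2 := hwx x' a1
    rw [hw, sum_inner, sum_inner] at hx2
    have hall : ∀ i ∈ act u h x', inner ℝ (u i) (xB (du u B) B h) = inner ℝ (u i) x' := by
      refine (Finset.sum_eq_sum_iff_of_le fun i hi => ?_).mp (le_antisymm (Finset.sum_le_sum fun i hi => ?_) hx2)
      · rw [mem_act.mp hi]; exact hmem h hh B hB i
      · rw [mem_act.mp hi]; exact hmem h hh B hB i
    refine ⟨B, hB, fun j hj => ?_⟩
    have hj' : j ∈ act u h x' := a3 (mem_act.mpr (le_antisymm (hx j) (hc j hj)))
    by_contra hjB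
    have h1 := hstrict h hh B hB j hjB
    rw [hall j hj', mem_act.mp hj'] at h1
    exact lt_irrefl _ h1
  · rintro J ⟨B, hB, hJ⟩ h hh
    obtain ⟨t, ht, hl⟩ := small_move u h (xB (du u B) B h) (xB (du u B) B (fun i => if i ∈ J then 0 else -1)) B (hstrict h hh B hB)
    refine ⟨xB (du u B) B h + t • (xB (du u B) B (fun i => if i ∈ J then 0 else -1)), fun j hj => ?_, fun i hi => ?_⟩
    · rw [inner_add_right, inner_smul_right, hB.1.inner_xB h (hJ hj), hB.1.inner_xB _ (hJ hj), if_pos hj, mul_zero, add_zero]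
    · by_cases hiB : i ∈ B
      · rw [inner_add_right, inner_smul_right, hB.1.inner_xB h hiB, hB.1.inner_xB _ hiB, if_neg hi]
        linarith
      · exact hl i hiB
  · rintro J ⟨B, hB, hJ⟩ c
    exact ⟨xB (du u B) B c, fun j hj => hB.1.inner_xB c (hJ hj)⟩
  · rintro J ⟨B, hB, hJ⟩
    have := Finset.card_le_card hJ
    rwa [hB.1.card] at this
  · obtain ⟨B, hB, -⟩ := opt 0
    exact ⟨B, hB, Finset.empty_subset _⟩

end poly
end AFS
end PartS

section PartT
namespace AFS

open MeasureTheory Set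
open scoped ENNReal Pointwise

section perturb
variable {ι : Type} [Fintype ι] [DecidableEq ι] {n : ℕ} {σ : Type} [Fintype σ]

noncomputable def phiL (u : ι → EE' n) (B : Finset ι) (l : ι) : (ι → ℝ) →ₗ[ℝ] ℝ where
  toFun := phi u B l
  map_add' := phi_add u B l
  map_smul' := fun c h => by rw [phi_smul]; rfl

theorem generic_v (u : ι → EE' n) : ∃ v : ι → ℝ, ∀ B, IsB u B → ∀ l ∉ B, phi u B l v ≠ 0 := by
  classical
  obtain ⟨v, hv⟩ := Module.Dual.exists_forall_ne_zero_of_forall_exists (K := ℝ) (M := ι → ℝ)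
    (ι := {x : Finset ι × ι // x.2 ∉ x.1}) (fun x => phiL u x.1.1 x.1.2) (fun x => ⟨Pi.single x.1.2 1, by
      have : xB (du u x.1.1) x.1.1 (Pi.single x.1.2 1) = 0 := by
        rw [xB]
        refine Finset.sum_eq_zero fun j hj => ?_
        rw [Pi.single_eq_of_ne, zero_smul]
        rintro rfl
        exact x.2 hj
      show phi u x.1.1 x.1.2 _ ≠ 0
      rw [phi, this]
      simp⟩)
  exact ⟨v, fun B _ l hl => hv ⟨(B, l), hl⟩⟩

theorem perturb {u : ι → EE' n} (hu : PosSp u) (hz : σ → ι → ℝ)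
    (hsum : ∀ x ∈ Pol u (∑ s, hz s), ∃ y : σ → EE' n, (∀ s, y s ∈ Pol u (hz s)) ∧ x = ∑ s, y s)
    (zz : EE' n) (hzz : ∀ i, inner ℝ (u i) zz < (∑ s, hz s) i) :
    ∃ Γ Fc, Geo u Γ Fc ∧ Fc ∅ ∧ ∃ h0 ∈ Γ, (∀ i, 0 < h0 i) ∧ ∀ s (η : ℝ), 0 < η → hz s + η • h0 ∈ Γ := by
  classical
  obtain ⟨v, hv⟩ := generic_v u
  set H := ∑ s, hz s with hH
  -- choose t
  have ev : ∀ᶠ t in nhdsWithin (0 : ℝ) (Ioi 0), (∀ i, inner ℝ (u i) zz < (H + t • v) i) ∧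
      ∀ B : Finset ι, ∀ l : ι, phi u B l v ≠ 0 → phi u B l (H + t • v) ≠ 0 ∧ (0 < phi u B l H → 0 < phi u B l (H + t • v)) := by
    refine Filter.Eventually.and ?_ ?_
    · refine Filter.eventually_all.mpr fun i => ?_
      refine Filter.Eventually.filter_mono nhdsWithin_le_nhds ?_
      have hc : Continuous fun t : ℝ => (H + t • v) i := by fun_prop
      exact (hc.tendsto' 0 (H i) (by simp)).eventually_const_lt (hzz i)
    · refine Filter.eventually_all.mpr fun B => Filter.eventually_all.mpr fun l => ?_
      have hc : Continuous fun t : ℝ => phi u B l (H + t • v) := (phi_cont u B l).comp (by fun_prop)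
      by_cases h0 : phi u B l H = 0
      · filter_upwards [self_mem_nhdsWithin] with t ht hv
        rw [phi_add, phi_smul, h0, zero_add]
        exact ⟨mul_ne_zero (ne_of_gt ht) hv, fun h => absurd h (lt_irrefl _)⟩
      · refine Filter.Eventually.filter_mono nhdsWithin_le_nhds ?_
        have ht := hc.tendsto' 0 (phi u B l H) (by simp)
        rcases lt_or_gt_of_ne h0 with h | h
        · filter_upwards [ht.eventually_lt_const h] with t h1 _
          exact ⟨h1.ne, fun h2 => absurd h (not_lt.mpr h2.le)⟩
        · filter_upwards [ht.eventually_const_lt h] with t h1 _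
          exact ⟨h1.ne', fun _ => h1⟩
  obtain ⟨t, ht1, ht2⟩ := ev.exists
  set h1 := H + t • v with hh1
  have hg : ∀ B, IsB u B → ∀ l ∉ B, phi u B l h1 ≠ 0 := fun B hB l hl => (ht2 B l (hv B hB l hl)).1
  obtain ⟨G, hF⟩ := geo_of_generic hu ⟨zz, fun i => (ht1 i).le⟩ hg
  have hΓ1 : h1 ∈ Gam u h1 := Gam_h0 hg
  have key : ∀ s, ∀ B, S0 u h1 B → ∀ l ∉ B, phi u B l (hz s) ≤ 0 := by
    intro s B hB l hl
    have hx : xB (du u B) B H ∈ Pol u H := by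
      intro i
      by_cases hi : i ∈ B
      · exact (hB.1.inner_xB H hi).le
      · by_contra hc
        push Not at hc
        have h2 : 0 < phi u B i H := by rw [phi]; linarith
        have h3 := (ht2 B i (hv B hB.1 i hi)).2 h2
        exact absurd (hΓ1 B hB i hi) (not_lt.mpr h3.le)
    obtain ⟨y, hy, hxy⟩ := hsum _ hx
    have heq : ∀ i ∈ B, ∀ s, inner ℝ (u i) (y s) = hz s i := by
      intro i hi
      have e1 := hB.1.inner_xB H hi
      rw [hxy, inner_sum, hH, Finset.sum_apply] at e1
      have := (Finset.sum_eq_sum_iff_of_le (fun s _ => hy s i)).mp e1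
      exact fun s => this s (Finset.mem_univ s)
    have := hB.1.uniq (h := hz s) (z := y s) (fun i hi => heq i hi s)
    rw [phi, ← this, sub_nonpos]
    exact hy s l
  obtain ⟨z, -, hzl⟩ := G.face ∅ hF h1 hΓ1
  have hΓ2 := G.transl _ hΓ1 (-z)
  refine ⟨_, _, G, hF, h1 + Uz u (-z), hΓ2, fun i => ?_, fun s η hη B hB l hl => ?_⟩
  · have := hzl i (by simp)
    simp only [Pi.add_apply, Uz, inner_neg_right]
    linarith
  · rw [phi_add, phi_smul]
    have a := key s B hB l hl
    have b := mul_neg_of_pos_of_neg hη (hΓ2 B hB l hl)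
    linarith

end perturb

section polsum
variable {n : ℕ} {σ : Type}

/-- support function of a finite set -/
noncomputable def supF (F : Finset (EE' n)) (w : EE' n) : ℝ := sSup ((fun x => (inner ℝ w x : ℝ)) '' (F : Set (EE' n)))

theorem le_supF {F : Finset (EE' n)} {w x : EE' n} (hx : x ∈ F) : inner ℝ w x ≤ supF F w :=
  le_csSup (F.finite_toSet.image _).bddAbove ⟨x, hx, rfl⟩

theorem supF_le {F : Finset (EE' n)} {w : EE' n} {C : ℝ} (hF : F.Nonempty) (h : ∀ x ∈ F, inner ℝ w x ≤ C) : supF F w ≤ C := by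
  refine csSup_le (hF.to_set.image _) ?_
  rintro _ ⟨x, hx, rfl⟩
  exact h x hx

theorem hull_supF {F : Finset (EE' n)} {w x : EE' n} (hx : x ∈ convexHull ℝ (F : Set (EE' n))) : inner ℝ w x ≤ supF F w := by
  have : convexHull ℝ (F : Set (EE' n)) ⊆ {x | inner ℝ w x ≤ supF F w} := by
    refine convexHull_min (fun y hy => le_supF hy) ?_
    exact convex_halfSpace_le (f := fun x : EE' n => (inner ℝ w x : ℝ)) ⟨fun x y => inner_add_right _ _ _, fun c x => by simp [inner_smul_right]⟩ _
  exact this hx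

theorem hull_supF_lt {F : Finset (EE' n)} {w x : EE' n} (hw : w ≠ 0) (hx : x ∈ interior (convexHull ℝ (F : Set (EE' n)))) :
    inner ℝ w x < supF F w := by
  have hc : Continuous fun t : ℝ => x + t • w := by fun_prop
  have h1 := (hc.tendsto' 0 x (by simp)).eventually (isOpen_interior.mem_nhds hx)
  obtain ⟨t, ht, ht0⟩ := ((h1.filter_mono nhdsWithin_le_nhds).and (self_mem_nhdsWithin (s := Ioi (0:ℝ)))).exists
  have := hull_supF (w := w) (interior_subset ht)
  rw [inner_add_right, inner_smul_right] at this
  have h2 : 0 < t * inner ℝ w w := mul_pos ht0 (real_inner_self_pos.mpr hw)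
  linarith

def CC (S : Set (EE' n)) : Prop := Convex ℝ S ∧ IsCompact S

theorem CC.msum {Q : σ → Set (EE' n)} (hQ : ∀ s, CC (Q s)) (m : Multiset σ) : CC (m.map Q).sum := by
  induction m using Multiset.induction_on with
  | empty => 
    simp only [Multiset.map_zero, Multiset.sum_zero]
    exact ⟨convex_singleton _, isCompact_singleton⟩
  | cons a m ih =>
    rw [Multiset.map_cons, Multiset.sum_cons]
    exact ⟨(hQ a).1.add ih.1, (hQ a).2.add ih.2⟩

theorem CC.hull (F : Finset (EE' n)) : CC (convexHull ℝ (F : Set (EE' n))) :=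
  ⟨convex_convexHull _ _, F.finite_toSet.isCompact_convexHull ℝ⟩

theorem polsum (hn : 1 ≤ n) (D : Finset (EE' n)) (hD : ∀ w, (∀ d ∈ D, inner ℝ d w = 0) → w = 0)
    (F : σ → Finset (EE' n)) (hF : ∀ s, (F s).Nonempty) (hFD : ∀ s, ∀ x ∈ F s, ∀ y ∈ F s, x - y ∈ D) (m : Multiset σ) :
    Pol (ray hn D) (m.map fun s i => supF (F s) (ray hn D i)).sum = (m.map fun s => convexHull ℝ (F s : Set (EE' n))).sum := by
  apply Subset.antisymm
  · intro x hx
    by_contra hxn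
    have hcc := CC.msum (fun s => CC.hull (F s)) m
    obtain ⟨f, c, hf1, hf2⟩ := geometric_hahn_banach_closed_point hcc.1 hcc.2.isClosed hxn
    set w := (InnerProductSpace.toDual ℝ (EE' n)).symm f with hw
    have hfw : ∀ y, f y = inner ℝ w y := fun y => by rw [hw, InnerProductSpace.toDual_symm_apply]
    obtain ⟨a, a0, a1, a2⟩ := cone_main hn D hD _ w rfl
    have key : ∀ m : Multiset σ, ∃ y ∈ (m.map fun s => convexHull ℝ (F s : Set (EE' n))).sum,
        inner ℝ w y = ∑ i, a i * (m.map fun s i => supF (F s) (ray hn D i)).sum i := by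
      intro m
      induction m using Multiset.induction_on with
      | empty => exact ⟨0, by simp, by simp⟩
      | cons s m ih =>
        obtain ⟨y, hy, hy2⟩ := ih
        obtain ⟨z, hz, hz2⟩ := Finset.exists_max_image (F s) (fun x => (inner ℝ w x : ℝ)) (hF s)
        refine ⟨z + y, ?_, ?_⟩
        · rw [Multiset.map_cons, Multiset.sum_cons]
          exact Set.add_mem_add (subset_convexHull ℝ _ hz) hy
        · rw [Multiset.map_cons, Multiset.sum_cons, inner_add_right, hy2]
          have : inner ℝ w z = ∑ i, a i * supF (F s) (ray hn D i) := by
            conv_lhs => rw [a2, sum_inner]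
            refine Finset.sum_congr rfl fun i _ => ?_
            rw [real_inner_smul_left]
            by_cases hi : a i = 0
            · simp [hi]
            · congr 1
              refine le_antisymm (le_supF hz) (supF_le (hF s) fun x hx => ?_)
              have h1 := (a1 i hi _ (hFD s x hx z hz)).2 (by
                have := hz2 x hx
                rw [real_inner_comm, inner_sub_right]; linarith)
              rw [real_inner_comm, inner_sub_right] at h1
              linarith
          rw [this, ← Finset.sum_add_distrib]
          refine Finset.sum_congr rfl fun i _ => ?_
          rw [Pi.add_apply, mul_add]
    obtain ⟨y, hy, hy2⟩ := key m
    have h1 := hf1 y hy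
    rw [hfw, hy2] at h1
    rw [hfw, a2] at hf2
    have := Pol_cone hx a a0
    linarith
  · induction m using Multiset.induction_on with
    | empty => simp [Pol]
    | cons s m ih =>
      rw [Multiset.map_cons, Multiset.sum_cons, Multiset.map_cons, Multiset.sum_cons]
      rintro _ ⟨y, hy, z, hz, rfl⟩ i
      rw [inner_add_right, Pi.add_apply]
      exact add_le_add (hull_supF hy) (ih hz i)

theorem struct_thm [Fintype σ] (hn : 1 ≤ n) (F : σ → Finset (EE' n)) (hne : Nonempty σ)
    (hF : ∀ s, (interior (convexHull ℝ (F s : Set (EE' n)))).Nonempty) :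
    ∃ (ι : Type) (_ : Fintype ι) (_ : DecidableEq ι) (u : ι → EE' n) (Γ : Set (ι → ℝ)) (Fc : Finset ι → Prop), Geo u Γ Fc ∧ Fc ∅ ∧
      ∃ hz : σ → ι → ℝ, ∃ h0 : ι → ℝ, (∀ i, 0 < h0 i) ∧ (∀ s (η : ℝ), 0 < η → hz s + η • h0 ∈ Γ) ∧
        ∀ m : Multiset σ, Pol u (m.map hz).sum = (m.map fun s => convexHull ℝ (F s : Set (EE' n))).sum := by
  classical
  have hFn : ∀ s, (F s).Nonempty := fun s => by
    obtain ⟨x, hx⟩ := hF s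
    have := convexHull_nonempty_iff.mp ⟨x, interior_subset hx⟩
    exact_mod_cast this
  set b := EuclideanSpace.basisFun (Fin n) ℝ with hb
  set D : Finset (EE' n) := Finset.univ.image (fun i => b i) ∪ Finset.univ.biUnion fun s => ((F s) ×ˢ (F s)).image fun x => x.1 - x.2 with hDdef
  have hD : ∀ w, (∀ d ∈ D, inner ℝ d w = 0) → w = 0 := by
    intro w hw
    rw [← b.sum_repr' w]
    refine Finset.sum_eq_zero fun i _ => ?_
    rw [hw (b i) (by simp [hDdef]), zero_smul]
  have hFD : ∀ s, ∀ x ∈ F s, ∀ y ∈ F s, x - y ∈ D := by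
    intro s x hx y hy
    rw [hDdef]
    refine Finset.mem_union_right _ (Finset.mem_biUnion.mpr ⟨s, Finset.mem_univ s, Finset.mem_image.mpr ⟨(x, y), by simp [hx, hy], rfl⟩⟩)
  have hps := polsum hn D hD F hFn hFD
  have hu : PosSp (ray hn D) := fun w => by
    obtain ⟨a, a0, -, a2⟩ := cone_main hn D hD _ w rfl
    exact ⟨a, a0, a2⟩
  choose z hz using hF
  obtain ⟨Γ, Fc, G, hFc, h0, -, h2, h3⟩ := perturb hu (fun s i => supF (F s) (ray hn D i)) (by
    intro x hx
    have h1 := hps (Finset.univ.val)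
    have h2 : x ∈ ∑ s : σ, convexHull ℝ (F s : Set (EE' n)) := by
      rw [Finset.sum, ← h1]; exact hx
    obtain ⟨y, hy, hy2⟩ := (Set.mem_finsetSum _ _ _).mp h2
    exact ⟨y, fun s i => hull_supF (hy (Finset.mem_univ s)), hy2.symm⟩) (∑ s, z s) (by
    intro i
    rw [inner_sum, Finset.sum_apply]
    exact Finset.sum_lt_sum_of_nonempty Finset.univ_nonempty fun s _ => hull_supF_lt (ray_ne hn D i) (hz s))
  exact ⟨RI D, inferInstance, inferInstance, ray hn D, Γ, Fc, G, hFc, _, h0, h2, h3, hps⟩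

end polsum
end AFS
end PartT

section PartU
namespace AFS

open MeasureTheory Set
open scoped ENNReal Pointwise

section approx
variable {n : ℕ} {σ : Type}

theorem poly_approx {K : Set (EE' n)} (hK : CC K) {ε : ℝ} (hε : 0 < ε) : ∃ F : Finset (EE' n),
    K ⊆ interior (convexHull ℝ (F : Set (EE' n))) ∧ convexHull ℝ (F : Set (EE' n)) ⊆ Metric.cthickening ε K := by
  classical
  have h : ∀ x : EE' n, ∃ F : Finset (EE' n), x ∈ interior (convexHull ℝ (F : Set (EE' n))) ∧
      convexHull ℝ (F : Set (EE' n)) ⊆ Metric.closedBall x ε := by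
    intro x
    obtain ⟨b, hb1, hb2⟩ := exists_mem_interior_convexHull_affineBasis (Metric.closedBall_mem_nhds x hε)
    refine ⟨Finset.univ.image b, ?_, ?_⟩
    · simpa using hb1
    · simpa using hb2
  choose F hF1 hF2 using h
  obtain ⟨t, ht, hK2⟩ := hK.2.elim_nhds_subcover (fun x => interior (convexHull ℝ (F x : Set (EE' n))))
    (fun x _ => isOpen_interior.mem_nhds (hF1 x))
  refine ⟨t.biUnion F, fun x hx => ?_, ?_⟩
  · obtain ⟨y, hy, hxy⟩ := mem_iUnion₂.mp (hK2 hx)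
    refine interior_mono (convexHull_mono ?_) hxy
    exact_mod_cast Finset.subset_biUnion_of_mem F hy
  · refine convexHull_min ?_ (hK.1.cthickening ε)
    intro x hx
    rw [Finset.mem_coe, Finset.mem_biUnion] at hx
    obtain ⟨y, hy, hxy⟩ := hx
    have := hF2 y (subset_convexHull ℝ _ hxy)
    exact Metric.mem_cthickening_of_dist_le x y ε K (ht y hy) (Metric.mem_closedBall.mp this)

theorem msum_mono {K Q : σ → Set (EE' n)} (h : ∀ s, K s ⊆ Q s) (m : Multiset σ) : (m.map K).sum ⊆ (m.map Q).sum := by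
  induction m using Multiset.induction_on with
  | empty => simp
  | cons a m ih =>
    simp only [Multiset.map_cons, Multiset.sum_cons]
    exact Set.add_subset_add (h a) ih

theorem msum_thick {K Q : σ → Set (EE' n)} (hK : ∀ s, CC (K s)) {ε : ℝ} (hε : 0 ≤ ε) (h : ∀ s, Q s ⊆ Metric.cthickening ε (K s))
    (m : Multiset σ) : (m.map Q).sum ⊆ Metric.cthickening (m.card * ε) (m.map K).sum := by
  induction m using Multiset.induction_on with
  | empty => simp
  | cons a m ih =>
    simp only [Multiset.map_cons, Multiset.sum_cons, Multiset.card_cons]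
    refine (Set.add_subset_add (h a) ih).trans ?_
    have hm := CC.msum hK m
    have h0 : (0:ℝ) ≤ m.card * ε := by positivity
    rw [← (hK a).2.add_closedBall_zero hε, ← hm.2.add_closedBall_zero h0,
      ← ((hK a).2.add hm.2).add_closedBall_zero (by positivity), add_add_add_comm,
      closedBall_add_closedBall hε h0]
    refine Set.add_subset_add_left ?_
    rw [add_zero]
    exact Metric.closedBall_subset_closedBall (by push_cast; linarith)

theorem gv_right {ι : Type} [Fintype ι] [DecidableEq ι] {u : ι → EE' n} (hb : ∀ h, Bornology.IsBounded (Pol u h)) (a h0 : ι → ℝ)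
    (h0p : ∀ i, 0 < h0 i) : Filter.Tendsto (fun k : ℕ => gv u (a + (1 / ((k:ℝ) + 1)) • h0)) Filter.atTop (nhds (gv u a)) := by
  have hanti : Antitone fun k : ℕ => Pol u (a + (1 / ((k:ℝ) + 1)) • h0) := by
    intro k l hkl x hx i
    refine (hx i).trans ?_
    simp only [Pi.add_apply, Pi.smul_apply, smul_eq_mul]
    have := mul_le_mul_of_nonneg_right (Nat.one_div_le_one_div (α := ℝ) hkl) (h0p i).le
    linarith
  have h1 := tendsto_measure_iInter_atTop (μ := volume) (fun k => (Pol_closed u _).measurableSet.nullMeasurableSet) hanti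
    ⟨0, (hb _).measure_lt_top.ne⟩
  have h2 : ⋂ k : ℕ, Pol u (a + (1 / ((k:ℝ) + 1)) • h0) = Pol u a := by
    ext x
    rw [mem_iInter]
    constructor
    · intro h i
      have hl : Filter.Tendsto (fun k : ℕ => (a + (1 / ((k:ℝ) + 1)) • h0) i) Filter.atTop (nhds (a i)) := by
        have := (tendsto_one_div_add_atTop_nhds_zero_nat (𝕜 := ℝ)).mul_const (h0 i)
        simpa using this.const_add (a i)
      exact ge_of_tendsto' hl fun k => h k i
    · intro h k i
      refine (h i).trans ?_
      simp only [Pi.add_apply, Pi.smul_apply, smul_eq_mul]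
      have : 0 < 1 / ((k:ℝ) + 1) * h0 i := mul_pos (by positivity) (h0p i)
      linarith
  rw [h2] at h1
  exact (ENNReal.tendsto_toReal (hb a).measure_lt_top.ne).comp h1

theorem vol_thick {K : Set (EE' n)} (hK : IsCompact K) : 
    Filter.Tendsto (fun r => volume.real (Metric.cthickening r K)) (nhds 0) (nhds (volume.real K)) :=
  (ENNReal.tendsto_toReal hK.measure_lt_top.ne).comp (tendsto_measure_cthickening_of_isCompact hK)

theorem msum_add_smul {ι : Type} (hz : σ → ι → ℝ) (c : ℝ) (h0 : ι → ℝ) (m : Multiset σ) :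
    (m.map fun s => hz s + c • h0).sum = (m.map hz).sum + c • ((m.card : ℝ) • h0) := by
  induction m using Multiset.induction_on with
  | empty => simp
  | cons a m ih =>
    simp only [Multiset.map_cons, Multiset.sum_cons, Multiset.card_cons, ih]
    ext i
    simp only [Pi.add_apply, Pi.smul_apply, smul_eq_mul]
    push_cast
    ring

theorem geo_approx [Fintype σ] (hn : 1 ≤ n) (hne : Nonempty σ) (K : σ → Set (EE' n)) (hK : ∀ s, CC (K s)) (hKn : ∀ s, (K s).Nonempty)
    (T : Finset (Multiset σ)) (hT : 0 ∉ T) (δ : ℝ) (hδ : 0 < δ) :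
    ∃ (ι : Type) (_ : Fintype ι) (_ : DecidableEq ι) (u : ι → EE' n) (Γ : Set (ι → ℝ)) (Fc : Finset ι → Prop), Geo u Γ Fc ∧ Fc ∅ ∧
      ∃ h : σ → ι → ℝ, (∀ s, h s ∈ Γ) ∧ ∀ m ∈ T, |gv u (m.map h).sum - volume.real (m.map K).sum| ≤ δ := by
  have e1 : ∀ᶠ ε in nhdsWithin (0:ℝ) (Ioi 0), ∀ m ∈ T, volume.real (Metric.cthickening (m.card * ε) (m.map K).sum) < volume.real (m.map K).sum + δ / 2 := by
    refine (Filter.eventually_all_finset T).mpr fun m _ => ?_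
    refine Filter.Eventually.filter_mono nhdsWithin_le_nhds ?_
    have hc : Continuous fun ε : ℝ => (m.card : ℝ) * ε := by fun_prop
    have := (vol_thick (CC.msum hK m).2).comp (hc.tendsto' 0 0 (by simp))
    exact this.eventually_lt_const (by linarith)
  obtain ⟨ε, hε, hε0⟩ := (e1.and self_mem_nhdsWithin).exists
  choose F hF1 hF2 using fun s => poly_approx (hK s) (ε := ε) hε0
  obtain ⟨ι, i1, i2, u, Γ, Fc, G, hFc, hz, h0, h0p, hmem, hpol⟩ := struct_thm hn F hne (fun s => (hKn s).mono (hF1 s))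
  have e2 : ∀ᶠ k : ℕ in Filter.atTop, ∀ m ∈ T, gv u ((m.map hz).sum + (1 / ((k:ℝ) + 1)) • ((m.card : ℝ) • h0)) < gv u (m.map hz).sum + δ / 2 := by
    refine (Filter.eventually_all_finset T).mpr fun m hm => ?_
    refine (gv_right G.bdd _ _ fun i => ?_).eventually_lt_const (by linarith)
    have : 0 < m.card := Multiset.card_pos.mpr fun h => hT (h ▸ hm)
    exact mul_pos (by exact_mod_cast this) (h0p i)
  obtain ⟨k, hk⟩ := e2.exists
  refine ⟨ι, i1, i2, u, Γ, Fc, G, hFc, fun s => hz s + (1 / ((k:ℝ) + 1)) • h0, fun s => hmem s _ (by positivity), fun m hm => ?_⟩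
  rw [msum_add_smul]
  have a1 := hk m hm
  have a2 := hε m hm
  have a3 : gv u (m.map hz).sum ≤ volume.real (Metric.cthickening (m.card * ε) (m.map K).sum) := by
    rw [gv, hpol]
    exact measureReal_mono (msum_thick hK (le_of_lt hε0) hF2 m) (CC.msum hK m).2.isBounded.cthickening.measure_lt_top.ne
  have a4 : volume.real (m.map K).sum ≤ gv u ((m.map hz).sum + (1 / ((k:ℝ) + 1)) • ((m.card : ℝ) • h0)) := by
    refine le_trans ?_ (gv_mono u G.bdd (h := (m.map hz).sum) ?_)
    · rw [gv, hpol]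
      exact measureReal_mono (msum_mono (fun s => (hF1 s).trans interior_subset) m) (CC.msum (fun s => CC.hull (F s)) m).2.measure_lt_top.ne
    · intro i
      simp only [Pi.add_apply, Pi.smul_apply, smul_eq_mul]
      have := (h0p i).le
      have : 0 ≤ 1 / ((k:ℝ) + 1) * (m.card * h0 i) := by positivity
      linarith
  rw [abs_le]
  constructor <;> linarith

end approx
end AFS
end PartU

section PartV
open MeasureTheory
open scoped Pointwise

namespace AFS

open MvPolynomial

section homog

theorem esymmZ_hom (e : ℕ) (k : ℤ) (hk : 0 ≤ k) : (ConvexPaper.esymmZ e k).IsHomogeneous k.toNat := by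
  rw [ConvexPaper.esymmZ, if_pos hk, MvPolynomial.esymm]
  refine IsHomogeneous.sum _ _ _ fun s hs => ?_
  have h1 := IsHomogeneous.prod s (fun i => (X i : MvPolynomial (Fin e) ℝ)) (fun _ => 1) fun i _ => isHomogeneous_X ℝ i
  rw [Finset.mem_powersetCard] at hs
  simpa [hs.2] using h1

theorem schur_hom (e N : ℕ) (lam : Fin N → ℕ) : (ConvexPaper.schur e N lam).IsHomogeneous (∑ j, lam j) := by
  rw [ConvexPaper.schur, Matrix.det_apply]
  refine IsHomogeneous.sum _ _ _ fun τ _ => ?_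
  have key : (∏ i, Matrix.of (fun i j : Fin N => ConvexPaper.esymmZ e ((lam i : ℤ) - ((i : ℕ) : ℤ) + ((j : ℕ) : ℤ))) (τ i) i).IsHomogeneous (∑ j, lam j) := by
    simp only [Matrix.of_apply]
    by_cases h : ∀ i, 0 ≤ (lam (τ i) : ℤ) - ((τ i : ℕ) : ℤ) + ((i : ℕ) : ℤ)
    · have h1 := IsHomogeneous.prod Finset.univ (fun i => ConvexPaper.esymmZ e ((lam (τ i) : ℤ) - ((τ i : ℕ) : ℤ) + ((i : ℕ) : ℤ))) _ 
        fun i _ => esymmZ_hom e _ (h i)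
      convert h1 using 1
      zify
      have h2 : ∀ i, (((lam (τ i) : ℤ) - ((τ i : ℕ) : ℤ) + ((i : ℕ) : ℤ)).toNat : ℤ) = (lam (τ i) : ℤ) - ((τ i : ℕ) : ℤ) + ((i : ℕ) : ℤ) :=
        fun i => Int.toNat_of_nonneg (h i)
      simp only [h2, Finset.sum_add_distrib, Finset.sum_sub_distrib]
      rw [Equiv.sum_comp τ (fun i => (lam i : ℤ)), Equiv.sum_comp τ (fun i => ((i : ℕ) : ℤ))]
      ring
    · push Not at h
      obtain ⟨i, hi⟩ := h
      rw [Finset.prod_eq_zero (Finset.mem_univ i)]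
      · exact isHomogeneous_zero _ _ _
      · rw [ConvexPaper.esymmZ, if_neg (not_le.mpr hi)]
  rcases Int.units_eq_one_or (Equiv.Perm.sign τ) with h | h
  · rw [h, one_smul]; exact key
  · rw [h, Units.neg_smul, one_smul]
    exact (homogeneousSubmodule (Fin e) ℝ _).neg_mem key

theorem schurProd_hom (p : ℕ) (t : Fin p → ℕ) (N : Fin p → ℕ) (lam : ∀ i, Fin (N i) → ℕ) :
    (ConvexPaper.schurProd p t N lam).IsHomogeneous (∑ i, ∑ j, lam i j) := by
  rw [ConvexPaper.schurProd]
  exact IsHomogeneous.prod _ _ _ fun i _ => (schur_hom _ _ _).rename_isHomogeneous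

end homog

section fin
variable {ι : Type} [Fintype ι] [DecidableEq ι] {n : ℕ} {σ : Type} [Fintype σ]
variable {u : ι → EE' n} {Γ : Set (ι → ℝ)} {Fc : Finset ι → Prop} {Φ : MvPolynomial ι ℝ →ₗ[ℝ] ℝ}

theorem Geo.gv_pos (G : Geo u Γ Fc) (hF : Fc ∅) {h : ι → ℝ} (hh : h ∈ Γ) : 0 < gv u h := by
  obtain ⟨z, -, hz⟩ := G.face ∅ hF h hh
  have ho : IsOpen {x : EE' n | ∀ i, inner ℝ (u i) x < h i} := by
    have : {x : EE' n | ∀ i, inner ℝ (u i) x < h i} = ⋂ i, {x | inner ℝ (u i) x < h i} := by ext; simp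
    rw [this]
    exact isOpen_iInter_of_finite fun i => isOpen_lt (by fun_prop) (by fun_prop)
  have h1 := ho.measure_pos volume ⟨z, fun i => hz i (by simp)⟩
  have h2 : volume {x : EE' n | ∀ i, inner ℝ (u i) x < h i} ≤ volume (Pol u h) := measure_mono fun x hx i => (hx i).le
  rw [gv, measureReal_def]
  exact ENNReal.toReal_pos (h1.trans_le h2).ne' (G.bdd h).measure_lt_top.ne

theorem Geo.Nz (G : Geo u Γ Fc) (hF : Fc ∅) (hΦ : ∀ h ∈ Γ, gv u h = (n.factorial : ℝ)⁻¹ * Φ (ell h ^ n)) : Nz Φ ∅ := by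
  obtain ⟨h, hh⟩ := G.nonempty
  have h1 := G.gv_pos hF hh
  refine Nz.of (q := ell h ^ n) fun h0 => ?_
  have h2 : mon (∅ : Finset ι).val = 1 := by simp [mon]
  rw [h2, one_mul] at h0
  rw [hΦ h hh, h0, mul_zero] at h1
  exact lt_irrefl _ h1

theorem Geo.msum_mem (G : Geo u Γ Fc) {h : σ → ι → ℝ} (hh : ∀ s, h s ∈ Γ) (m : Multiset σ) (hm : m ≠ 0) : (m.map h).sum ∈ Γ := by
  induction m using Multiset.induction_on with
  | empty => exact absurd rfl hm
  | cons a m ih =>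
    rw [Multiset.map_cons, Multiset.sum_cons]
    by_cases h0 : m = 0
    · simp [h0, hh a]
    · exact G.add _ (hh a) _ (ih h0)

/-- alternating sum -/
noncomputable def alt (n : ℕ) (g : Multiset σ → ℝ) (s0 : σ) (l : List σ) : ℝ :=
  ∑ S ∈ (Finset.range n).powerset.filter (fun S => S.Nonempty),
      (-1 : ℝ) ^ (n - S.card) * g (S.val.map fun i => l.getD i s0)

theorem alt_eq (G : Geo u Γ Fc) (hΦ : ∀ h ∈ Γ, gv u h = (n.factorial : ℝ)⁻¹ * Φ (ell h ^ n)) (hn : 1 ≤ n) {h : σ → ι → ℝ} (hh : ∀ s, h s ∈ Γ)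
    (s0 : σ) (l : List σ) (hl : l.length = n) : alt n (fun m => gv u (m.map h).sum) s0 l = pullF Φ h (mon (l : Multiset σ)) := by
  have h1 := difpoly Φ (l.map h) 1 0
  have e : l.map h = (List.range n).map fun i => h (l.getD i s0) := by
    apply List.ext_getElem
    · simp [hl]
    · intro i h1 h2
      simp only [List.length_map] at h1
      simp [h1]
  have e2 : (l.map h).length = n := by simp [hl]
  rw [e2] at h1
  have h2 : pullF Φ h (mon (l : Multiset σ)) = Φ (1 * ((l.map h).map ell).prod) := by
    rw [pullF_apply, mon, map_multiset_prod, one_mul, List.map_map, Multiset.map_map, Multiset.map_coe, Multiset.prod_coe]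
    congr 3
    funext s
    simp
  rw [h2]
  have hfac : (0 : ℝ) < n.factorial := by positivity
  have h3 : Φ (1 * ((l.map h).map ell).prod) = (n.factorial : ℝ)⁻¹ * dif (l.map h) (fun h => Φ (1 * ell h ^ n)) 0 := by
    rw [h1]; field_simp
  rw [h3]
  conv_rhs => rw [e]
  rw [dif_range, alt, Finset.mul_sum, Finset.sum_filter]
  refine Finset.sum_congr rfl fun S _ => ?_
  split_ifs with hS
  · have h4 : ((S.val.map fun i => l.getD i s0).map h).sum ∈ Γ := G.msum_mem hh _ (by
      intro h0
      rw [Multiset.map_eq_zero, Finset.val_eq_zero] at h0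
      simp [h0] at hS)
    rw [hΦ _ h4, one_mul, zero_add, Multiset.map_map]
    simp only [Finset.sum, Function.comp_def]
    ring
  · rw [Finset.not_nonempty_iff_eq_empty] at hS
    subst hS
    simp [show n ≠ 0 by omega]

theorem mixedVol_alt (K : σ → Set (EE' n)) (s0 : σ) (l : List σ) (hl : l.length = n) :
    ConvexPaper.mixedVol n (l.map K) = (n.factorial : ℝ)⁻¹ * alt n (fun m => volume.real (m.map K).sum) s0 l := by
  rw [ConvexPaper.mixedVol, alt]
  congr 1
  refine Finset.sum_congr rfl fun S hS => ?_
  rw [measureReal_def, Multiset.map_map]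
  congr 3
  change _ = ∑ i ∈ S, K (l.getD i s0)
  refine Finset.sum_congr rfl fun i hi => ?_
  rw [Finset.mem_filter, Finset.mem_powerset] at hS
  have := Finset.mem_range.mp (hS.1 hi)
  simp [hl, this]

theorem AFpos.two {Ψ : MvPolynomial σ ℝ →ₗ[ℝ] ℝ} (h : AFpos Ψ 2) (a b : σ) : Ψ (X a * X a) * Ψ (X b * X b) ≤ Ψ (X a * X b) ^ 2 := by
  classical
  have h1 := (h.2 0 rfl).2 (Pi.single a 1) (Pi.single b 1)
  have h2 := h.1 {a, a} rfl
  simp only [bf_apply, ell_single, one_smul, mon, Multiset.map_zero, Multiset.prod_zero, one_mul] at h1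
  simp only [mon, Multiset.insert_eq_cons, Multiset.map_cons, Multiset.map_singleton, Multiset.prod_cons, Multiset.prod_singleton] at h2
  exact h1 h2

variable {A : Type} [Fintype A]

noncomputable def ml {σ : Type} (v : A → σ) (μ : A →₀ ℕ) : List σ := (((Finset.univ : Finset A).toList.map fun i => List.replicate (μ i) (v i)).flatten)

theorem mon_ml (v : A → σ) (μ : A →₀ ℕ) : mon (ml v μ : Multiset σ) = rename v (monomial μ (1:ℝ)) := by
  rw [ml, rename_monomial]
  have : ∀ L : List A, mon (((L.map fun i => List.replicate (μ i) (v i)).flatten : List σ) : Multiset σ) = (L.map fun i => (X (v i) : MvPolynomial σ ℝ) ^ (μ i)).prod := by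
    intro L
    induction L with
    | nil => simp [mon]
    | cons a L ih =>
      rw [List.map_cons, List.flatten_cons, ← Multiset.coe_add, mon_add, ih, Multiset.coe_replicate, mon_rep, List.map_cons, List.prod_cons]
  rw [this, Finset.prod_map_toList, ← rename_monomial, monomial_eq, map_mul, Finsupp.prod_fintype _ _ (by simp)]
  simp

theorem ml_length (v : A → σ) (μ : A →₀ ℕ) : (ml v μ).length = μ.degree := by
  rw [ml, List.length_flatten, List.map_map, Finsupp.degree_eq_sum]
  simp [Function.comp_def]

theorem ml_map {τ : Type*} (f : σ → Set τ) (v : A → σ) (μ : A →₀ ℕ) : 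
    (ml v μ).map f = (((Finset.univ : Finset A).toList.map fun i => List.replicate (μ i) (f (v i))).flatten) := by
  rw [ml, List.map_flatten, List.map_map]
  simp [Function.comp_def]

end fin
end AFS
end PartV

open MeasureTheory
open scoped Pointwise

namespace AFS

open MvPolynomial

section assembly
variable {n : ℕ} {A : Type} [Fintype A]

/-- approximants of `polyMixedVol` -/
noncomputable def pAlt (n : ℕ) (P : MvPolynomial A ℝ) (g : Multiset (A ⊕ Bool) → ℝ) (a b : Bool) : ℝ :=
  ∑ μ ∈ P.support, P.coeff μ * ((n.factorial : ℝ)⁻¹ * alt n g (Sum.inr true) (ml Sum.inl μ ++ [Sum.inr a, Sum.inr b]))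

theorem pAlt_poly (P : MvPolynomial A ℝ) (d : ℕ) (hP : P.IsHomogeneous d) (hd : d + 2 = n) (K : A ⊕ Bool → Set (EE' n)) (a b : Bool) :
    ConvexPaper.polyMixedVol n P (fun x => K (Sum.inl x)) [K (Sum.inr a), K (Sum.inr b)] =
      pAlt n P (fun m => volume.real (m.map K).sum) a b := by
  rw [ConvexPaper.polyMixedVol, pAlt]
  refine Finset.sum_congr rfl fun μ hμ => ?_
  congr 1
  have hdeg : μ.degree = d := by
    have := hP (mem_support_iff.mp hμ)
    rw [Finsupp.degree_eq_weight_one]; exact this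
  rw [← mixedVol_alt K _ _ (by simp [ml_length, hdeg, hd])]
  rw [List.map_append, ml_map]
  rfl

theorem pAlt_pull {ι : Type} [Fintype ι] [DecidableEq ι] 
    {u : ι → EE' n} {Γ : Set (ι → ℝ)} {Fc : Finset ι → Prop} {Φ : MvPolynomial ι ℝ →ₗ[ℝ] ℝ}
    (G : Geo u Γ Fc) (hΦ : ∀ h ∈ Γ, gv u h = (n.factorial : ℝ)⁻¹ * Φ (ell h ^ n)) (hn : 1 ≤ n) {h : A ⊕ Bool → ι → ℝ} (hh : ∀ s, h s ∈ Γ)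
    (P : MvPolynomial A ℝ) (d : ℕ) (hP : P.IsHomogeneous d) (hd : d + 2 = n) (a b : Bool) :
    pAlt n P (fun m => gv u (m.map h).sum) a b = (n.factorial : ℝ)⁻¹ * mulF (pullF Φ h) (rename Sum.inl P) (X (Sum.inr a) * X (Sum.inr b)) := by
  rw [mulF_apply, pAlt]
  conv_rhs => rw [P.as_sum, map_sum, Finset.sum_mul, map_sum, Finset.mul_sum]
  refine Finset.sum_congr rfl fun μ hμ => ?_
  have hdeg : μ.degree = d := by
    have := hP (mem_support_iff.mp hμ)
    rw [Finsupp.degree_eq_weight_one]; exact this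
  rw [alt_eq G hΦ hn hh _ _ (by simp [ml_length, hdeg, hd])]
  have h1 : mon ((ml Sum.inl μ ++ [Sum.inr a, Sum.inr b] : List (A ⊕ Bool)) : Multiset (A ⊕ Bool)) =
      rename Sum.inl (monomial μ (1:ℝ)) * (X (Sum.inr a) * X (Sum.inr b)) := by
    rw [← Multiset.coe_add, mon_add, mon_ml]
    congr 1
    simp [mon]
  have h2 : monomial μ (P.coeff μ) = P.coeff μ • monomial μ (1:ℝ) := by rw [smul_monomial, smul_eq_mul, mul_one]
  rw [h1, h2, map_smul, smul_mul_assoc, map_smul, smul_eq_mul]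
  ring

theorem pAlt_tendsto (P : MvPolynomial A ℝ) (T : Finset (Multiset (A ⊕ Bool))) (hT : ∀ m : Multiset (A ⊕ Bool), m ≠ 0 → m.card ≤ n → m ∈ T)
    (g : ℕ → Multiset (A ⊕ Bool) → ℝ) (g0 : Multiset (A ⊕ Bool) → ℝ) 
    (hg : ∀ m ∈ T, Filter.Tendsto (fun k => g k m) Filter.atTop (nhds (g0 m))) (a b : Bool) :
    Filter.Tendsto (fun k => pAlt n P (g k) a b) Filter.atTop (nhds (pAlt n P g0 a b)) := by
  refine tendsto_finsetSum _ fun μ _ => (Filter.Tendsto.const_mul _ (Filter.Tendsto.const_mul _ ?_))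
  refine tendsto_finsetSum _ fun S hS => Filter.Tendsto.const_mul _ (hg _ (hT _ ?_ ?_))
  · intro h0
    rw [Multiset.map_eq_zero, Finset.val_eq_zero] at h0
    simp [h0] at hS
  · rw [Finset.mem_filter, Finset.mem_powerset] at hS
    have := Finset.card_le_card hS.1
    simpa using this

theorem finite_T (n : ℕ) : ∃ T : Finset (Multiset (A ⊕ Bool)), 0 ∉ T ∧ ∀ m : Multiset (A ⊕ Bool), m ≠ 0 → m.card ≤ n → m ∈ T := by
  classical
  refine ⟨(n • (Finset.univ : Finset (A ⊕ Bool)).val).powerset.toFinset.erase 0, by simp, fun m h0 hm => ?_⟩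
  rw [Finset.mem_erase, Multiset.mem_toFinset, Multiset.mem_powerset, Multiset.le_iff_count]
  refine ⟨h0, fun a => ?_⟩
  rw [Multiset.count_nsmul, Multiset.count_eq_one_of_mem Finset.univ.nodup (Finset.mem_univ a)]
  have := Multiset.count_le_card a m
  omega

theorem main_thm (p : ℕ) (t : Fin p → ℕ) (N : Fin p → ℕ) (lam : ∀ i, Fin (N i) → ℕ)
    (hanti : ∀ i, Antitone (lam i)) (hle : ∀ i j, lam i j ≤ t i) (hdeg : (∑ i, ∑ j, lam i j) + 2 = n)
    (K : ((i : Fin p) × Fin (t i)) ⊕ Bool → Set (EE' n)) (hK : ∀ s, CC (K s)) (hKn : ∀ s, (K s).Nonempty) :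
    let Q := fun a b => pAlt n (ConvexPaper.schurProd p t N lam) (fun m => volume.real (m.map K).sum) a b
    Q true true * Q false false ≤ Q true false ^ 2 := by
  intro Q
  have hn : 1 ≤ n := by omega
  obtain ⟨T, hT0, hT⟩ := finite_T (A := (i : Fin p) × Fin (t i)) n
  have key : ∀ k : ℕ, ∃ g : Multiset (((i : Fin p) × Fin (t i)) ⊕ Bool) → ℝ, 
      (∀ m ∈ T, |g m - volume.real (m.map K).sum| ≤ 1 / ((k : ℝ) + 1)) ∧ 
      pAlt n (ConvexPaper.schurProd p t N lam) g true true * pAlt n (ConvexPaper.schurProd p t N lam) g false false ≤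
        pAlt n (ConvexPaper.schurProd p t N lam) g true false ^ 2 := by
    intro k
    obtain ⟨ι, i1, i2, u, Γ, Fc, G, hF, h, hh, hg⟩ := geo_approx hn ⟨Sum.inr true⟩ K hK hKn T hT0 (1 / ((k : ℝ) + 1)) (by positivity)
    refine ⟨_, hg, ?_⟩
    obtain ⟨Φ, hΦ, Al⟩ := G.alg
    have hA := Al.AFpos G (G.Nz hF hΦ) h hh
    have hn2 : n = 2 + ∑ i, ∑ j, lam i j := by omega
    have hA2 := AFpos.mul_schurProd (Φ := pullF Φ h) ⟨Sum.inr true⟩ p t N lam hanti hle Sum.inl 2 (hn2 ▸ hA)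
    have h3 := hA2.two (Sum.inr true) (Sum.inr false)
    have hH := schurProd_hom p t N lam
    rw [pAlt_pull G hΦ hn hh _ _ hH hdeg, pAlt_pull G hΦ hn hh _ _ hH hdeg, pAlt_pull G hΦ hn hh _ _ hH hdeg]
    have h4 : 0 ≤ ((n.factorial : ℝ)⁻¹) ^ 2 := by positivity
    have h5 := mul_le_mul_of_nonneg_left h3 h4
    refine le_trans (le_of_eq ?_) (h5.trans (le_of_eq ?_)) <;> ring
  choose g hg1 hg2 using key
  have hlim : ∀ m ∈ T, Filter.Tendsto (fun k => g k m) Filter.atTop (nhds (volume.real (m.map K).sum)) := by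
    intro m hm
    rw [tendsto_iff_dist_tendsto_zero]
    refine squeeze_zero (fun _ => dist_nonneg) (fun k => ?_) tendsto_one_div_add_atTop_nhds_zero_nat
    rw [Real.dist_eq]
    exact hg1 k m hm
  have hl := pAlt_tendsto (ConvexPaper.schurProd p t N lam) T hT g _ hlim
  exact le_of_tendsto_of_tendsto' ((hl true true).mul (hl false false)) ((hl true false).pow 2) hg2

end assembly
end AFS

namespace ConvexPaper

/-- Alexandrov–Fenchel inequality for valuations of Schur type:
for tuples `E_i` of convex bodies and partitions `λ^i` with `λ^i_1 ≤ t_i` and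
`Σ|λ^i| = n−2`, the function `Θ(M,N) = V(s_{λ^1}(E_1),…,s_{λ^p}(E_p),M,N)` satisfies
`Θ(M,N)² ≥ Θ(M,M)·Θ(N,N)` for all convex bodies `M, N`. -/
theorem statement17 (n p : ℕ) (hn : 2 ≤ n)
    (t : Fin p → ℕ) (K : ∀ i : Fin p, Fin (t i) → ConvexBody (En n))
    (N : Fin p → ℕ) (lam : ∀ i, Fin (N i) → ℕ)
    (hanti : ∀ i, Antitone (lam i)) (hle : ∀ i j, lam i j ≤ t i)
    (hdeg : (∑ i, ∑ j, lam i j) = n - 2)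
    (M L : ConvexBody (En n)) :
    polyMixedVol n (schurProd p t N lam) (fun x => (K x.1 x.2 : Set (En n)))
        [(M : Set (En n)), (M : Set (En n))] *
      polyMixedVol n (schurProd p t N lam) (fun x => (K x.1 x.2 : Set (En n)))
        [(L : Set (En n)), (L : Set (En n))] ≤
    (polyMixedVol n (schurProd p t N lam) (fun x => (K x.1 x.2 : Set (En n)))
        [(M : Set (En n)), (L : Set (En n))]) ^ 2 := by
  let B : ((i : Fin p) × Fin (t i)) ⊕ Bool → ConvexBody (En n) :=
    Sum.elim (fun x => K x.1 x.2) (fun b => if b then M else L)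
  have hd : (∑ i, ∑ j, lam i j) + 2 = n := by omega
  have h := AFS.main_thm p t N lam hanti hle hd (fun s => (B s : Set (En n)))
    (fun s => ⟨(B s).convex, (B s).isCompact⟩) (fun s => (B s).nonempty)
  have e := fun a b => AFS.pAlt_poly (schurProd p t N lam) _ (AFS.schurProd_hom p t N lam) hd (fun s => (B s : Set (En n))) a b
  simp only [← e] at h
  exact h

end ConvexPaper
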